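/- arXiv:1703.08086 — 2 statements merged into one kernel-verified Lean document; each statement's English description precedes it below -/
import Mathlib

section
/- Let q = p^r ≥ 3 be a prime power. Let f and f + g be permutation polynomials of F_q, where f has Carlitz rank Crk(f) = n ≥ 1 and f belongs to the class L₁, and where g ∈ F_q[x] has degree k with 1 ≤ k < q − 1. Then n·k + k(k−1)·√q ≥ q − ν − n, where ν = gcd(k, q−1) and √q denotes the real square root of q. -/
/-- The map induced by `P_n(x) = (…((a₀x+a₁)^{q-2}+a₂)^{q-2}…+aₙ)^{q-2}+a_{n+1}`. -/
def carlitzMap {F : Type*} [Field F] (q : ℕ) (a : ℕ → F) : ℕ → F → F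
  | 0 => fun x => a 0 * x + a 1
  | n + 1 => fun x => (carlitzMap q a n x) ^ (q - 2) + a (n + 2)

/-- `a` gives a valid representation of `f` as `P_n` (so `a 0 ≠ 0` and `a i ≠ 0` for
`2 ≤ i ≤ n`, and `f c = P_n(c)` for all `c`). -/
def IsCarlitzRep {F : Type*} [Field F] (q : ℕ) (f : F → F) (n : ℕ) (a : ℕ → F) : Prop :=
  a 0 ≠ 0 ∧ (∀ i, 2 ≤ i → i ≤ n → a i ≠ 0) ∧ ∀ c, f c = carlitzMap q a n c

/-- The Carlitz rank of `f` is `n`: `n` is the least length of a representation of `f`. -/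
def HasCarlitzRank {F : Type*} [Field F] (q : ℕ) (f : F → F) (n : ℕ) : Prop :=
  IsLeast {m | ∃ a : ℕ → F, IsCarlitzRep q f m a} n

/-- `α_0 = 0`, `α_1 = a_0`, `α_k = a_k α_{k-1} + α_{k-2}`. -/
def carlitzAlpha {F : Type*} [Field F] (a : ℕ → F) : ℕ → F
  | 0 => 0
  | 1 => a 0
  | k + 2 => a (k + 2) * carlitzAlpha a (k + 1) + carlitzAlpha a k

/-- `β_0 = 1`, `β_1 = a_1`, `β_k = a_k β_{k-1} + β_{k-2}`. -/
def carlitzBeta {F : Type*} [Field F] (a : ℕ → F) : ℕ → F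
  | 0 => 1
  | 1 => a 1
  | k + 2 => a (k + 2) * carlitzBeta a (k + 1) + carlitzBeta a k

/-- `f ∈ L₁` (with Carlitz rank `n ≥ 1`): `f` admits a representation of length
`n = Crk(f)` with `α_n ≠ 0`. -/
def MemL1 {F : Type*} [Field F] (q : ℕ) (f : F → F) (n : ℕ) : Prop :=
  HasCarlitzRank q f n ∧ 1 ≤ n ∧
    ∃ a : ℕ → F, IsCarlitzRep q f n a ∧ carlitzAlpha a n ≠ 0

section PoleFiltration

variable {F : Type*} [Field F]

/-- The field of Laurent series. -/
def Laurent (F : Type*) [Field F] : Type _ := HahnSeries ℤ F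

noncomputable instance : Field (Laurent F) := inferInstanceAs (Field (HahnSeries ℤ F))

noncomputable instance : Algebra F (Laurent F) :=
  (HahnSeries.instAlgebra : Algebra F (HahnSeries ℤ F))

namespace Laurent

/-- The coefficients of a Laurent series. -/
def coeff (f : Laurent F) (n : ℤ) : F := HahnSeries.coeff f n

/-- The order of vanishing of a Laurent series. -/
noncomputable def order (f : Laurent F) : ℤ := HahnSeries.order (f : HahnSeries ℤ F)

@[simp] theorem coeff_zero (n : ℤ) : (0 : Laurent F).coeff n = 0 := rfl

@[simp] theorem coeff_add (f g : Laurent F) (n : ℤ) :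
    (f + g).coeff n = f.coeff n + g.coeff n := rfl

@[simp] theorem coeff_sub (f g : Laurent F) (n : ℤ) :
    (f - g).coeff n = f.coeff n - g.coeff n := rfl

@[simp] theorem coeff_smul (c : F) (f : Laurent F) (n : ℤ) :
    (c • f).coeff n = c * f.coeff n := rfl

theorem coeff_one (n : ℤ) : (1 : Laurent F).coeff n = if n = 0 then 1 else 0 :=
  HahnSeries.coeff_one.trans (by congr)

theorem coeff_eq_zero_of_lt_order {f : Laurent F} {n : ℤ} (h : n < f.order) : f.coeff n = 0 :=
  HahnSeries.coeff_eq_zero_of_lt_order h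

theorem coeff_order_ne_zero {f : Laurent F} (hf : f ≠ 0) : f.coeff f.order ≠ 0 :=
  HahnSeries.coeff_order_eq_zero.not.mpr hf

theorem order_le_of_coeff_ne_zero {f : Laurent F} {n : ℤ} (h : f.coeff n ≠ 0) : f.order ≤ n :=
  HahnSeries.order_le_of_coeff_ne_zero h

theorem order_mul {f g : Laurent F} (hf : f ≠ 0) (hg : g ≠ 0) :
    (f * g).order = f.order + g.order :=
  HahnSeries.order_mul (x := (f : HahnSeries ℤ F)) (y := g) hf hg

end Laurent

/-- `f` has a pole of order exactly `n`. -/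
def HasPole (f : Laurent F) (n : ℤ) : Prop :=
  f.coeff (-n) ≠ 0 ∧ ∀ m < -n, f.coeff m = 0

/-- The Laurent series whose pole order is less than `w`. -/
def poleFilt (F : Type*) [Field F] (w : ℤ) : Submodule F (Laurent F) where
  carrier := {f | ∀ m ≤ -w, f.coeff m = 0}
  add_mem' ha hb m hm := by simp [ha m hm, hb m hm]
  zero_mem' := by simp
  smul_mem' c x hx m hm := by simp [hx m hm]

theorem poleFilt_mono {v w : ℤ} (h : v ≤ w) : poleFilt F v ≤ poleFilt F w :=
  fun _ hf m hm => hf m (by omega)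

theorem HasPole.ne_zero {f : Laurent F} {n : ℤ} (h : HasPole f n) : f ≠ 0 := by
  rintro rfl
  exact h.1 (by simp)

theorem hasPole_neg_order {f : Laurent F} (hf : f ≠ 0) : HasPole f (-f.order) := by
  refine ⟨?_, fun m hm => Laurent.coeff_eq_zero_of_lt_order (by omega)⟩
  rw [neg_neg]
  exact Laurent.coeff_order_ne_zero hf

theorem HasPole.eq_neg_order {f : Laurent F} {n : ℤ} (h : HasPole f n) : n = -f.order := by
  have h1 := Laurent.order_le_of_coeff_ne_zero h.1
  have h2 := (hasPole_neg_order h.ne_zero).1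
  by_contra hne
  exact h2 (h.2 _ (by omega))

theorem HasPole.unique {f : Laurent F} {n m : ℤ} (h : HasPole f n) (h' : HasPole f m) :
    n = m := h.eq_neg_order.trans h'.eq_neg_order.symm

theorem HasPole.mul {f g : Laurent F} {n m : ℤ} (hf : HasPole f n) (hg : HasPole g m) :
    HasPole (f * g) (n + m) := by
  have h := hasPole_neg_order (mul_ne_zero hf.ne_zero hg.ne_zero)
  rw [Laurent.order_mul hf.ne_zero hg.ne_zero] at h
  rw [hf.eq_neg_order, hg.eq_neg_order]
  convert h using 1
  ring

theorem hasPole_one : HasPole (1 : Laurent F) 0 :=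
  ⟨by simp [Laurent.coeff_one], fun m hm => by
    rw [Laurent.coeff_one, if_neg (by omega)]⟩

theorem HasPole.pow {f : Laurent F} {n : ℤ} (hf : HasPole f n) (i : ℕ) :
    HasPole (f ^ i) (i * n) := by
  induction i with
  | zero => simpa using hasPole_one
  | succ i ih =>
    rw [pow_succ]
    convert ih.mul hf using 1
    push_cast
    ring

theorem HasPole.smul {f : Laurent F} {n : ℤ} (hf : HasPole f n) {c : F} (hc : c ≠ 0) :
    HasPole (c • f) n :=
  ⟨by simpa using ⟨hc, hf.1⟩, fun m hm => by simp [hf.2 m hm]⟩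

theorem HasPole.mem_poleFilt_iff {f : Laurent F} {n w : ℤ} (h : HasPole f n) :
    f ∈ poleFilt F w ↔ n < w := by
  constructor
  · intro hf
    by_contra hn
    exact h.1 (hf _ (by omega))
  · exact fun hn m hm => h.2 m (by omega)

theorem HasPole.add_of_lt {f g : Laurent F} {n : ℤ} (hf : HasPole f n)
    (hg : g ∈ poleFilt F n) : HasPole (f + g) n :=
  ⟨by simpa [hg (-n) le_rfl] using hf.1, fun m hm => by simp [hf.2 m hm, hg m hm.le]⟩

theorem hasPole_or_mem_poleFilt {f : Laurent F} {n : ℤ} (hf : f ∈ poleFilt F (n + 1)) :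
    HasPole f n ∨ f ∈ poleFilt F n := by
  by_cases h : f.coeff (-n) = 0
  · right
    intro m hm
    rcases hm.lt_or_eq with h1 | rfl
    · exact hf m (by omega)
    · exact h
  · exact Or.inl ⟨h, fun m hm => hf m (by omega)⟩

theorem mul_mem_poleFilt {f g : Laurent F} {n m : ℤ} (hf : f ∈ poleFilt F (n + 1))
    (hg : g ∈ poleFilt F (m + 1)) : f * g ∈ poleFilt F (n + m + 1) := by
  by_cases hf0 : f = 0
  · simp [hf0]
  by_cases hg0 : g = 0
  · simp [hg0]
  have h1 := hasPole_neg_order hf0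
  have h2 := hasPole_neg_order hg0
  rw [h1.mem_poleFilt_iff] at hf
  rw [h2.mem_poleFilt_iff] at hg
  rw [(h1.mul h2).mem_poleFilt_iff]
  omega

theorem pow_mem_poleFilt {f : Laurent F} {n : ℤ} (hf : f ∈ poleFilt F (n + 1)) (i : ℕ) :
    f ^ i ∈ poleFilt F (i * n + 1) := by
  induction i with
  | zero =>
    rw [pow_zero, hasPole_one.mem_poleFilt_iff]
    simp
  | succ i ih =>
    rw [pow_succ]
    convert mul_mem_poleFilt ih hf using 2
    push_cast
    ring

/-- Every nonzero element of `V` has a pole or a nonzero constant term. -/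
def NoZeroAtPole (V : Submodule F (Laurent F)) : Prop :=
  ∀ f ∈ V, f ∈ poleFilt F 0 → f = 0

/-- The set of pole orders of elements of `V`. -/
def poleSet (V : Submodule F (Laurent F)) : Set ℕ :=
  {n | ∃ f ∈ V, HasPole f n}

theorem NoZeroAtPole.exists_hasPole {V : Submodule F (Laurent F)} (hV : NoZeroAtPole V)
    {f : Laurent F} (hf : f ∈ V) (h0 : f ≠ 0) : ∃ n : ℕ, HasPole f n := by
  have h := hasPole_neg_order h0
  by_cases hn : 0 ≤ -f.order
  · refine ⟨(-f.order).toNat, ?_⟩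
    rwa [Int.toNat_of_nonneg hn]
  · exact absurd (hV f hf (h.mem_poleFilt_iff.mpr (by omega))) h0

theorem finiteDimensional_inf_poleFilt {V : Submodule F (Laurent F)} (hV : NoZeroAtPole V)
    (w : ℕ) : FiniteDimensional F ↥(V ⊓ poleFilt F w) := by
  let c : ↥(V ⊓ poleFilt F w) →ₗ[F] (Fin w → F) :=
    { toFun := fun f i => f.1.coeff (-(i : ℤ))
      map_add' := fun _ _ => by ext; simp
      map_smul' := fun _ _ => by ext; simp }
  refine FiniteDimensional.of_injective c ?_
  rw [← LinearMap.ker_eq_bot, LinearMap.ker_eq_bot']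
  intro f hf
  apply Subtype.ext
  refine hV f.1 f.2.1 fun m hm => ?_
  by_cases h : m ≤ -w
  · exact f.2.2 m h
  · have := congrFun hf ⟨(-m).toNat, by omega⟩
    have h2 : (-((-m).toNat : ℤ)) = m := by omega
    change f.1.coeff (-((-m).toNat : ℤ)) = 0 at this
    rwa [h2] at this

open Classical in
theorem finrank_inf_poleFilt {V : Submodule F (Laurent F)} (hV : NoZeroAtPole V) (w : ℕ) :
    Module.finrank F ↥(V ⊓ poleFilt F w) = ((Finset.range w).filter (· ∈ poleSet V)).card := by
  induction w with
  | zero =>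
    have : V ⊓ poleFilt F (0 : ℕ) = ⊥ := by
      rw [eq_bot_iff]
      rintro f ⟨h1, h2⟩
      exact hV f h1 (by simpa using h2)
    rw [this]
    simp
  | succ w ih =>
    have := finiteDimensional_inf_poleFilt hV (w + 1)
    let c : ↥(V ⊓ poleFilt F (w + 1 : ℕ)) →ₗ[F] F :=
      { toFun := fun f => f.1.coeff (-(w : ℤ))
        map_add' := fun _ _ => by simp
        map_smul' := fun _ _ => by simp }
    have hker : Module.finrank F (LinearMap.ker c) = Module.finrank F ↥(V ⊓ poleFilt F w) := by
      have hle : V ⊓ poleFilt F w ≤ V ⊓ poleFilt F (w + 1 : ℕ) :=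
        inf_le_inf_left _ (poleFilt_mono (by push_cast; omega))
      have h2 : (LinearMap.ker c).map (Submodule.subtype _) = V ⊓ poleFilt F w := by
        ext f
        simp only [Submodule.mem_map, LinearMap.mem_ker, Submodule.subtype_apply]
        constructor
        · rintro ⟨g, hg, rfl⟩
          refine ⟨g.2.1, fun m hm => ?_⟩
          rcases hm.lt_or_eq with h1 | rfl
          · exact g.2.2 m (by push_cast; omega)
          · exact hg
        · intro hf
          exact ⟨⟨f, hle hf⟩, hf.2 _ le_rfl, rfl⟩
      rw [← h2]
      exact (LinearEquiv.finrank_eq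
        (Submodule.equivMapOfInjective _ (Submodule.injective_subtype _) _))
    have hrn := LinearMap.finrank_range_add_finrank_ker c
    rw [hker, ih] at hrn
    rw [← hrn, Finset.range_add_one, Finset.filter_insert]
    split_ifs with hw
    · rw [Finset.card_insert_of_notMem (by simp), add_comm]
      congr 1
      have : LinearMap.range c = ⊤ := by
        obtain ⟨f, hf, hp⟩ := hw
        rw [LinearMap.range_eq_top]
        intro y
        have hf' : f ∈ V ⊓ poleFilt F (w + 1 : ℕ) :=
          ⟨hf, hp.mem_poleFilt_iff.mpr (by push_cast; omega)⟩
        refine ⟨(y / f.coeff (-(w : ℤ))) • ⟨f, hf'⟩, ?_⟩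
        rw [map_smul]
        exact div_mul_cancel₀ _ hp.1
      rw [this, finrank_top, Module.finrank_self]
    · have : LinearMap.range c = ⊥ := by
        rw [LinearMap.range_eq_bot]
        ext f
        by_contra h
        exact hw ⟨f.1, f.2.1, h, fun m hm => f.2.2 m (by push_cast; omega)⟩
      rw [this, finrank_bot, zero_add]

end PoleFiltration

section PoleEmbedding

variable {F : Type*} [Field F]

/-- A realisation of an `F`-algebra as a ring of Laurent series, all of whose nonzero elements
have a pole or a nonzero constant term, and such that all but finitely many pole orders occur. -/
structure PoleEmbedding (F R : Type*) [Field F] [CommRing R] [Algebra F R] where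
  toAlgHom : R →ₐ[F] Laurent F
  eq_zero_of_mem : ∀ x, toAlgHom x ∈ poleFilt F 0 → x = 0
  gaps : Finset ℕ
  mem_gaps : ∀ n, n ∈ gaps ↔ ¬ ∃ x, HasPole (toAlgHom x) n

namespace PoleEmbedding

variable {R : Type*} [CommRing R] [Algebra F R] (e : PoleEmbedding F R)

/-- The number of gaps. -/
def genus : ℕ := e.gaps.card

theorem injective : Function.Injective e.toAlgHom := by
  rw [injective_iff_map_eq_zero]
  intro x hx
  exact e.eq_zero_of_mem x (by rw [hx]; exact zero_mem _)

include e in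
theorem isDomain : IsDomain R := e.injective.isDomain e.toAlgHom

/-- The elements whose pole order is less than `w`. -/
noncomputable def filt (w : ℤ) : Submodule F R := (poleFilt F w).comap e.toAlgHom.toLinearMap

theorem mem_filt {w : ℤ} {x : R} : x ∈ e.filt w ↔ e.toAlgHom x ∈ poleFilt F w := Iff.rfl

theorem filt_mono {v w : ℤ} (h : v ≤ w) : e.filt v ≤ e.filt w :=
  fun _ hx => poleFilt_mono h hx

/-- The pole orders of the elements of a subspace. -/
def poles (W : Submodule F R) : Set ℕ := {n | ∃ x ∈ W, HasPole (e.toAlgHom x) n}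

theorem poles_eq (W : Submodule F R) : e.poles W = poleSet (W.map e.toAlgHom.toLinearMap) := by
  ext n
  simp [poles, poleSet]

theorem poles_mono {V W : Submodule F R} (h : V ≤ W) : e.poles V ⊆ e.poles W :=
  fun _ ⟨f, hf, hn⟩ => ⟨f, h hf, hn⟩

theorem noZeroAtPole (W : Submodule F R) : NoZeroAtPole (W.map e.toAlgHom.toLinearMap) := by
  rintro _ ⟨x, -, rfl⟩ hx
  rw [e.eq_zero_of_mem x hx, map_zero]

theorem exists_hasPole {x : R} (hx : x ≠ 0) : ∃ n : ℕ, HasPole (e.toAlgHom x) n := by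
  refine (e.noZeroAtPole ⊤).exists_hasPole (Submodule.mem_map_of_mem (Submodule.mem_top (x := x)))
    ?_
  exact (map_ne_zero_iff _ e.injective).mpr hx

theorem notMem_gaps {n : ℕ} : n ∉ e.gaps ↔ n ∈ e.poles ⊤ := by
  rw [e.mem_gaps, not_not]
  simp [poles]

/-- The restriction of the embedding to the part of a subspace with bounded poles. -/
noncomputable def infFiltEquiv (W : Submodule F R) (w : ℤ) :
    ↥(W ⊓ e.filt w) ≃ₗ[F] ↥(W.map e.toAlgHom.toLinearMap ⊓ poleFilt F w) :=
  (Submodule.equivMapOfInjective e.toAlgHom.toLinearMap e.injective (W ⊓ e.filt w)).trans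
    (LinearEquiv.ofEq _ _ (by
      ext f
      constructor
      · rintro ⟨x, hx, rfl⟩
        exact ⟨⟨x, hx.1, rfl⟩, hx.2⟩
      · rintro ⟨⟨x, hx, rfl⟩, h⟩
        exact ⟨x, ⟨hx, h⟩, rfl⟩))

theorem finiteDimensional_inf_filt (W : Submodule F R) (w : ℕ) :
    FiniteDimensional F ↥(W ⊓ e.filt w) := by
  have := finiteDimensional_inf_poleFilt (e.noZeroAtPole W) w
  exact Module.Finite.equiv (e.infFiltEquiv W w).symm

open Classical in
theorem finrank_inf_filt (W : Submodule F R) (w : ℕ) :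
    Module.finrank F ↥(W ⊓ e.filt w) = ((Finset.range w).filter (· ∈ e.poles W)).card := by
  rw [(e.infFiltEquiv W w).finrank_eq, finrank_inf_poleFilt (e.noZeroAtPole W), poles_eq]

instance (w : ℕ) : FiniteDimensional F ↥(e.filt w) := by
  have := e.finiteDimensional_inf_filt ⊤ w
  rwa [top_inf_eq] at this

open Classical in
theorem finrank_filt (w : ℕ) :
    Module.finrank F ↥(e.filt w) = ((Finset.range w).filter (· ∉ e.gaps)).card := by
  have := e.finrank_inf_filt ⊤ w
  rw [top_inf_eq] at this
  simp only [this, notMem_gaps]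

theorem finrank_filt_le (w : ℕ) : Module.finrank F ↥(e.filt w) ≤ w := by
  classical
  rw [finrank_filt]
  exact (Finset.card_filter_le _ _).trans (by simp)

theorem le_finrank_filt (w : ℕ) : w ≤ Module.finrank F ↥(e.filt w) + e.genus := by
  classical
  rw [finrank_filt, genus]
  have h := Finset.card_filter_add_card_filter_not (s := Finset.range w) (· ∉ e.gaps)
  have h2 : ((Finset.range w).filter (¬ · ∉ e.gaps)).card ≤ e.gaps.card :=
    Finset.card_le_card fun x hx => by simpa using (Finset.mem_filter.mp hx).2
  rw [Finset.card_range] at h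
  omega

theorem sup_filt_eq_top {V : Submodule F R} {N : ℕ}
    (hN : ∀ n, n ∈ e.poles ⊤ → n ∉ e.poles V → n < N) : V ⊔ e.filt N = ⊤ := by
  rw [eq_top_iff]
  have key : ∀ m : ℕ, e.filt m ≤ V ⊔ e.filt N := by
    intro m
    induction m with
    | zero => exact le_sup_of_le_right (e.filt_mono (by omega))
    | succ m ih =>
      intro x hx
      rcases hasPole_or_mem_poleFilt (n := m) (by simpa [mem_filt] using hx) with h | h
      · by_cases hm : m ∈ e.poles V
        · obtain ⟨y, hy, hp⟩ := hm
          set c := (e.toAlgHom x).coeff (-(m : ℤ)) / (e.toAlgHom y).coeff (-(m : ℤ)) with hc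
          have h1 : x - c • y ∈ V ⊔ e.filt N := by
            refine ih fun k hk => ?_
            have h2 : (e.toAlgHom (x - c • y)).coeff k =
                (e.toAlgHom x).coeff k - c * (e.toAlgHom y).coeff k := by simp
            change (e.toAlgHom (x - c • y)).coeff k = 0
            rw [h2]
            rcases hk.lt_or_eq with h1 | rfl
            · rw [h.2 k h1, hp.2 k h1]
              ring
            · rw [hc, div_mul_cancel₀ _ hp.1, sub_self]
          have h2 : c • y ∈ V ⊔ e.filt N := Submodule.mem_sup_left (V.smul_mem c hy)
          simpa using add_mem h1 h2
        · have hlt := hN m ⟨x, Submodule.mem_top, h⟩ hm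
          exact Submodule.mem_sup_right (h.mem_poleFilt_iff.mpr (by exact_mod_cast hlt))
      · exact ih h
  intro x _
  by_cases hx : x = 0
  · rw [hx]
    exact zero_mem _
  · obtain ⟨n, hn⟩ := e.exists_hasPole hx
    exact key (n + 1) (hn.mem_poleFilt_iff.mpr (by push_cast; omega))

theorem finite_quotient_and_finrank_eq {V : Submodule F R}
    (hV : (e.poles ⊤ \ e.poles V).Finite) :
    Module.Finite F (R ⧸ V) ∧ Module.finrank F (R ⧸ V) = (e.poles ⊤ \ e.poles V).ncard := by
  classical
  obtain ⟨N, hN⟩ := hV.bddAbove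
  have hN' : ∀ n, n ∈ e.poles ⊤ → n ∉ e.poles V → n < N + 1 :=
    fun n h1 h2 => Nat.lt_succ_of_le (hN ⟨h1, h2⟩)
  have htop := e.sup_filt_eq_top hN'
  have q1 := LinearMap.quotientInfEquivSupQuotient (e.filt (N + 1 : ℕ)) V
  rw [sup_comm, htop] at q1
  have q2 : ((⊤ : Submodule F R) ⧸ Submodule.comap (Submodule.subtype ⊤) V) ≃ₗ[F] R ⧸ V :=
    Submodule.Quotient.equiv _ _ Submodule.topEquiv (by
      ext x
      simp)
  have q := q1.trans q2
  refine ⟨Module.Finite.equiv q, ?_⟩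
  rw [← q.finrank_eq]
  have h1 := Submodule.finrank_quotient_add_finrank
    (Submodule.comap (e.filt (N + 1 : ℕ)).subtype (e.filt (N + 1 : ℕ)) ⊓
      Submodule.comap (e.filt (N + 1 : ℕ)).subtype V)
  have h2 : Module.finrank F ↥(Submodule.comap (e.filt (N + 1 : ℕ)).subtype
      (e.filt (N + 1 : ℕ)) ⊓ Submodule.comap (e.filt (N + 1 : ℕ)).subtype V) =
      Module.finrank F ↥(V ⊓ e.filt (N + 1 : ℕ)) := by
    rw [Submodule.comap_subtype_self, top_inf_eq, inf_comm, ← Submodule.map_comap_subtype]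
    exact (Submodule.equivMapOfInjective _ (Submodule.injective_subtype _) _).finrank_eq
  have h3 := e.finrank_inf_filt V (N + 1)
  have h4 := e.finrank_inf_filt ⊤ (N + 1)
  rw [top_inf_eq] at h4
  rw [h2, h3, h4] at h1
  have h5 : ((Finset.range (N + 1)).filter (· ∈ e.poles ⊤)) =
      ((Finset.range (N + 1)).filter (· ∈ e.poles V)) ∪ hV.toFinset := by
    ext n
    simp only [Finset.mem_filter, Finset.mem_range, Finset.mem_union, Set.Finite.mem_toFinset,
      Set.mem_sdiff]
    constructor
    · rintro ⟨h6, h7⟩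
      by_cases h8 : n ∈ e.poles V
      · exact Or.inl ⟨h6, h8⟩
      · exact Or.inr ⟨h7, h8⟩
    · rintro (⟨h6, h7⟩ | ⟨h6, h7⟩)
      · exact ⟨h6, e.poles_mono le_top h7⟩
      · exact ⟨hN' n h6 h7, h6⟩
  rw [h5, Finset.card_union_of_disjoint] at h1
  · rw [Set.ncard_eq_toFinset_card _ hV]
    omega
  · rw [Finset.disjoint_left]
    intro n h6 h7
    exact ((Set.Finite.mem_toFinset _).mp h7).2 (Finset.mem_filter.mp h6).2

/-- The degree of an ideal. -/
noncomputable def deg (F : Type*) {R : Type*} [Field F] [CommRing R] [Algebra F R]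
    (I : Ideal R) : ℕ := Module.finrank F (R ⧸ I)

/-- The pole orders of the elements of an ideal. -/
def polesIdeal (I : Ideal R) : Set ℕ := e.poles (I.restrictScalars F)

theorem finite_and_deg_eq {I : Ideal R} (hV : (e.poles ⊤ \ e.polesIdeal I).Finite) :
    Module.Finite F (R ⧸ I) ∧ deg F I = (e.poles ⊤ \ e.polesIdeal I).ncard := by
  obtain ⟨h1, h2⟩ := e.finite_quotient_and_finrank_eq hV
  have q := Submodule.Quotient.restrictScalarsEquiv F I
  refine ⟨Module.Finite.equiv q, ?_⟩
  rw [deg, polesIdeal, ← h2]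
  exact q.finrank_eq.symm

theorem add_mem_polesIdeal {I : Ideal R} {n m : ℕ} (hn : n ∈ e.polesIdeal I)
    (hm : m ∈ e.poles ⊤) : n + m ∈ e.polesIdeal I := by
  obtain ⟨x, hx, hxn⟩ := hn
  obtain ⟨y, -, hym⟩ := hm
  refine ⟨x * y, I.mul_mem_right y hx, ?_⟩
  rw [map_mul]
  exact_mod_cast hxn.mul hym

theorem finite_compl_poles_top : (e.poles ⊤)ᶜ = ↑e.gaps := by
  ext n
  rw [Set.mem_compl_iff, ← e.notMem_gaps]
  simp

theorem finite_compl_polesIdeal {I : Ideal R} (hI : I ≠ ⊥) : (e.polesIdeal I)ᶜ.Finite := by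
  obtain ⟨a, ha, ha0⟩ := Submodule.exists_mem_ne_zero_of_ne_bot hI
  obtain ⟨n, hn⟩ := e.exists_hasPole ha0
  refine ((Finset.range n).finite_toSet.union (e.gaps.finite_toSet.image (n + ·))).subset ?_
  intro m hm
  by_cases hmn : m < n
  · exact Or.inl (by simpa using hmn)
  · right
    refine ⟨m - n, ?_, by simp; omega⟩
    by_contra hg
    refine hm ?_
    have := e.add_mem_polesIdeal ⟨a, ha, hn⟩ (e.notMem_gaps.mp hg)
    rwa [Nat.add_sub_cancel' (by omega)] at this

include e in
theorem finite_quotient {I : Ideal R} (hI : I ≠ ⊥) : Module.Finite F (R ⧸ I) :=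
  (e.finite_and_deg_eq ((e.finite_compl_polesIdeal hI).subset fun _ h => h.2)).1

theorem deg_eq {I : Ideal R} (hI : I ≠ ⊥) : deg F I = (e.poles ⊤ \ e.polesIdeal I).ncard :=
  (e.finite_and_deg_eq ((e.finite_compl_polesIdeal hI).subset fun _ h => h.2)).2

theorem ncard_compl_polesIdeal {I : Ideal R} (hI : I ≠ ⊥) :
    (e.polesIdeal I)ᶜ.ncard = deg F I + e.genus := by
  have h : (e.polesIdeal I)ᶜ = (e.poles ⊤ \ e.polesIdeal I) ∪ (e.poles ⊤)ᶜ := by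
    ext n
    have : n ∈ e.polesIdeal I → n ∈ e.poles ⊤ := fun h => e.poles_mono le_top h
    simp only [Set.mem_compl_iff, Set.mem_union, Set.mem_sdiff]
    tauto
  rw [h, Set.ncard_union_eq (hs := (e.finite_compl_polesIdeal hI).subset fun _ h => h.2)
    (ht := by rw [e.finite_compl_poles_top]; exact e.gaps.finite_toSet),
    e.deg_eq hI, e.finite_compl_poles_top, Set.ncard_coe_finset, genus]
  rw [Set.disjoint_left]
  exact fun n h1 h2 => h2 h1.1

theorem lt_of_notMem_polesIdeal {I : Ideal R} (hI : I ≠ ⊥) {w : ℕ} (hw : w ∉ e.polesIdeal I) :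
    w < deg F I + 2 * e.genus := by
  classical
  have hfin : (e.poles ⊤ \ e.polesIdeal I).Finite :=
    (e.finite_compl_polesIdeal hI).subset fun _ h => h.2
  set S := (Finset.range (w + 1)) \ (e.gaps ∪ e.gaps.image (w - ·)) with hS
  have h1 : w + 1 ≤ S.card + (e.gaps.card + e.gaps.card) := by
    have := Finset.le_card_sdiff (e.gaps ∪ e.gaps.image (w - ·)) (Finset.range (w + 1))
    have h2 := Finset.card_union_le e.gaps (e.gaps.image (w - ·))
    have h3 : (e.gaps.image (w - ·)).card ≤ e.gaps.card := Finset.card_image_le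
    rw [Finset.card_range, ← hS] at this
    omega
  have h2 : S.card ≤ deg F I := by
    rw [e.deg_eq hI, Set.ncard_eq_toFinset_card _ hfin]
    refine Finset.card_le_card fun n hn => ?_
    simp only [hS, Finset.mem_sdiff, Finset.mem_range, Finset.mem_union, Finset.mem_image,
      not_or, not_exists, not_and] at hn
    obtain ⟨h3, h4, h5⟩ := hn
    rw [Set.Finite.mem_toFinset]
    refine ⟨e.notMem_gaps.mp h4, fun h6 => hw ?_⟩
    have h7 : w - n ∉ e.gaps := fun h => h5 _ h (by omega)
    have := e.add_mem_polesIdeal h6 (e.notMem_gaps.mp h7)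
    rwa [Nat.add_sub_cancel' (by omega)] at this
  rw [genus]
  omega

open Classical in
theorem card_filter_polesIdeal {I : Ideal R} (hI : I ≠ ⊥) {w : ℕ}
    (hw : deg F I + 2 * e.genus ≤ w) :
    ((Finset.range w).filter (· ∈ e.polesIdeal I)).card + (deg F I + e.genus) = w := by
  rw [← e.ncard_compl_polesIdeal hI,
    Set.ncard_eq_toFinset_card _ (e.finite_compl_polesIdeal hI)]
  have h : (e.finite_compl_polesIdeal hI).toFinset =
      (Finset.range w).filter (¬ · ∈ e.polesIdeal I) := by
    ext n
    simp only [Set.Finite.mem_toFinset, Set.mem_compl_iff, Finset.mem_filter, Finset.mem_range]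
    exact ⟨fun h => ⟨(e.lt_of_notMem_polesIdeal hI h).trans_le hw, h⟩, fun h => h.2⟩
  rw [h, Finset.card_filter_add_card_filter_not, Finset.card_range]

theorem deg_span_singleton {a : R} {n : ℕ} (ha : HasPole (e.toAlgHom a) n) :
    deg F (Ideal.span {a}) = n := by
  classical
  have ha0 : a ≠ 0 := fun h => ha.ne_zero (by rw [h, map_zero])
  have hI : Ideal.span {a} ≠ ⊥ := by simpa [Ideal.span_singleton_eq_bot]
  have h1 := e.ncard_compl_polesIdeal hI
  have hmem : ∀ m : ℕ, m ∈ e.polesIdeal (Ideal.span {a}) ↔ n ≤ m ∧ m - n ∉ e.gaps := by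
    intro m
    constructor
    · rintro ⟨x, hx, hp⟩
      obtain ⟨y, rfl⟩ := Ideal.mem_span_singleton'.mp hx
      have hy0 : y ≠ 0 := by
        rintro rfl
        exact hp.ne_zero (by simp)
      obtain ⟨k, hk⟩ := e.exists_hasPole hy0
      rw [map_mul] at hp
      have := hp.unique (hk.mul ha)
      have h2 : m = k + n := by exact_mod_cast this
      refine ⟨by omega, e.notMem_gaps.mpr ⟨y, Submodule.mem_top, ?_⟩⟩
      rwa [show m - n = k by omega]
    · rintro ⟨h2, h3⟩
      have := e.add_mem_polesIdeal (I := Ideal.span {a})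
        ⟨a, Ideal.mem_span_singleton_self a, ha⟩ (e.notMem_gaps.mp h3)
      rwa [Nat.add_sub_cancel' h2] at this
  have h2 : (e.polesIdeal (Ideal.span {a}))ᶜ =
      ↑(Finset.range n ∪ e.gaps.image (n + ·)) := by
    ext m
    simp only [Set.mem_compl_iff, hmem, Finset.coe_union, Finset.coe_range, Finset.coe_image,
      Set.mem_union, Set.mem_Iio, Set.mem_image, Finset.mem_coe]
    constructor
    · intro h
      by_cases hm : m < n
      · exact Or.inl hm
      · right
        refine ⟨m - n, ?_, by omega⟩
        by_contra hg
        exact h ⟨by omega, hg⟩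
    · rintro (h | ⟨x, hx, rfl⟩)
      · omega
      · simpa using hx
  rw [h2, Set.ncard_coe_finset, Finset.card_union_of_disjoint, Finset.card_range,
    Finset.card_image_of_injective _ (add_right_injective n), genus] at h1
  · omega
  · rw [Finset.disjoint_left]
    intro x hx hx'
    obtain ⟨y, -, rfl⟩ := Finset.mem_image.mp hx'
    simp at hx

end PoleEmbedding

end PoleEmbedding

section Stepanov

variable {F : Type*} [Field F]

theorem exists_hasPole_sum {ι : Type*} {s : Finset ι} {f : ι → Laurent F} {n : ι → ℤ}
    (hf : ∀ i ∈ s, HasPole (f i) (n i)) (hn : Set.InjOn n s) (hs : s.Nonempty) :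
    ∃ i ∈ s, HasPole (∑ i ∈ s, f i) (n i) ∧ ∀ j ∈ s, n j ≤ n i := by
  classical
  obtain ⟨i, hi, hmax⟩ := s.exists_max_image n hs
  refine ⟨i, hi, ?_, hmax⟩
  rw [← Finset.add_sum_erase s f hi]
  refine (hf i hi).add_of_lt (sum_mem fun j hj => ?_)
  have hj' := Finset.mem_of_mem_erase hj
  rw [(hf j hj').mem_poleFilt_iff]
  exact (hmax j hj').lt_of_ne fun h => (Finset.ne_of_mem_erase hj) (hn hj' hi h)

theorem frobeniusAlgHom_pow_apply [Fintype F] {A : Type*} [CommRing A] [Algebra F A] (s : ℕ)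
    (a : A) : (FiniteField.frobeniusAlgHom F A ^ s) a = a ^ Fintype.card F ^ s := by
  induction s with
  | zero => simp
  | succ s ih =>
    rw [pow_succ', AlgHom.mul_apply, ih, FiniteField.coe_frobeniusAlgHom]
    change (a ^ Fintype.card F ^ s) ^ Fintype.card F = _
    rw [← pow_mul, ← pow_succ]

theorem PoleEmbedding.card_algHom_le {A : Type*} [CommRing A] [Algebra F A]
    (e : PoleEmbedding F A) {K : Type*} [Field K] [Algebra F K] {h : A} {n : ℕ}
    (hn : HasPole (e.toAlgHom h) n) {S : Set (A →ₐ[F] K)} (hS : ∀ φ ∈ S, φ h = 0) :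
    S.Finite ∧ S.ncard ≤ n := by
  have h0 : h ≠ 0 := by
    rintro rfl
    exact hn.ne_zero (by simp)
  have hI : Ideal.span {h} ≠ ⊥ := by simpa [Ideal.span_singleton_eq_bot]
  have hfin := e.finite_quotient hI
  have hcard := card_algHom_le_finrank F (A ⧸ Ideal.span {h}) K
  have hd := e.deg_span_singleton hn
  rw [PoleEmbedding.deg] at hd
  rw [hd] at hcard
  have hfin2 : Finite (A ⧸ Ideal.span {h} →ₐ[F] K) := inferInstance
  let g : (A ⧸ Ideal.span {h} →ₐ[F] K) → (A →ₐ[F] K) := fun ψ =>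
    ψ.comp (Ideal.Quotient.mkₐ F (Ideal.span {h}))
  have hsub : S ⊆ Set.range g := by
    intro φ hφ
    refine ⟨Ideal.Quotient.liftₐ (Ideal.span {h}) φ ?_, ?_⟩
    · intro a ha
      obtain ⟨c, rfl⟩ := Ideal.mem_span_singleton'.mp ha
      rw [map_mul, hS φ hφ, mul_zero]
    · ext a
      rfl
  have hr : (Set.range g).Finite := Set.finite_range g
  refine ⟨hr.subset hsub, (Set.ncard_le_ncard hsub hr).trans ?_⟩
  refine le_trans ?_ hcard
  rw [← Set.image_univ, ← Set.ncard_univ]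
  exact Set.ncard_image_le Set.finite_univ

theorem PoleEmbedding.ncard_le_of_frobenius {A : Type*} [CommRing A] [Algebra F A] [Fintype F]
    (e : PoleEmbedding F A) {K : Type*} [Field K] [Algebra F K] (s : ℕ)
    {J : Finset ℕ} {b : ℕ → A} (hb : ∀ n ∈ J, HasPole (e.toAlgHom (b n)) n)
    {d : ℕ} {u : ℕ → Fin d → A} {w : ℕ} (hu : ∀ n ∈ J, ∀ i, u n i ∈ e.filt (w + 1))
    {m l : ℕ} (hJ : ∀ n ∈ J, n ≤ m) (hl : l < Fintype.card F ^ s)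
    (hdim : d * (Fintype.card F ^ s * l + w + 1) <
      J.card * Module.finrank F ↥(e.filt ((l + 1 : ℕ) : ℤ)))
    {S : Set (A →ₐ[F] K)} (θ : (A →ₐ[F] K) → Fin d → K)
    (hθ : ∀ φ ∈ S, ∀ n ∈ J,
      ∑ i, φ (u n i) * θ φ i = φ (b n) ^ (Fintype.card F ^ s * Fintype.card F ^ s)) :
    S.Finite ∧ S.ncard ≤ l + Fintype.card F ^ s * m := by
  classical
  have := e.isDomain
  set r := Fintype.card F ^ s with hr
  let fr : A →ₐ[F] A := FiniteField.frobeniusAlgHom F A ^ s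
  have hfr : ∀ a, fr a = a ^ r := frobeniusAlgHom_pow_apply s
  let W := r * l + w + 1
  let T : (J → ↥(e.filt ((l + 1 : ℕ) : ℤ))) →ₗ[F] (Fin d → ↥(e.filt (W : ℕ))) :=
    LinearMap.pi fun i => (∑ j : J, (LinearMap.mulRight F (u j i)) ∘ₗ fr.toLinearMap ∘ₗ
      Submodule.subtype _ ∘ₗ LinearMap.proj j).codRestrict _ (by
        intro v
        rw [LinearMap.sum_apply]
        refine sum_mem fun j _ => ?_
        change (fr (v j : A)) * u j i ∈ _
        rw [hfr, e.mem_filt, map_mul, map_pow]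
        have h0 := e.mem_filt.mp (hu j j.2 i)
        have h1 := pow_mem_poleFilt (n := l) (by simpa [e.mem_filt] using (v j).2) r
        have h2 := mul_mem_poleFilt h1 h0
        convert h2 using 2
        simp only [W]
        push_cast
        ring)
  have hT : ∀ v i, ((T v i : ↥(e.filt (W : ℕ))) : A) = ∑ j : J, (v j : A) ^ r * u j i := by
    intro v i
    simp only [T, LinearMap.pi_apply, LinearMap.codRestrict_apply, LinearMap.sum_apply]
    refine Finset.sum_congr rfl fun j _ => ?_
    rw [← hfr]
    rfl
  have hlt : Module.finrank F (Fin d → ↥(e.filt (W : ℕ))) <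
      Module.finrank F (J → ↥(e.filt ((l + 1 : ℕ) : ℤ))) := by
    rw [Module.finrank_pi_fintype, Module.finrank_pi_fintype]
    simp only [Finset.sum_const, Finset.card_univ, Fintype.card_fin, smul_eq_mul,
      Fintype.card_coe]
    exact (Nat.mul_le_mul_left d (e.finrank_filt_le W)).trans_lt hdim
  obtain ⟨v, hv, hv0⟩ := Submodule.exists_mem_ne_zero_of_ne_bot
    (LinearMap.ker_ne_bot_of_finrank_lt hlt)
  rw [LinearMap.mem_ker] at hv
  have hv' : ∀ i, ∑ j : J, (v j : A) ^ r * u j i = 0 := fun i => by rw [← hT, hv]; rfl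
  let h : A := ∑ j : J, (v j : A) * b j ^ r
  let t : Finset J := Finset.univ.filter fun j => (v j : A) ≠ 0
  have ht : t.Nonempty := by
    by_contra hne
    refine hv0 (funext fun j => Subtype.ext ?_)
    by_contra hj
    exact hne ⟨j, by simpa [t] using hj⟩
  have hht : e.toAlgHom h = ∑ j ∈ t, e.toAlgHom ((v j : A) * b j ^ r) := by
    rw [map_sum]
    symm
    refine Finset.sum_subset (Finset.subset_univ _) fun j _ hj => ?_
    have : (v j : A) = 0 := by simpa [t] using hj
    rw [this, zero_mul, map_zero]
  have hpole : ∀ j : J, ∃ n : ℕ, j ∈ t → HasPole (e.toAlgHom (v j)) n := by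
    intro j
    by_cases hj : j ∈ t
    · obtain ⟨n, hn⟩ := e.exists_hasPole (x := v j) (by simpa [t] using hj)
      exact ⟨n, fun _ => hn⟩
    · exact ⟨0, fun h => absurd h hj⟩
  choose ν hν using hpole
  have hνl : ∀ j ∈ t, ν j ≤ l := by
    intro j hj
    have := (hν j hj).mem_poleFilt_iff.mp (v j).2
    push_cast at this
    omega
  have hterm : ∀ j ∈ t, HasPole (e.toAlgHom ((v j : A) * b j ^ r)) ((ν j + r * j : ℕ) : ℤ) := by
    intro j hj
    rw [map_mul, map_pow]
    have := (hν j hj).mul ((hb j j.2).pow r)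
    exact_mod_cast this
  have hinj : Set.InjOn (fun j : J => ((ν j + r * j : ℕ) : ℤ)) t := by
    intro i hi j hj hij
    have h1 := hνl i hi
    have h2 := hνl j hj
    have h3 : ν i + r * i = ν j + r * j := Int.ofNat_inj.mp hij
    have h4 := congrArg (· / r) h3
    have hr0 : 0 < r := by omega
    simp only [Nat.add_mul_div_left _ _ hr0] at h4
    rw [Nat.div_eq_of_lt (by omega), Nat.div_eq_of_lt (by omega)] at h4
    exact Subtype.ext (by simpa using h4)
  obtain ⟨j, hj, hp, -⟩ := exists_hasPole_sum hterm hinj ht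
  rw [← hht] at hp
  have hle : ν j + r * j ≤ l + r * m :=
    add_le_add (hνl j hj) (Nat.mul_le_mul_left r (hJ j j.2))
  have hker : ∀ φ ∈ S, φ h = 0 := by
    intro φ hφ
    let fk : K →ₐ[F] K := FiniteField.frobeniusAlgHom F K ^ s
    have hfk : ∀ a, fk a = a ^ r := frobeniusAlgHom_pow_apply s
    have h1 : φ h ^ r = ∑ j : J, φ (v j) ^ r * φ (b j) ^ (r * r) := by
      rw [← hfk, map_sum, map_sum]
      refine Finset.sum_congr rfl fun j _ => ?_
      rw [hfk, map_mul, map_pow, mul_pow, ← pow_mul]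
    have h2 : φ h ^ r = 0 := by
      rw [h1]
      calc ∑ j : J, φ (v j) ^ r * φ (b j) ^ (r * r)
          = ∑ j : J, φ (v j) ^ r * ∑ i, φ (u j i) * θ φ i :=
            Finset.sum_congr rfl fun j _ => by rw [hθ φ hφ j j.2]
        _ = ∑ i, φ (∑ j : J, (v j : A) ^ r * u j i) * θ φ i := by
            simp only [Finset.mul_sum, map_sum, map_mul, map_pow, Finset.sum_mul]
            rw [Finset.sum_comm]
            refine Finset.sum_congr rfl fun i _ => Finset.sum_congr rfl fun j _ => ?_
            ring
        _ = 0 := Finset.sum_eq_zero fun i _ => by rw [hv', map_zero, zero_mul]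
    exact pow_eq_zero_iff (by omega) |>.mp h2
  obtain ⟨h1, h2⟩ := e.card_algHom_le hp hker
  exact ⟨h1, h2.trans hle⟩

end Stepanov

section PlaneModel

open Polynomial

variable {F : Type*} [Field F]

/-- An affine plane curve that is monic in the second coordinate, together with a Laurent
parametrization of a single branch at infinity. -/
structure PlaneModel (F : Type*) [Field F] where
  f : F[X][X]
  monic : f.Monic
  a : ℕ
  b : ℕ
  natDegree_eq : f.natDegree = a
  cast_ne : (a : F) ≠ 0
  coprime : a.Coprime b
  x : Laurent F
  y : Laurent F
  hasPole_x : HasPole x a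
  hasPole_y : HasPole y b
  root : f.eval₂ (aeval x : F[X] →ₐ[F] Laurent F) y = 0
  gaps : Finset ℕ
  mem_gaps : ∀ n, n ∈ gaps ↔ ¬ ∃ i l, i * a + l * b = n

namespace PlaneModel

variable (M : PlaneModel F)

/-- The coordinate ring. -/
abbrev Ring : Type _ := AdjoinRoot M.f

/-- The first coordinate function. -/
noncomputable def cx : M.Ring := AdjoinRoot.of M.f X

/-- The second coordinate function. -/
noncomputable def cy : M.Ring := AdjoinRoot.root M.f

/-- The embedding of the coordinate ring into Laurent series. -/
noncomputable def emb : M.Ring →ₐ[F] Laurent F :=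
  AdjoinRoot.liftAlgHom M.f (aeval M.x) M.y M.root

theorem emb_mk (p : F[X][X]) :
    M.emb (AdjoinRoot.mk M.f p) = p.eval₂ (aeval M.x : F[X] →ₐ[F] Laurent F) M.y := rfl

theorem emb_cx : M.emb M.cx = M.x := by
  simp [cx, emb]

theorem emb_cy : M.emb M.cy = M.y := by
  simp [cy, emb]

theorem a_pos : 0 < M.a := by
  rcases Nat.eq_zero_or_pos M.a with h | h
  · exact absurd (by rw [h, Nat.cast_zero]) M.cast_ne
  · exact h

theorem exists_hasPole_aeval {c : F[X]} (hc : c ≠ 0) :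
    ∃ i : ℕ, HasPole (aeval M.x c) ((i * M.a : ℕ) : ℤ) := by
  rw [aeval_eq_sum_range' (Nat.lt_succ_self _)]
  have hs : ∑ i ∈ Finset.range (c.natDegree + 1), c.coeff i • M.x ^ i =
      ∑ i ∈ c.support, c.coeff i • M.x ^ i := by
    symm
    refine Finset.sum_subset ?_ ?_
    · intro i hi
      rw [Finset.mem_range]
      exact Nat.lt_succ_of_le (le_natDegree_of_mem_supp i hi)
    · intro i _ hi
      rw [notMem_support_iff.mp hi, zero_smul]
  rw [hs]
  obtain ⟨i, -, hi, -⟩ := exists_hasPole_sum (s := c.support)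
    (f := fun i => c.coeff i • M.x ^ i) (n := fun i => (i : ℤ) * M.a)
    (fun i hi => (M.hasPole_x.pow i).smul (mem_support_iff.mp hi))
    (fun i _ j _ h => by
      have := mul_right_cancel₀ (by exact_mod_cast M.a_pos.ne') h
      exact_mod_cast this)
    (support_nonempty.mpr hc)
  exact ⟨i, by exact_mod_cast hi⟩

theorem exists_hasPole_emb_mk {p : F[X][X]} (hp : p ≠ 0) (hdeg : p.natDegree < M.a) :
    ∃ i l : ℕ, HasPole (M.emb (AdjoinRoot.mk M.f p)) ((i * M.a + l * M.b : ℕ) : ℤ) := by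
  rw [emb_mk, eval₂_eq_sum, Polynomial.sum]
  have h : ∀ l, ∃ i : ℕ, l ∈ p.support → HasPole (aeval M.x (p.coeff l)) ((i * M.a : ℕ) : ℤ) := by
    intro l
    by_cases hl : l ∈ p.support
    · obtain ⟨i, hi⟩ := M.exists_hasPole_aeval (mem_support_iff.mp hl)
      exact ⟨i, fun _ => hi⟩
    · exact ⟨0, fun h => absurd h hl⟩
  choose i hi using h
  obtain ⟨l, -, hl, -⟩ := exists_hasPole_sum (s := p.support)
    (f := fun l => (aeval M.x (p.coeff l)) * M.y ^ l)
    (n := fun l => ((i l * M.a + l * M.b : ℕ) : ℤ))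
    (fun l hl => by
      have := (hi l hl).mul (M.hasPole_y.pow l)
      exact_mod_cast this)
    (fun l hl m hm hlm => by
      have h1 : i l * M.a + l * M.b = i m * M.a + m * M.b := Int.ofNat_inj.mp hlm
      have h2 : l * M.b ≡ m * M.b [MOD M.a] := by
        have := congrArg (· % M.a) h1
        simpa [Nat.ModEq, Nat.add_mod, Nat.mul_mod_left] using this
      have h3 := Nat.ModEq.cancel_right_of_coprime M.coprime h2
      have h4 := le_natDegree_of_mem_supp l hl
      have h5 := le_natDegree_of_mem_supp m hm
      exact Nat.ModEq.eq_of_lt_of_lt h3 (by omega) (by omega))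
    (support_nonempty.mpr hp)
  exact ⟨i l, l, hl⟩

theorem exists_mk_eq (z : M.Ring) :
    ∃ p : F[X][X], p.natDegree < M.a ∧ AdjoinRoot.mk M.f p = z := by
  obtain ⟨p, rfl⟩ := AdjoinRoot.mk_surjective z
  refine ⟨p %ₘ M.f, ?_, ?_⟩
  · rw [← M.natDegree_eq]
    refine natDegree_modByMonic_lt p M.monic fun h => ?_
    have := M.natDegree_eq
    rw [h, natDegree_one] at this
    exact M.a_pos.ne this
  · rw [modByMonic_eq_sub_mul_div, map_sub, map_mul, AdjoinRoot.mk_self, zero_mul, sub_zero]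

theorem hasPole_monomial (i l : ℕ) :
    HasPole (M.emb (M.cx ^ i * M.cy ^ l)) ((i * M.a + l * M.b : ℕ) : ℤ) := by
  rw [map_mul, map_pow, map_pow, emb_cx, emb_cy]
  have := (M.hasPole_x.pow i).mul (M.hasPole_y.pow l)
  exact_mod_cast this

/-- The coordinate ring as a ring of Laurent series. -/
noncomputable def poleEmbedding : PoleEmbedding F M.Ring where
  toAlgHom := M.emb
  eq_zero_of_mem z hz := by
    obtain ⟨p, hp, rfl⟩ := M.exists_mk_eq z
    by_contra h0
    obtain ⟨i, l, h⟩ := M.exists_hasPole_emb_mk (p := p) (by rintro rfl; simp at h0) hp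
    have := h.mem_poleFilt_iff.mp hz
    omega
  gaps := M.gaps
  mem_gaps n := by
    rw [M.mem_gaps, not_iff_not]
    constructor
    · rintro ⟨i, l, rfl⟩
      exact ⟨_, M.hasPole_monomial i l⟩
    · rintro ⟨z, hz⟩
      obtain ⟨p, hp, rfl⟩ := M.exists_mk_eq z
      obtain ⟨i, l, h⟩ := M.exists_hasPole_emb_mk (p := p)
        (by rintro rfl; exact hz.ne_zero (by simp)) hp
      exact ⟨i, l, Int.ofNat_inj.mp (h.unique hz)⟩

theorem exists_monomial {n : ℕ} (hn : n ∉ M.gaps) :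
    ∃ i l, l < M.a ∧ i * M.a + l * M.b = n := by
  rw [M.mem_gaps, not_not] at hn
  obtain ⟨i, l, rfl⟩ := hn
  refine ⟨i + l / M.a * M.b, l % M.a, Nat.mod_lt _ M.a_pos, ?_⟩
  conv_rhs => rw [← Nat.div_add_mod l M.a]
  ring

theorem algHom_ext {K : Type*} [CommRing K] [Algebra F K] {φ ψ : M.Ring →ₐ[F] K}
    (hx : φ M.cx = ψ M.cx) (hy : φ M.cy = ψ M.cy) : φ = ψ :=
  AdjoinRoot.algHom_ext' (Polynomial.algHom_ext hx) hy

end PlaneModel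

end PlaneModel

section PlaneModelPoints

open Polynomial

variable {F : Type*} [Field F]

namespace PoleEmbedding

variable {A : Type*} [CommRing A] [Algebra F A] (e : PoleEmbedding F A)

theorem exists_mem_filt (z : A) : ∃ n : ℕ, z ∈ e.filt (n + 1) := by
  by_cases hz : z = 0
  · exact ⟨0, hz ▸ zero_mem _⟩
  · obtain ⟨n, hn⟩ := e.exists_hasPole hz
    exact ⟨n, hn.mem_poleFilt_iff.mpr (by omega)⟩

theorem exists_forall_mem_filt (s : Finset A) : ∃ n : ℕ, ∀ z ∈ s, z ∈ e.filt (n + 1) := by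
  choose N hN using e.exists_mem_filt
  refine ⟨s.sup N, fun z hz => e.filt_mono ?_ (hN z)⟩
  have := Finset.le_sup (f := N) hz
  omega

end PoleEmbedding

namespace PlaneModel

variable (M : PlaneModel F)

/-- The defining polynomial divided by `Y - y`. -/
noncomputable def cofactor : M.Ring[X] := M.f.map (AdjoinRoot.of M.f) /ₘ (X - C M.cy)

theorem mul_cofactor : (X - C M.cy) * M.cofactor = M.f.map (AdjoinRoot.of M.f) := by
  rw [cofactor, mul_divByMonic_eq_iff_isRoot, IsRoot, eval_map, cy]
  exact AdjoinRoot.eval₂_root M.f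

theorem nontrivial_ring : Nontrivial M.Ring :=
  M.poleEmbedding.isDomain.toNontrivial

theorem monic_cofactor : M.cofactor.Monic := by
  have := M.monic.map (AdjoinRoot.of M.f)
  rw [← mul_cofactor] at this
  exact (monic_X_sub_C _).of_mul_monic_left this

theorem natDegree_cofactor : M.cofactor.natDegree = M.a - 1 := by
  have := M.nontrivial_ring
  rw [cofactor, natDegree_divByMonic _ (monic_X_sub_C _), M.monic.natDegree_map, M.natDegree_eq,
    natDegree_X_sub_C]

theorem pow_eq_of_frobenius_ne [Fintype F] {K : Type*} [Field K] [Algebra F K] (s : ℕ)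
    {φ : M.Ring →ₐ[F] K} (hx : φ M.cx ^ Fintype.card F ^ s = φ M.cx)
    (hy : φ M.cy ^ Fintype.card F ^ s ≠ φ M.cy) :
    (φ M.cy ^ Fintype.card F ^ s) ^ (M.a - 1) =
      ∑ i ∈ Finset.range (M.a - 1),
        -φ (M.cofactor.coeff i) * (φ M.cy ^ Fintype.card F ^ s) ^ i := by
  let ψ : M.Ring →ₐ[F] K := (FiniteField.frobeniusAlgHom F K ^ s).comp φ
  have hψ : ∀ z, ψ z = φ z ^ Fintype.card F ^ s := fun z => frobeniusAlgHom_pow_apply s _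
  rw [← hψ] at hx hy ⊢
  have hof : ψ.comp (AdjoinRoot.ofAlgHom F M.f) = φ.comp (AdjoinRoot.ofAlgHom F M.f) :=
    Polynomial.algHom_ext hx
  have h1 : (M.f.map (AdjoinRoot.of M.f)).eval₂ (φ : M.Ring →+* K) (ψ M.cy) = 0 := by
    rw [eval₂_map]
    have h2 : (φ : M.Ring →+* K).comp (AdjoinRoot.of M.f) =
        (ψ : M.Ring →+* K).comp (AdjoinRoot.of M.f) := by
      apply Polynomial.ringHom_ext'
      · exact RingHom.ext fun c => (AlgHom.congr_fun hof (C c)).symm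
      · exact (AlgHom.congr_fun hof X).symm
    rw [h2, show ψ M.cy = (ψ : M.Ring →+* K) (AdjoinRoot.root M.f) from rfl, ← hom_eval₂,
      AdjoinRoot.eval₂_root, map_zero]
  rw [← mul_cofactor, eval₂_mul, eval₂_sub, eval₂_X, eval₂_C, mul_eq_zero] at h1
  rcases h1 with h1 | h1
  · exact absurd (sub_eq_zero.mp h1) hy
  · rw [M.monic_cofactor.as_sum, natDegree_cofactor, eval₂_add, eval₂_pow, eval₂_X,
      eval₂_finsetSum] at h1
    rw [eq_neg_of_add_eq_zero_left h1, ← Finset.sum_neg_distrib]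
    refine Finset.sum_congr rfl fun i _ => ?_
    rw [eval₂_mul, eval₂_C, eval₂_pow, eval₂_X, neg_mul]
    rfl

theorem exists_ncard_frobenius_ne_le [Fintype F] (K : Type*) [Field K] [Algebra F K] :
    ∃ c r₀ : ℕ, ∀ s, r₀ < Fintype.card F ^ s →
      {φ : M.Ring →ₐ[F] K | φ M.cx ^ Fintype.card F ^ (2 * s) = φ M.cx ∧
        φ M.cy ^ Fintype.card F ^ (2 * s) ≠ φ M.cy}.ncard ≤
      (M.a - 1) * Fintype.card F ^ (2 * s) + c * Fintype.card F ^ s := by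
  classical
  obtain ⟨c, hc⟩ := M.poleEmbedding.exists_forall_mem_filt
    ((Finset.range (M.a - 1)).image M.cofactor.coeff)
  set G := M.poleEmbedding.genus with hG
  set d := M.a - 1 with hd
  set k := G + G * d + d * d with hk
  refine ⟨k + 1, G * (G * d + d * d + 1) + d * k + d * c + d + G, fun s hs => ?_⟩
  set r := Fintype.card F ^ s with hr
  have hr2 : Fintype.card F ^ (2 * s) = r * r := by rw [two_mul, pow_add]
  set m := d * r + k with hm
  let J : Finset ℕ := (Finset.range (m + 1)).filter (· ∉ M.gaps)
  have hmon : ∀ n, ∃ p : ℕ × ℕ, n ∉ M.gaps → p.2 < M.a ∧ p.1 * M.a + p.2 * M.b = n := by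
    intro n
    by_cases hn : n ∈ M.gaps
    · exact ⟨0, fun h => absurd hn h⟩
    · obtain ⟨i, l, h⟩ := M.exists_monomial hn
      exact ⟨(i, l), fun _ => h⟩
  choose p hp using hmon
  have hJ : ∀ n ∈ J, n ≤ m ∧ n ∉ M.gaps := by
    intro n hn
    simp only [J, Finset.mem_filter, Finset.mem_range] at hn
    exact ⟨by omega, hn.2⟩
  have hxfilt : ∀ n ∈ J, M.cx ^ (p n).1 ∈ M.poleEmbedding.filt (m + 1) := by
    intro n hn
    obtain ⟨h1, h2⟩ := hJ n hn
    have h3 := M.hasPole_monomial (p n).1 0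
    rw [pow_zero, mul_one] at h3
    refine h3.mem_poleFilt_iff.mpr ?_
    have := (hp n h2).2
    have h4 : (p n).1 * M.a ≤ m := by omega
    push_cast
    zify at h4
    simp only [zero_mul, add_zero]
    omega
  let u : ℕ → Fin d → M.Ring := fun n i =>
    if (p n).2 < d then (if (i : ℕ) = (p n).2 then M.cx ^ (p n).1 else 0)
    else M.cx ^ (p n).1 * -M.cofactor.coeff i
  have hJcard : m + 1 ≤ J.card + G := by
    have h1 := M.poleEmbedding.le_finrank_filt (m + 1)
    rwa [M.poleEmbedding.finrank_filt] at h1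
  have hfr := M.poleEmbedding.le_finrank_filt (r - 1 + 1)
  have hrpos : 0 < r := by omega
  have key := M.poleEmbedding.ncard_le_of_frobenius (K := K) s (J := J)
    (b := fun n => M.cx ^ (p n).1 * M.cy ^ (p n).2) (d := d) (u := u) (w := m + c) (m := m)
    (l := r - 1)
    (S := {φ : M.Ring →ₐ[F] K | φ M.cx ^ Fintype.card F ^ (2 * s) = φ M.cx ∧
        φ M.cy ^ Fintype.card F ^ (2 * s) ≠ φ M.cy})
    (θ := fun φ i => (φ M.cy ^ Fintype.card F ^ (2 * s)) ^ (i : ℕ))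
    (fun n hn => by
      have h1 := M.hasPole_monomial (p n).1 (p n).2
      rwa [(hp n (hJ n hn).2).2] at h1)
    (fun n hn i => by
      simp only [u]
      have h0 := hxfilt n hn
      split_ifs
      · exact M.poleEmbedding.filt_mono (by push_cast; omega) h0
      · exact zero_mem _
      · have h1 := neg_mem (hc (M.cofactor.coeff i)
          (Finset.mem_image_of_mem _ (Finset.mem_range.mpr i.2)))
        rw [PoleEmbedding.mem_filt] at h0 h1 ⊢
        rw [map_mul]
        have := mul_mem_poleFilt h0 h1
        push_cast
        exact this)
    (fun n hn => (hJ n hn).1) (by omega)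
    (by
      rw [← hr]
      have h1 : d * r + G * d + d * d + 1 ≤ J.card := by omega
      have h2 : r - G ≤ Module.finrank F ↥(M.poleEmbedding.filt ((r - 1 + 1 : ℕ) : ℤ)) := by
        omega
      refine lt_of_lt_of_le ?_ (Nat.mul_le_mul h1 h2)
      obtain ⟨t, ht⟩ : ∃ t, r = G + t := ⟨r - G, by omega⟩
      obtain ⟨v, hv⟩ : ∃ v, r = v + 1 := ⟨r - 1, by omega⟩
      rw [show r - G = t by omega, show r - 1 = v by omega]
      zify at *
      rw [hm]
      have ht' : (t : ℤ) = r - G := by omega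
      have hv' : (v : ℤ) = r - 1 := by omega
      rw [ht', hv']
      have : 0 ≤ (d : ℤ) * r := by positivity
      rw [hk] at hs ⊢
      nlinarith)
    (fun φ hφ n hn => by
      obtain ⟨h1, h2⟩ := hφ
      have h3 := (hp n (hJ n hn).2).1
      have h5 := M.pow_eq_of_frobenius_ne (2 * s) h1 h2
      rw [← hr, ← hr2]
      generalize Fintype.card F ^ (2 * s) = Q at h1 h2 h5 ⊢
      rw [map_mul, map_pow, map_pow, mul_pow, ← pow_mul, mul_comm (p n).1, pow_mul, h1,
        ← pow_mul, mul_comm (p n).2, pow_mul]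
      simp only [u]
      split_ifs with hlt
      · rw [Finset.sum_eq_single ⟨(p n).2, hlt⟩]
        · simp
        · intro i _ hi
          rw [if_neg (fun h => hi (Fin.ext h))]
          simp
        · simp
      · have h4 : (p n).2 = M.a - 1 := by omega
        rw [h4, h5, Finset.sum_range, Finset.mul_sum]
        refine Finset.sum_congr rfl fun i _ => ?_
        rw [map_mul, map_pow, map_neg, mul_assoc])
  refine key.2.trans ?_
  rw [← hr, hr2, hm]
  have : r - 1 ≤ r := Nat.sub_le _ _
  nlinarith

end PlaneModel

end PlaneModelPoints

section PlaneModelLower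

open Polynomial

variable {F : Type*} [Field F]

namespace PlaneModel

variable (M : PlaneModel F)

theorem mk_derivative_ne_zero : AdjoinRoot.mk M.f (derivative M.f) ≠ 0 := by
  rw [Ne, AdjoinRoot.mk_eq_zero]
  have ha := M.a_pos
  have hc : (derivative M.f).coeff (M.a - 1) ≠ 0 := by
    have h1 : M.f.coeff M.a = 1 := by
      rw [← M.natDegree_eq]
      exact M.monic
    rw [coeff_derivative, Nat.sub_add_cancel ha, h1, one_mul]
    have h2 : ((M.a - 1 : ℕ) : F[X]) + 1 = C (M.a : F) := by
      rw [← Nat.cast_succ, Nat.succ_eq_add_one, Nat.sub_add_cancel ha, C_eq_natCast]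
    rw [h2, Ne, C_eq_zero]
    exact M.cast_ne
  have h0 : derivative M.f ≠ 0 := by
    intro h
    rw [h] at hc
    simp at hc
  refine M.monic.not_dvd_of_natDegree_lt h0 ?_
  exact natDegree_derivative_lt (by rw [M.natDegree_eq]; omega)

/-- The point with given coordinates. -/
noncomputable def point {K : Type*} [CommRing K] [Algebra F K] (x y : K)
    (h : M.f.eval₂ (aeval x : F[X] →ₐ[F] K) y = 0) : M.Ring →ₐ[F] K :=
  AdjoinRoot.liftAlgHom M.f (aeval x) y h

section

variable {K : Type*} [CommRing K] [Algebra F K]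

theorem point_cx (x y : K) (h : M.f.eval₂ (aeval x : F[X] →ₐ[F] K) y = 0) :
    M.point x y h M.cx = x := by
  simp [point, cx]

theorem point_cy (x y : K) (h : M.f.eval₂ (aeval x : F[X] →ₐ[F] K) y = 0) :
    M.point x y h M.cy = y := by
  simp [point, cy]

theorem point_mk (x y : K) (h : M.f.eval₂ (aeval x : F[X] →ₐ[F] K) y = 0) (p : F[X][X]) :
    M.point x y h (AdjoinRoot.mk M.f p) = p.eval₂ (aeval x : F[X] →ₐ[F] K) y := rfl

end

theorem finite_frobenius_cx {K : Type*} [Field K] [Algebra F K] {Q : ℕ} (hQ : 1 < Q) :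
    {φ : M.Ring →ₐ[F] K | φ M.cx ^ Q = φ M.cx}.Finite := by
  have h : HasPole (M.poleEmbedding.toAlgHom (M.cx ^ Q - M.cx)) (Q * M.a : ℕ) := by
    have h1 := M.hasPole_monomial Q 0
    have h2 := M.hasPole_monomial 1 0
    simp only [pow_zero, mul_one, zero_mul, add_zero, pow_one] at h1 h2
    change HasPole (M.emb (M.cx ^ Q - M.cx)) _
    rw [map_sub, sub_eq_add_neg]
    refine h1.add_of_lt (neg_mem ?_)
    rw [h2.mem_poleFilt_iff]
    have := Nat.mul_lt_mul_of_pos_right hQ M.a_pos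
    exact_mod_cast this
  refine (M.poleEmbedding.card_algHom_le h fun φ hφ => ?_).1
  rw [map_sub, map_pow, sub_eq_zero]
  exact hφ

theorem exists_le_ncard_frobenius_cx [Fintype F] (K : Type*) [Field K] [Algebra F K]
    [IsAlgClosed K] :
    ∃ c : ℕ, ∀ t, 1 ≤ t → M.a * Fintype.card F ^ t ≤
      {φ : M.Ring →ₐ[F] K | φ M.cx ^ Fintype.card F ^ t = φ M.cx}.ncard + M.a * c := by
  classical
  obtain ⟨c, hc⟩ := M.poleEmbedding.exists_hasPole M.mk_derivative_ne_zero
  refine ⟨c, fun t ht => ?_⟩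
  obtain ⟨hBfin, hB⟩ := M.poleEmbedding.card_algHom_le (K := K) hc
    (S := {φ | φ (AdjoinRoot.mk M.f (derivative M.f)) = 0}) (fun _ h => h)
  set Q := Fintype.card F ^ t with hQ
  have hQ1 : 1 < Q := Nat.one_lt_pow (by omega) Fintype.one_lt_card
  have hT := M.finite_frobenius_cx (K := K) hQ1
  obtain ⟨p, hp⟩ := CharP.exists F
  have hpK : CharP K p := charP_of_injective_algebraMap (algebraMap F K).injective p
  have hpQ : p ∣ Q := by
    rw [hQ]
    refine dvd_pow ?_ (by omega)
    rw [← CharP.cast_eq_zero_iff F p]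
    exact FiniteField.cast_card_eq_zero F
  have hsep : (X ^ Q - X : K[X]).Separable := galois_poly_separable p Q hpQ
  have hP0 : (X ^ Q - X : K[X]) ≠ 0 := hsep.ne_zero
  let R : Finset K := (X ^ Q - X : K[X]).roots.toFinset
  have hRcard : R.card = Q := by
    rw [Multiset.toFinset_card_of_nodup (nodup_roots hsep), IsAlgClosed.card_roots_eq_natDegree,
      FiniteField.X_pow_card_sub_X_natDegree_eq K hQ1]
  have hR : ∀ z ∈ R, z ^ Q = z := by
    intro z hz
    have := isRoot_of_mem_roots (Multiset.mem_toFinset.mp hz)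
    simpa [sub_eq_zero] using this
  let bad : Finset K := hBfin.toFinset.image fun φ => φ M.cx
  have hbad : bad.card ≤ c := by
    refine Finset.card_image_le.trans ?_
    rwa [← Set.ncard_eq_toFinset_card _ hBfin]
  have hgood : Q ≤ (R \ bad).card + c := by
    have := Finset.le_card_sdiff bad R
    omega
  let g : K → K[X] := fun z => M.f.map (aeval z : F[X] →ₐ[F] K)
  have hg : ∀ z, (g z).natDegree = M.a := fun z => by
    rw [M.monic.natDegree_map, M.natDegree_eq]
  have hg0 : ∀ z, g z ≠ 0 := fun z => (M.monic.map _).ne_zero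
  have hroots : ∀ z ∈ R \ bad, (g z).roots.toFinset.card = M.a := by
    intro z hz
    rw [Multiset.toFinset_card_of_nodup, IsAlgClosed.card_roots_eq_natDegree, hg]
    rw [Multiset.nodup_iff_count_le_one]
    intro y
    rw [count_roots]
    by_contra! h
    rw [one_lt_rootMultiplicity_iff_isRoot (hg0 z)] at h
    obtain ⟨h1, h2⟩ := h
    rw [IsRoot, eval_map] at h1
    rw [IsRoot, derivative_map, eval_map] at h2
    refine (Finset.mem_sdiff.mp hz).2 (Finset.mem_image.mpr ⟨M.point z y h1, ?_, ?_⟩)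
    · rw [Set.Finite.mem_toFinset, Set.mem_ofPred_eq, point_mk]
      exact h2
    · exact M.point_cx z y h1
  let E : Finset (Σ _ : K, K) := (R \ bad).sigma fun z => (g z).roots.toFinset
  have hE : E.card = (R \ bad).card * M.a := by
    rw [Finset.card_sigma, Finset.sum_const_nat hroots]
  have hEmem : ∀ z ∈ E, M.f.eval₂ (aeval z.1 : F[X] →ₐ[F] K) z.2 = 0 := by
    intro z hz
    have := isRoot_of_mem_roots (Multiset.mem_toFinset.mp (Finset.mem_sigma.mp hz).2)
    rwa [IsRoot, eval_map] at this
  have hle : E.card ≤ hT.toFinset.card := by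
    rw [← Finset.card_attach]
    refine Finset.card_le_card_of_injOn (fun z => M.point z.1.1 z.1.2 (hEmem z.1 z.2)) ?_ ?_
    · intro z _
      rw [Finset.mem_coe, Set.Finite.mem_toFinset, Set.mem_ofPred_eq, point_cx]
      exact hR _ (Finset.mem_sdiff.mp (Finset.mem_sigma.mp z.2).1).1
    · intro z _ w _ hzw
      have h1 := AlgHom.congr_fun hzw M.cx
      have h2 := AlgHom.congr_fun hzw M.cy
      simp only [point_cx, point_cy] at h1 h2
      exact Subtype.ext (Sigma.ext h1 (heq_of_eq h2))
  rw [← Set.ncard_eq_toFinset_card _ hT, hE] at hle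
  have := Nat.mul_le_mul_left M.a hgood
  rw [mul_add, mul_comm M.a (Finset.card _)] at this
  omega

theorem forall_frobenius_of_coords [Fintype F] {K : Type*} [Field K] [Algebra F K] {t : ℕ}
    {φ : M.Ring →ₐ[F] K} (hx : φ M.cx ^ Fintype.card F ^ t = φ M.cx)
    (hy : φ M.cy ^ Fintype.card F ^ t = φ M.cy) (z : M.Ring) :
    φ z ^ Fintype.card F ^ t = φ z := by
  have h : (FiniteField.frobeniusAlgHom F K ^ t).comp φ = φ := by
    refine M.algHom_ext ?_ ?_
    · rw [AlgHom.comp_apply, frobeniusAlgHom_pow_apply, hx]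
    · rw [AlgHom.comp_apply, frobeniusAlgHom_pow_apply, hy]
  have h1 := AlgHom.congr_fun h z
  rwa [AlgHom.comp_apply, frobeniusAlgHom_pow_apply] at h1

theorem exists_le_ncard_frobenius [Fintype F] (K : Type*) [Field K] [Algebra F K]
    [IsAlgClosed K] :
    ∃ c s₀ : ℕ, ∀ s, s₀ ≤ s →
      {φ : M.Ring →ₐ[F] K | ∀ z, φ z ^ Fintype.card F ^ (2 * s) = φ z}.Finite ∧
      Fintype.card F ^ (2 * s) ≤
      {φ : M.Ring →ₐ[F] K | ∀ z, φ z ^ Fintype.card F ^ (2 * s) = φ z}.ncard +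
        c * Fintype.card F ^ s := by
  obtain ⟨c₁, r₀, h₁⟩ := M.exists_ncard_frobenius_ne_le K
  obtain ⟨c₂, h₂⟩ := M.exists_le_ncard_frobenius_cx K
  refine ⟨c₁ + M.a * c₂, r₀ + 1, fun s hs => ?_⟩
  have hF : 1 < Fintype.card F := Fintype.one_lt_card
  have hr₀ : r₀ < Fintype.card F ^ s :=
    lt_of_lt_of_le (by omega) (Nat.lt_pow_self hF).le
  have h3 := h₁ s hr₀
  have h4 := h₂ (2 * s) (by omega)
  have hT := M.finite_frobenius_cx (K := K) (Q := Fintype.card F ^ (2 * s))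
    (Nat.one_lt_pow (by omega) hF)
  have hsub : {φ : M.Ring →ₐ[F] K | ∀ z, φ z ^ Fintype.card F ^ (2 * s) = φ z} ⊆
      {φ | φ M.cx ^ Fintype.card F ^ (2 * s) = φ M.cx} := fun φ hφ => hφ M.cx
  refine ⟨hT.subset hsub, ?_⟩
  have hcov : {φ : M.Ring →ₐ[F] K | φ M.cx ^ Fintype.card F ^ (2 * s) = φ M.cx} ⊆
      {φ : M.Ring →ₐ[F] K | ∀ z, φ z ^ Fintype.card F ^ (2 * s) = φ z} ∪
      {φ : M.Ring →ₐ[F] K | φ M.cx ^ Fintype.card F ^ (2 * s) = φ M.cx ∧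
        φ M.cy ^ Fintype.card F ^ (2 * s) ≠ φ M.cy} := by
    intro φ hφ
    by_cases hy : φ M.cy ^ Fintype.card F ^ (2 * s) = φ M.cy
    · exact Or.inl (M.forall_frobenius_of_coords hφ hy)
    · exact Or.inr ⟨hφ, hy⟩
  have h5 := (Set.ncard_le_ncard hcov ((hT.subset hsub).union
    (hT.subset fun φ hφ => hφ.1))).trans (Set.ncard_union_le _ _)
  obtain ⟨d, hd⟩ : ∃ d, M.a = d + 1 := ⟨M.a - 1, by have := M.a_pos; omega⟩
  have h6 : 1 ≤ Fintype.card F ^ s := by omega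
  have h7 : M.a * c₂ ≤ M.a * c₂ * Fintype.card F ^ s := Nat.le_mul_of_pos_right _ h6
  have h8 : M.a * Fintype.card F ^ (2 * s) =
      (M.a - 1) * Fintype.card F ^ (2 * s) + Fintype.card F ^ (2 * s) := by
    rw [hd, Nat.add_sub_cancel]
    ring
  rw [add_mul]
  omega

end PlaneModel

end PlaneModelLower

section Normalization

universe u

variable {F : Type*} [Field F]

namespace PoleEmbedding

section

variable {R : Type*} [CommRing R] [Algebra F R] (e : PoleEmbedding F R)

include e in
theorem isNoetherianRing : IsNoetherianRing R := by
  rw [isNoetherianRing_iff_ideal_fg]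
  intro I
  by_cases hI : I = ⊥
  · rw [hI]
    exact Submodule.fg_bot
  obtain ⟨a, ha, ha0⟩ := Submodule.exists_mem_ne_zero_of_ne_bot hI
  have hfin : Module.Finite F (R ⧸ Ideal.span {a}) :=
    e.finite_quotient (by simpa [Ideal.span_singleton_eq_bot])
  have hN : IsNoetherian R (R ⧸ Ideal.span {a}) := isNoetherian_of_tower F inferInstance
  refine Submodule.fg_of_fg_map_of_fg_inf_ker (Submodule.mkQ (Ideal.span {a})) ?_ ?_
  · exact IsNoetherian.noetherian _
  · have hle : Ideal.span {a} ≤ I := (Ideal.span_singleton_le_iff_mem I).mpr ha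
    rw [Submodule.ker_mkQ, inf_eq_right.mpr hle]
    exact ⟨{a}, by simp [Ideal.span]⟩

include e in
theorem dimensionLEOne : Ring.DimensionLEOne R where
  maximalOfPrime {p} hp hprime := by
    have := e.finite_quotient hp
    have : IsDomain (R ⧸ p) := Ideal.Quotient.isDomain p
    have hIntegral : Algebra.IsIntegral F (R ⧸ p) := inferInstance
    exact Ideal.Quotient.maximal_of_isField p
      (isField_of_isIntegral_of_isField' (R := F) (Field.toIsField F))

end

variable {A : Type u} [CommRing A] [Algebra F A] (e : PoleEmbedding F A)

theorem exists_normalization :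
    ∃ (R : Type u) (_ : CommRing R) (_ : Algebra F R) (ι : A →ₐ[F] R) (eR : PoleEmbedding F R),
      (∀ a, eR.toAlgHom (ι a) = e.toAlgHom a) ∧ IsDedekindDomain R ∧
      ∃ c : A, c ≠ 0 ∧ ∀ r : R, ∃ a, ι a = ι c * r := by
  classical
  have hdom := e.isDomain
  let L := FractionRing A
  have hunit : ∀ z : nonZeroDivisors A, IsUnit (e.toAlgHom z) := fun z =>
    ((map_ne_zero_iff _ e.injective).mpr (nonZeroDivisors.coe_ne_zero z)).isUnit
  let E : L →ₐ[F] Laurent F := IsLocalization.liftAlgHom (M := nonZeroDivisors A) hunit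
  have hE : ∀ a, E (algebraMap A L a) = e.toAlgHom a := fun a => IsLocalization.lift_eq _ a
  let R := integralClosure A L
  let ι : A →ₐ[F] R := IsScalarTower.toAlgHom F A R
  have hι : ∀ a, ((ι a : R) : L) = algebraMap A L a := fun a => rfl
  let ER : R →ₐ[F] Laurent F := E.comp (IsScalarTower.toAlgHom F R L)
  have hER : ∀ r : R, ER r = E r := fun r => rfl
  have hpoleA : ∀ a : A, a ≠ 0 → ∃ n : ℕ, HasPole (E (algebraMap A L a)) n := fun a ha => by
    rw [hE]
    exact e.exists_hasPole ha
  have hzero : ∀ r : R, ER r ∈ poleFilt F 0 → r = 0 := by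
    intro r hr
    by_contra hr0
    have hr0' : (r : L) ≠ 0 := fun h => hr0 (Subtype.ext h)
    obtain ⟨d, hd, hdr⟩ := (show IsIntegral A (r : L) from r.2).isAlmostIntegral
    have hd0 : d ≠ 0 := nonZeroDivisors.ne_zero hd
    obtain ⟨n, hn⟩ := hpoleA d hd0
    have hp := hasPole_neg_order (f := E (r : L)) ((map_ne_zero_iff _ E.injective).mpr hr0')
    rw [hER, hp.mem_poleFilt_iff] at hr
    obtain ⟨a, ha⟩ := hdr (n + 1)
    have hpr := hn.mul (hp.pow (n + 1))
    rw [← map_pow, ← map_mul, ← Algebra.smul_def, ← ha] at hpr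
    have ha0 : a ≠ 0 := by
      rintro rfl
      exact hpr.ne_zero (by simp)
    obtain ⟨m, hm⟩ := hpoleA a ha0
    have := hm.unique hpr
    push_cast at this
    nlinarith
  let eR : PoleEmbedding F R :=
    { toAlgHom := ER
      eq_zero_of_mem := hzero
      gaps := e.gaps.filter fun n => ¬ ∃ r, HasPole (ER r) n
      mem_gaps := fun n => by
        rw [Finset.mem_filter, e.mem_gaps]
        constructor
        · exact fun h => h.2
        · refine fun h => ⟨?_, h⟩
          rintro ⟨a, ha⟩
          refine h ⟨ι a, ?_⟩
          rwa [hER, hι, hE] }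
  have hcl : IsIntegrallyClosed R := integralClosure.isIntegrallyClosedOfFiniteExtension L
  have hRdom : IsDomain R := eR.isDomain
  have hded : IsDedekindDomain R :=
    { toIsDomain := hRdom
      toIsDedekindRing :=
        { toIsNoetherian := eR.isNoetherianRing
          toDimensionLEOne := eR.dimensionLEOne
          toIsIntegralClosure := hcl } }
  refine ⟨R, inferInstance, inferInstance, ι, eR, fun a => ?_, hded, ?_⟩
  · change ER (ι a) = _
    rw [hER, hι, hE]
  · let V : Submodule F R := LinearMap.range ι.toLinearMap
    have hV : (eR.poles ⊤ \ eR.poles V).Finite := by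
      refine e.gaps.finite_toSet.subset fun n hn => ?_
      rw [Finset.mem_coe, e.mem_gaps]
      rintro ⟨a, ha⟩
      refine hn.2 ⟨ι a, ⟨a, rfl⟩, ?_⟩
      change HasPole (ER (ι a)) n
      rwa [hER, hι, hE]
    obtain ⟨hfin, -⟩ := eR.finite_quotient_and_finrank_eq hV
    obtain ⟨S, hS⟩ := hfin.fg_top
    have hlift : ∀ w : R ⧸ V, ∃ r : R, Submodule.Quotient.mk r = w :=
      Submodule.Quotient.mk_surjective V
    choose π hπ using hlift
    obtain ⟨c, hc⟩ := IsLocalization.exist_integer_multiples_of_finset (nonZeroDivisors A)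
      (S.image fun w => ((π w : R) : L))
    refine ⟨c, nonZeroDivisors.coe_ne_zero c, ?_⟩
    let W : Submodule F R := V.comap (LinearMap.mulLeft F (ι c))
    have hVW : V ≤ W := by
      rintro _ ⟨a, rfl⟩
      exact ⟨c * a, by simp⟩
    have hW : W.map V.mkQ = ⊤ := by
      rw [eq_top_iff, ← hS, Submodule.span_le]
      intro w hw
      refine ⟨π w, ?_, hπ w⟩
      obtain ⟨a, ha⟩ := hc _ (Finset.mem_image_of_mem _ hw)
      refine ⟨a, Subtype.ext ?_⟩
      change algebraMap A L a = algebraMap A L c * (π w : L)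
      rw [ha, Algebra.smul_def]
    intro r
    have hr : r ∈ W := by
      have : W = ⊤ := by
        rw [← Submodule.comap_top V.mkQ, ← hW, Submodule.comap_map_mkQ, sup_eq_right.mpr hVW]
      rw [this]
      exact Submodule.mem_top
    obtain ⟨a, ha⟩ := hr
    exact ⟨a, ha⟩

end PoleEmbedding

end Normalization

section BasePoints

variable {F : Type*} [Field F]

/-- The `K`-valued points fixed by the `t`-th power of the Frobenius of `F`. -/
def frobPoints (F A K : Type*) [Field F] [Fintype F] [CommRing A] [Algebra F A] [Field K]
    [Algebra F K] (t : ℕ) : Set (A →ₐ[F] K) :=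
  {φ | ∀ z, φ z ^ Fintype.card F ^ t = φ z}

namespace PoleEmbedding

variable {A R : Type*} [CommRing A] [Algebra F A] [CommRing R] [Algebra F R]

theorem finite_frobPoints [Fintype F] (e : PoleEmbedding F A) (K : Type*) [Field K] [Algebra F K]
    {t : ℕ} (ht : 1 ≤ t) : (frobPoints F A K t).Finite := by
  obtain ⟨n, hn⟩ := Infinite.exists_notMem_finset (insert 0 e.gaps)
  rw [Finset.mem_insert, not_or, e.mem_gaps, not_not] at hn
  obtain ⟨hn0, x, hx⟩ := hn
  have hQ : 1 < Fintype.card F ^ t := Nat.one_lt_pow (by omega) Fintype.one_lt_card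
  have h1 := hx.pow (Fintype.card F ^ t)
  have h : HasPole (e.toAlgHom (x ^ Fintype.card F ^ t - x)) (Fintype.card F ^ t * n : ℕ) := by
    rw [map_sub, map_pow, sub_eq_add_neg]
    push_cast at h1 ⊢
    refine h1.add_of_lt (neg_mem ?_)
    rw [hx.mem_poleFilt_iff]
    have := Nat.mul_lt_mul_of_pos_right hQ (Nat.pos_of_ne_zero hn0)
    rw [one_mul] at this
    exact_mod_cast this
  refine (e.card_algHom_le h fun φ hφ => ?_).1
  rw [map_sub, map_pow, sub_eq_zero]
  exact hφ x

theorem exists_algHom_extension {ι : A →ₐ[F] R} (hι : Function.Injective ι) {c : A}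
    (hc : ∀ r : R, ∃ a, ι a = ι c * r) {K : Type*} [Field K] [Algebra F K] (φ : A →ₐ[F] K)
    (hφ : φ c ≠ 0) :
    ∃ ψ : R →ₐ[F] K, ψ.comp ι = φ ∧ ∀ r, ∃ a, ψ r = φ a / φ c := by
  choose a ha using hc
  have h1 : a 1 = c := hι (by rw [ha, mul_one])
  have hmul : ∀ r s, c * a (r * s) = a r * a s := fun r s => hι (by
    rw [map_mul, map_mul, ha, ha, ha]; ring)
  have hadd : ∀ r s, a (r + s) = a r + a s := fun r s => hι (by
    rw [map_add, ha, ha, ha]; ring)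
  have halg : ∀ b, a (ι b) = c * b := fun b => hι (by rw [map_mul, ha])
  have h0 : a 0 = 0 := hι (by rw [map_zero, ha, mul_zero])
  refine ⟨{ toFun := fun r => φ (a r) / φ c
            map_one' := by rw [h1, div_self hφ]
            map_mul' := fun r s => ?_
            map_zero' := by rw [h0, map_zero, zero_div]
            map_add' := fun r s => by rw [hadd, map_add, add_div]
            commutes' := fun x => ?_ }, ?_, fun r => ⟨a r, rfl⟩⟩
  · have := congrArg φ (hmul r s)
    rw [map_mul, map_mul] at this
    field_simp
    rw [mul_comm, this]
  · rw [← ι.commutes, halg, map_mul, mul_div_cancel_left₀ _ hφ, AlgHom.commutes]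
  · ext b
    change φ (a (ι b)) / φ c = φ b
    rw [halg, map_mul, mul_div_cancel_left₀ _ hφ]

theorem ncard_frobPoints_le [Fintype F] (e : PoleEmbedding F A) (eR : PoleEmbedding F R)
    {ι : A →ₐ[F] R} (hι : Function.Injective ι) {c : A} {n : ℕ} (hn : HasPole (e.toAlgHom c) n)
    (hc : ∀ r : R, ∃ a, ι a = ι c * r) (K : Type*) [Field K] [Algebra F K] {t : ℕ} (ht : 1 ≤ t) :
    (frobPoints F A K t).ncard ≤ (frobPoints F R K t).ncard + n := by
  obtain ⟨hfin, hcard⟩ := e.card_algHom_le (K := K) hn (S := {φ | φ c = 0}) fun _ h => h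
  have hR := eR.finite_frobPoints K ht
  have hsub : frobPoints F A K t ⊆
      Set.image (fun ψ => ψ.comp ι) (frobPoints F R K t) ∪ {φ | φ c = 0} := by
    intro φ hφ
    by_cases h0 : φ c = 0
    · exact Or.inr h0
    obtain ⟨ψ, hψ, hψa⟩ := exists_algHom_extension hι hc φ h0
    refine Or.inl ⟨ψ, fun r => ?_, hψ⟩
    obtain ⟨a, ha⟩ := hψa r
    rw [ha, div_pow, hφ a, hφ c]
  calc _ ≤ _ := Set.ncard_le_ncard hsub ((hR.image _).union hfin)
    _ ≤ _ := Set.ncard_union_le _ _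
    _ ≤ _ := add_le_add (Set.ncard_image_le hR) hcard

theorem finite_algHom [Finite F] (e : PoleEmbedding F A) : Finite (A →ₐ[F] F) := by
  have := Fintype.ofFinite F
  have h := e.finite_frobPoints F le_rfl
  rw [← Set.finite_univ_iff]
  exact h.subset fun φ _ z => by rw [pow_one, FiniteField.pow_card]

theorem card_algHom_add_genus_le [Finite F] (e : PoleEmbedding F A) (eR : PoleEmbedding F R)
    {ι : A →ₐ[F] R} (hι : ∀ a, eR.toAlgHom (ι a) = e.toAlgHom a) :
    Nat.card (R →ₐ[F] F) + eR.genus ≤ Nat.card (A →ₐ[F] F) + e.genus := by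
  classical
  have hA := e.finite_algHom
  have hR := eR.finite_algHom
  have := Fintype.ofFinite (A →ₐ[F] F)
  have := Fintype.ofFinite (R →ₐ[F] F)
  rw [Nat.card_eq_fintype_card, Nat.card_eq_fintype_card]
  let V : Submodule F R := LinearMap.range ι.toLinearMap
  have hV : eR.poles V = (e.gaps : Set ℕ)ᶜ := by
    ext n
    rw [Set.mem_compl_iff, Finset.mem_coe, e.mem_gaps, not_not]
    constructor
    · rintro ⟨_, ⟨a, rfl⟩, h⟩
      refine ⟨a, ?_⟩
      rw [← hι]
      exact h
    · rintro ⟨a, h⟩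
      refine ⟨ι a, ⟨a, rfl⟩, ?_⟩
      rwa [hι]
  have hdiff : eR.poles ⊤ \ eR.poles V = ↑(e.gaps \ eR.gaps) := by
    rw [hV]
    ext n
    rw [Set.mem_sdiff, ← eR.notMem_gaps]
    simp [and_comm]
  have hsub : eR.gaps ⊆ e.gaps := by
    intro n hn
    by_contra h
    have h1 : n ∈ eR.poles V := by rw [hV]; exact h
    exact (eR.notMem_gaps.mpr (eR.poles_mono le_top h1)) hn
  obtain ⟨hfin, hrank⟩ := eR.finite_quotient_and_finrank_eq (V := V) (by
    rw [hdiff]; exact Finset.finite_toSet _)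
  rw [hdiff, Set.ncard_coe_finset, Finset.card_sdiff_of_subset hsub] at hrank
  have hle := Finset.card_le_card hsub
  let S : Submodule F (Module.Dual F R) :=
    Submodule.span F (Set.range (AlgHom.toLinearMap : (R →ₐ[F] F) → _))
  have hS : Module.finrank F S = Fintype.card (R →ₐ[F] F) :=
    finrank_span_eq_card (linearIndependent_algHom_toLinearMap F R F)
  have : FiniteDimensional F S := FiniteDimensional.span_of_finite F (Set.finite_range _)
  let T : S →ₗ[F] Module.Dual F A := ι.toLinearMap.dualMap.domRestrict S
  have hT := LinearMap.finrank_range_add_finrank_ker (K := F) (V := S) T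
  have hrange : Module.finrank F (LinearMap.range T) ≤ Fintype.card (A →ₐ[F] F) := by
    have hle : LinearMap.range T ≤
        Submodule.span F (Set.range (AlgHom.toLinearMap : (A →ₐ[F] F) → _)) := by
      rw [LinearMap.range_domRestrict, Submodule.map_span, Submodule.span_le]
      rintro _ ⟨_, ⟨φ, rfl⟩, rfl⟩
      exact Submodule.subset_span ⟨φ.comp ι, rfl⟩
    have : FiniteDimensional F (Submodule.span F
        (Set.range (AlgHom.toLinearMap : (A →ₐ[F] F) → (A →ₗ[F] F)))) :=
      FiniteDimensional.span_of_finite F (Set.finite_range _)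
    refine (Submodule.finrank_mono hle).trans ?_
    exact finrank_range_le_card _
  have hker : Module.finrank F (LinearMap.ker T) ≤ Module.finrank F (R ⧸ V) := by
    have hfd : FiniteDimensional F V.dualAnnihilator :=
      Module.Finite.equiv (V.dualQuotEquivDualAnnihilator)
    have hmap : (LinearMap.ker T).map S.subtype ≤ V.dualAnnihilator := by
      rintro _ ⟨s, hs, rfl⟩
      rw [← LinearMap.ker_dualMap_eq_dualAnnihilator_range]
      exact hs
    rw [← Subspace.dual_finrank_eq (K := F) (V := R ⧸ V),
      (V.dualQuotEquivDualAnnihilator).finrank_eq,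
      (Submodule.equivMapOfInjective S.subtype S.injective_subtype (LinearMap.ker T)).finrank_eq]
    exact Submodule.finrank_mono hmap
  unfold genus
  omega

end PoleEmbedding

end BasePoints

section IdealCount

open UniqueFactorizationMonoid

namespace PoleEmbedding

variable {F : Type*} [Field F] {R : Type*} [CommRing R] [Algebra F R]

theorem cardQuot_eq [Finite F] (e : PoleEmbedding F R) {I : Ideal R} (hI : I ≠ ⊥) :
    Submodule.cardQuot I = Nat.card F ^ deg F I := by
  have := e.finite_quotient hI
  rw [Submodule.cardQuot_apply, deg]
  exact Module.natCard_eq_pow_finrank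

include F in
theorem infinite (e : PoleEmbedding F R) : Infinite R := by
  obtain ⟨n, hn⟩ := Infinite.exists_notMem_finset (insert 0 e.gaps)
  rw [Finset.mem_insert, not_or, e.mem_gaps, not_not] at hn
  obtain ⟨hn0, x, hx⟩ := hn
  refine Infinite.of_injective (fun i : ℕ => x ^ i) fun i j hij => ?_
  have h1 := hx.pow i
  have h2 := hx.pow j
  rw [← map_pow, show x ^ i = x ^ j from hij, map_pow] at h1
  have h3 := h1.unique h2
  exact_mod_cast mul_right_cancel₀ (by exact_mod_cast hn0) h3

theorem deg_mul [Finite F] [IsDedekindDomain R] (e : PoleEmbedding F R) {I J : Ideal R}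
    (hI : I ≠ ⊥) (hJ : J ≠ ⊥) : deg F (I * J) = deg F I + deg F J := by
  have : Infinite R := e.infinite
  have h : Submodule.cardQuot (I * J) = Submodule.cardQuot I * Submodule.cardQuot J :=
    multiplicative_of_coprime Submodule.cardQuot I J (Submodule.cardQuot_bot _ _)
      (fun {I J} hI => by simp [Ideal.isUnit_iff.mp hI, Ideal.mul_top])
      (fun {I} i hI =>
        have : Ideal.IsPrime I := Ideal.isPrime_of_prime hI
        cardQuot_pow_of_prime hI.ne_zero)
      fun {I J} hIJ => cardQuot_mul_of_coprime <| Ideal.isCoprime_iff_sup_eq.mpr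
        (Ideal.isUnit_iff.mp
          (hIJ (Ideal.dvd_iff_le.mpr le_sup_left) (Ideal.dvd_iff_le.mpr le_sup_right)))
  rw [e.cardQuot_eq hI, e.cardQuot_eq hJ, e.cardQuot_eq (mul_ne_zero hI hJ), ← pow_add] at h
  exact Nat.pow_right_injective Finite.one_lt_card h

theorem deg_top : deg F (⊤ : Ideal R) = 0 := by
  have : Subsingleton (R ⧸ (⊤ : Ideal R)) := Ideal.Quotient.subsingleton_iff.mpr rfl
  exact Module.finrank_zero_of_subsingleton

theorem deg_eq_zero_iff (e : PoleEmbedding F R) {I : Ideal R} (hI : I ≠ ⊥) :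
    deg F I = 0 ↔ I = ⊤ := by
  have := e.finite_quotient hI
  rw [deg, Module.finrank_zero_iff, Ideal.Quotient.subsingleton_iff]

/-- The nonzero ideals of degree `m`. -/
def idealsOfDeg (F R : Type*) [Field F] [CommRing R] [Algebra F R] (m : ℕ) : Set (Ideal R) :=
  {I | I ≠ ⊥ ∧ deg F I = m}

theorem finite_idealsOfDeg [Finite F] (e : PoleEmbedding F R) (m : ℕ) :
    (idealsOfDeg F R m).Finite := by
  have := e.isDomain
  have hfin : Finite (e.filt ((m + e.genus + 1 : ℕ) : ℤ)) := Module.finite_of_finite F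
  have hfin' : (e.filt ((m + e.genus + 1 : ℕ) : ℤ) : Set R).Finite := Set.toFinite _
  refine ((hfin'.sdiff (t := {0})).biUnion (t := fun a => {I : Ideal R | a ∈ I}) ?_).subset ?_
  · intro a ha
    have ha0 : a ≠ 0 := ha.2
    have h1 := e.finite_quotient (I := Ideal.span {a}) (by simpa [Ideal.span_singleton_eq_bot])
    have h2 : Finite (R ⧸ Ideal.span {a}) := Module.finite_of_finite F
    have h3 : Finite (Ideal (R ⧸ Ideal.span {a})) := inferInstance
    refine Set.Finite.of_finite_image (f := Ideal.map (Ideal.Quotient.mk (Ideal.span {a})))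
      (Set.toFinite _) ?_
    intro I hI J hJ h
    have key : ∀ I : Ideal R, a ∈ I → (I.map (Ideal.Quotient.mk (Ideal.span {a}))).comap
        (Ideal.Quotient.mk (Ideal.span {a})) = I := fun I hI => by
      rw [Ideal.comap_map_of_surjective _ Ideal.Quotient.mk_surjective, sup_eq_left,
        ← RingHom.ker_eq_comap_bot, Ideal.mk_ker, Ideal.span_singleton_le_iff_mem]
      exact hI
    rw [← key I hI, ← key J hJ, h]
  · rintro I ⟨hI, hm⟩
    have := e.finite_quotient hI
    have hrank := e.le_finrank_filt (m + e.genus + 1)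
    let T : e.filt ((m + e.genus + 1 : ℕ) : ℤ) →ₗ[F] R ⧸ I :=
      (Ideal.Quotient.mkₐ F I).toLinearMap.domRestrict _
    have hT : LinearMap.ker T ≠ ⊥ := LinearMap.ker_ne_bot_of_finrank_lt (by
      rw [deg] at hm
      omega)
    obtain ⟨a, ha, ha0⟩ := Submodule.exists_mem_ne_zero_of_ne_bot hT
    rw [Set.mem_iUnion₂]
    refine ⟨a, ⟨a.2, fun h => ha0 (Subtype.ext h)⟩, ?_⟩
    exact Ideal.Quotient.eq_zero_iff_mem.mp ha

end PoleEmbedding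

end IdealCount

section IdealClassCount

variable {F : Type*} [Field F]

theorem HasPole.exists_sub_smul_mem {f g : Laurent F} {n : ℤ} (hf : HasPole f n)
    (hg : HasPole g n) : ∃ c : F, c ≠ 0 ∧ f - c • g ∈ poleFilt F n := by
  refine ⟨f.coeff (-n) / g.coeff (-n), div_ne_zero hf.1 hg.1, fun m hm => ?_⟩
  rcases hm.lt_or_eq with h | rfl
  · simp [hf.2 m h, hg.2 m h]
  · rw [Laurent.coeff_sub, Laurent.coeff_smul, div_mul_cancel₀ _ hg.1, sub_self]

namespace PoleEmbedding

variable {R : Type*} [CommRing R] [Algebra F R]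

theorem exists_eq_algebraMap (e : PoleEmbedding F R) {u : R} (hu : HasPole (e.toAlgHom u) 0) :
    ∃ c : F, u = algebraMap F R c := by
  obtain ⟨c, -, hc⟩ := hu.exists_sub_smul_mem hasPole_one
  refine ⟨c, sub_eq_zero.mp (e.eq_zero_of_mem _ ?_)⟩
  rwa [map_sub, AlgHom.commutes, Algebra.algebraMap_eq_smul_one]

theorem ncard_ideals_in_class [Finite F] [IsDedekindDomain R] (e : PoleEmbedding F R)
    {J : Ideal R} (hJ : J ≠ ⊥) {m : ℕ} (hm : 2 * e.genus ≤ m) :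
    {I ∈ idealsOfDeg F R m | ∃ a ≠ (0 : R), I * J = Ideal.span {a}}.ncard =
      Nat.card F ^ (m - e.genus) := by
  classical
  set w := m + deg F J with hw
  have hw2 : deg F J + 2 * e.genus ≤ w := by omega
  obtain ⟨a₀, ha₀J, ha₀⟩ : w ∈ e.polesIdeal J := by
    by_contra h
    have := e.lt_of_notMem_polesIdeal hJ h
    omega
  set V := J.restrictScalars F ⊓ e.filt w with hV
  have hVfin : FiniteDimensional F V := e.finiteDimensional_inf_filt _ w
  have hVcard : Nat.card V = Nat.card F ^ (m - e.genus) := by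
    rw [Module.natCard_eq_pow_finrank (K := F), e.finrank_inf_filt]
    have h := e.card_filter_polesIdeal hJ hw2
    congr 1
    change (Finset.filter (· ∈ e.polesIdeal J) _).card = _
    omega
  have hpole : ∀ x : V, HasPole (e.toAlgHom (a₀ + x)) w := fun x => by
    rw [map_add]
    exact ha₀.add_of_lt x.2.2
  have hne : ∀ x : V, a₀ + (x : R) ≠ 0 := fun x h => by
    have := (hpole x).ne_zero
    rw [h, map_zero] at this
    exact this rfl
  have hex : ∀ x : V, ∃ I : Ideal R, Ideal.span {a₀ + (x : R)} = J * I := fun x => by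
    refine Ideal.dvd_iff_le.mpr ?_
    rw [Ideal.span_singleton_le_iff_mem]
    exact J.add_mem ha₀J x.2.1
  choose G hG using hex
  have hspan : ∀ x : V, Ideal.span {a₀ + (x : R)} ≠ ⊥ := fun x => by
    simpa [Ideal.span_singleton_eq_bot] using hne x
  have hG0 : ∀ x, G x ≠ ⊥ := fun x h => hspan x (by rw [hG, h, Ideal.mul_bot])
  have hinj : Function.Injective G := by
    intro x y hxy
    have hmem : a₀ + (y : R) ∈ Ideal.span {a₀ + (x : R)} := by
      rw [hG x, hxy, ← hG y]
      exact Ideal.mem_span_singleton_self _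
    obtain ⟨u, hu⟩ := Ideal.mem_span_singleton.mp hmem
    have hu0 : u ≠ 0 := by
      rintro rfl
      exact hne y (by rw [hu, mul_zero])
    obtain ⟨r, hr⟩ := e.exists_hasPole hu0
    have h1 := (hpole x).mul hr
    rw [← map_mul, ← hu] at h1
    have h2 := (hpole y).unique h1
    have hr0 : r = 0 := by omega
    rw [hr0] at hr
    obtain ⟨c, rfl⟩ := e.exists_eq_algebraMap (by simpa using hr)
    have h3 : (y : R) - c • (x : R) = (c - 1) • a₀ := by
      rw [sub_smul, one_smul, Algebra.smul_def, Algebra.smul_def]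
      linear_combination hu
    have h4 : (y : R) - c • (x : R) ∈ e.filt w :=
      (e.filt w).sub_mem y.2.2 ((e.filt w).smul_mem c x.2.2)
    have hc : c = 1 := by
      by_contra hc
      rw [h3, mem_filt, map_smul, (ha₀.smul (sub_ne_zero.mpr hc)).mem_poleFilt_iff] at h4
      exact lt_irrefl _ h4
    rw [hc, sub_self, zero_smul, one_smul, sub_eq_zero] at h3
    exact Subtype.ext h3.symm
  rw [← hVcard, ← Set.ncard_univ, ← Set.ncard_image_of_injective _ hinj, Set.image_univ]
  congr 1
  ext I
  constructor
  · rintro ⟨⟨hI0, hIm⟩, a, ha0, ha⟩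
    obtain ⟨n, hn⟩ := e.exists_hasPole ha0
    have hd := e.deg_mul hI0 hJ
    rw [ha, e.deg_span_singleton hn, hIm, ← hw] at hd
    rw [hd] at hn
    obtain ⟨c, hc0, hc⟩ := ha₀.exists_sub_smul_mem hn
    have haIJ : a ∈ I * J := by
      rw [ha]
      exact Ideal.mem_span_singleton_self a
    have haJ : a ∈ J := Ideal.mul_le_right haIJ
    let x : V := ⟨c • a - a₀, (J.restrictScalars F).sub_mem
      ((J.restrictScalars F).smul_mem c haJ) ha₀J, by
        rw [← neg_sub]
        refine (e.filt w).neg_mem ?_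
        rw [mem_filt, map_sub, map_smul]
        exact hc⟩
    have hx : a₀ + (x : R) = algebraMap F R c * a := by
      rw [← Algebra.smul_def]
      exact add_sub_cancel _ _
    refine ⟨x, mul_left_cancel₀ hJ ?_⟩
    rw [← hG, hx, mul_comm J, ha]
    exact Ideal.span_singleton_mul_left_unit ((isUnit_iff_ne_zero.mpr hc0).map _) a
  · rintro ⟨x, rfl⟩
    refine ⟨⟨hG0 x, ?_⟩, a₀ + x, hne x, by rw [mul_comm, hG]⟩
    have hd := e.deg_mul hJ (hG0 x)
    rw [← hG, e.deg_span_singleton (hpole x)] at hd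
    omega

theorem ncard_idealsOfDeg_succ [Finite F] [IsDedekindDomain R] (e : PoleEmbedding F R) {m : ℕ}
    (hm : 2 * e.genus ≤ m) :
    (idealsOfDeg F R (m + 1)).ncard = Nat.card F * (idealsOfDeg F R m).ncard := by
  classical
  have key : ∀ m, 2 * e.genus ≤ m →
      (idealsOfDeg F R m).ncard = Nat.card (ClassGroup R) * Nat.card F ^ (m - e.genus) := by
    intro m hm
    have hfin := e.finite_idealsOfDeg m
    have := hfin.to_subtype
    let cls : idealsOfDeg F R m → ClassGroup R :=
      fun I => ClassGroup.mk0 ⟨I, mem_nonZeroDivisors_of_ne_zero I.2.1⟩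
    have hcls : ∀ (I : idealsOfDeg F R m) (J : nonZeroDivisors (Ideal R)),
        cls I = (ClassGroup.mk0 J)⁻¹ ↔ ∃ a ≠ (0 : R), (I : Ideal R) * J = Ideal.span {a} :=
      fun I J => ClassGroup.mk0_eq_mk0_inv_iff
        (I := ⟨I, mem_nonZeroDivisors_of_ne_zero I.2.1⟩) (J := J)
    have hfib : ∀ C : ClassGroup R, Nat.card {I // cls I = C} = Nat.card F ^ (m - e.genus) := by
      intro C
      obtain ⟨J, hJ⟩ := ClassGroup.mk0_surjective C⁻¹
      have hJ0 : (J : Ideal R) ≠ ⊥ := nonZeroDivisors.coe_ne_zero J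
      obtain rfl : C = (ClassGroup.mk0 J)⁻¹ := by rw [hJ, inv_inv]
      rw [← e.ncard_ideals_in_class hJ0 hm, ← Nat.card_coe_set_eq]
      exact Nat.card_congr ⟨fun I => ⟨I.1.1, I.1.2, (hcls I.1 J).mp I.2⟩,
        fun I => ⟨⟨I.1, I.2.1⟩, (hcls _ J).mpr I.2.2⟩, fun I => rfl, fun I => rfl⟩
    have hsurj : Function.Surjective cls := by
      intro C
      have h : 0 < Nat.card {I // cls I = C} := by
        rw [hfib]
        exact pow_pos Nat.card_pos _
      obtain ⟨I⟩ := (Nat.card_pos_iff.mp h).1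
      exact ⟨I.1, I.2⟩
    have := Finite.of_surjective cls hsurj
    have := Fintype.ofFinite (ClassGroup R)
    rw [← Nat.card_coe_set_eq, ← Nat.card_congr (Equiv.sigmaFiberEquiv cls), Nat.card_sigma,
      Finset.sum_congr rfl fun C _ => hfib C]
    simp [Nat.card_eq_fintype_card]
  rw [key _ hm, key (m + 1) (by omega), Nat.succ_sub (by omega), pow_succ]
  ring

end PoleEmbedding

end IdealClassCount

section PrimeIdealCount

open UniqueFactorizationMonoid

namespace PoleEmbedding

variable {F : Type*} [Field F] {R : Type*} [CommRing R] [Algebra F R]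

theorem deg_pos (e : PoleEmbedding F R) {P : Ideal R} (hP : P ≠ ⊥) (hprime : P.IsPrime) :
    0 < deg F P :=
  Nat.pos_of_ne_zero fun h => hprime.ne_top ((e.deg_eq_zero_iff hP).mp h)

variable [Finite F]

theorem finite_primes (e : PoleEmbedding F R) (m : ℕ) :
    {P : Ideal R | P ≠ ⊥ ∧ P.IsPrime ∧ deg F P ≤ m}.Finite := by
  refine ((Finset.range (m + 1)).finite_toSet.biUnion
    fun d _ => e.finite_idealsOfDeg d).subset fun P hP => ?_
  rw [Set.mem_iUnion₂]
  exact ⟨deg F P, by simpa using Nat.lt_succ_of_le hP.2.2, hP.1, rfl⟩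

/-- The nonzero primes of degree at most `m`. -/
noncomputable def primes (e : PoleEmbedding F R) (m : ℕ) : Finset (Ideal R) :=
  (e.finite_primes m).toFinset

theorem mem_primes (e : PoleEmbedding F R) {m : ℕ} {P : Ideal R} :
    P ∈ e.primes m ↔ P ≠ ⊥ ∧ P.IsPrime ∧ deg F P ≤ m :=
  (e.finite_primes m).mem_toFinset

/-- The number of geometric points defined over the extension of degree `j`, counted through the
primes on which they lie. -/
noncomputable def pointCount (e : PoleEmbedding F R) (j : ℕ) : ℕ :=
  ∑ P ∈ e.primes j with deg F P ∣ j, deg F P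

theorem pointCount_eq (e : PoleEmbedding F R) {j m : ℕ} (hj : 1 ≤ j) (hjm : j ≤ m) :
    e.pointCount j = ∑ P ∈ e.primes m with deg F P ∣ j, deg F P := by
  refine Finset.sum_congr ?_ fun _ _ => rfl
  ext P
  simp only [Finset.mem_filter, mem_primes]
  constructor
  · rintro ⟨⟨h1, h2, h3⟩, h4⟩
    exact ⟨⟨h1, h2, h3.trans hjm⟩, h4⟩
  · rintro ⟨⟨h1, h2, -⟩, h4⟩
    exact ⟨⟨h1, h2, Nat.le_of_dvd hj h4⟩, h4⟩

variable [IsDedekindDomain R]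

theorem deg_multiset_prod (e : PoleEmbedding F R) (s : Multiset (Ideal R)) (hs : ∀ I ∈ s, I ≠ ⊥) :
    s.prod ≠ ⊥ ∧ deg F s.prod = (s.map (deg F)).sum := by
  induction s using Multiset.induction_on with
  | empty => exact ⟨by simp, by simpa using deg_top⟩
  | cons I s ih =>
    obtain ⟨h1, h2⟩ := ih fun J hJ => hs J (Multiset.mem_cons_of_mem hJ)
    have hI := hs I (Multiset.mem_cons_self I s)
    rw [Multiset.prod_cons, Multiset.map_cons, Multiset.sum_cons, e.deg_mul hI h1, h2]
    exact ⟨mul_ne_zero hI h1, rfl⟩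

theorem deg_pow (e : PoleEmbedding F R) {I : Ideal R} (hI : I ≠ ⊥) (i : ℕ) :
    deg F (I ^ i) = i * deg F I := by
  have h := (e.deg_multiset_prod (Multiset.replicate i I) fun J hJ =>
    (Multiset.eq_of_mem_replicate hJ) ▸ hI).2
  simpa using h

theorem deg_eq_sum_primes (e : PoleEmbedding F R) {I : Ideal R} (hI : I ≠ ⊥) :
    open Classical in
    deg F I = ∑ P ∈ e.primes (deg F I), (normalizedFactors I).count P * deg F P := by
  classical
  set s := normalizedFactors I with hs
  have hmem : ∀ P ∈ s, P ≠ ⊥ ∧ P.IsPrime := fun P hP =>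
    have h := prime_of_normalized_factor P hP
    ⟨h.ne_zero, Ideal.isPrime_of_prime h⟩
  have hprod : s.prod = I := Ideal.prod_normalizedFactors_eq_self hI
  have h := (e.deg_multiset_prod s fun P hP => (hmem P hP).1).2
  rw [hprod] at h
  have hsub : s.toFinset ⊆ e.primes (deg F I) := by
    intro P hP
    rw [Multiset.mem_toFinset] at hP
    refine e.mem_primes.mpr ⟨(hmem P hP).1, (hmem P hP).2, ?_⟩
    rw [h]
    exact Multiset.single_le_sum (fun _ _ => Nat.zero_le _) _ (Multiset.mem_map_of_mem _ hP)
  rw [← Finset.sum_subset hsub fun P _ hP => ?_, h, Finset.sum_multiset_map_count]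
  · simp [smul_eq_mul]
  · rw [Multiset.mem_toFinset, ← Multiset.count_eq_zero] at hP
    rw [hP, zero_mul]

theorem card_pow_dvd (e : PoleEmbedding F R) {I P : Ideal R} (hI : I ≠ ⊥)
    (hP : P ∈ e.primes (deg F I)) :
    open Classical in
    ((Finset.Icc 1 (deg F I)).filter fun j => deg F P ∣ j ∧ P ^ (j / deg F P) ∣ I).card =
      (normalizedFactors I).count P := by
  classical
  have hd := e.deg_eq_sum_primes hI
  have hle := Finset.single_le_sum (f := fun P => (normalizedFactors I).count P * deg F P)
    (fun _ _ => Nat.zero_le _) hP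
  simp only [← hd] at hle
  obtain ⟨hP0, hPp, -⟩ := e.mem_primes.mp hP
  have hpos := e.deg_pos hP0 hPp
  have hpr : Prime P := Ideal.prime_of_isPrime hP0 hPp
  have hdvd : ∀ i, P ^ i ∣ I ↔ i ≤ (normalizedFactors I).count P := fun i => by
    rw [dvd_iff_normalizedFactors_le_normalizedFactors (pow_ne_zero _ hP0) hI,
      hpr.irreducible.normalizedFactors_pow, normalize_eq, Multiset.le_count_iff_replicate_le]
  have hcard : (Finset.Icc 1 ((normalizedFactors I).count P)).card =
      (normalizedFactors I).count P := by simp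
  rw [← hcard]
  refine (Finset.card_bij (fun i _ => i * deg F P) ?_ ?_ ?_).symm
  · intro i hi
    rw [Finset.mem_Icc] at hi
    rw [Finset.mem_filter, Finset.mem_Icc, Nat.mul_div_cancel _ hpos, hdvd]
    exact ⟨⟨Nat.mul_pos hi.1 hpos, (Nat.mul_le_mul_right _ hi.2).trans hle⟩, Dvd.intro_left _ rfl,
      hi.2⟩
  · intro i _ j _ hij
    exact Nat.eq_of_mul_eq_mul_right hpos hij
  · intro j hj
    rw [Finset.mem_filter, Finset.mem_Icc] at hj
    obtain ⟨⟨h1, h2⟩, ⟨i, rfl⟩, h4⟩ := hj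
    rw [Nat.mul_div_cancel_left _ hpos, hdvd] at h4
    refine ⟨i, Finset.mem_Icc.mpr ⟨Nat.pos_of_ne_zero fun h => ?_, h4⟩, mul_comm _ _⟩
    simp [h] at h1

theorem ncard_multiples (e : PoleEmbedding F R) {K : Ideal R} (hK : K ≠ ⊥) {m : ℕ}
    (hm : deg F K ≤ m) :
    {I ∈ idealsOfDeg F R m | K ∣ I}.ncard = (idealsOfDeg F R (m - deg F K)).ncard := by
  have hinj : Function.Injective fun I : Ideal R => K * I := fun I J h => mul_left_cancel₀ hK h
  rw [← Set.ncard_image_of_injective (idealsOfDeg F R (m - deg F K)) hinj]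
  congr 1
  ext I
  constructor
  · rintro ⟨⟨h0, h⟩, J, rfl⟩
    have hJ : J ≠ ⊥ := fun h => h0 (by rw [h, Ideal.mul_bot])
    rw [e.deg_mul hK hJ] at h
    exact ⟨J, ⟨hJ, by omega⟩, rfl⟩
  · rintro ⟨J, ⟨hJ, h⟩, rfl⟩
    refine ⟨⟨mul_ne_zero hK hJ, ?_⟩, dvd_mul_right _ _⟩
    rw [e.deg_mul hK hJ]
    omega

theorem mul_ncard_idealsOfDeg (e : PoleEmbedding F R) (m : ℕ) :
    m * (idealsOfDeg F R m).ncard =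
      ∑ j ∈ Finset.Icc 1 m, e.pointCount j * (idealsOfDeg F R (m - j)).ncard := by
  classical
  have hfin := e.finite_idealsOfDeg m
  have h1 : ∀ I ∈ hfin.toFinset, m = ∑ P ∈ e.primes m, ∑ j ∈ Finset.Icc 1 m,
      if deg F P ∣ j ∧ P ^ (j / deg F P) ∣ I then deg F P else 0 := by
    intro I hI
    obtain ⟨hI0, rfl⟩ := hfin.mem_toFinset.mp hI
    nth_rw 1 [e.deg_eq_sum_primes hI0]
    refine Finset.sum_congr rfl fun P hP => ?_
    rw [← Finset.sum_filter, Finset.sum_const, e.card_pow_dvd hI0 hP, smul_eq_mul]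
  have h2 : m * (idealsOfDeg F R m).ncard = ∑ I ∈ hfin.toFinset, m := by
    rw [Finset.sum_const, Set.ncard_eq_toFinset_card _ hfin, smul_eq_mul, mul_comm]
  rw [h2, Finset.sum_congr rfl h1, Finset.sum_comm]
  simp_rw [Finset.sum_comm (s := hfin.toFinset)]
  rw [Finset.sum_comm]
  refine Finset.sum_congr rfl fun j hj => ?_
  rw [Finset.mem_Icc] at hj
  rw [e.pointCount_eq hj.1 hj.2, Finset.sum_mul, Finset.sum_filter]
  refine Finset.sum_congr rfl fun P hP => ?_
  obtain ⟨hP0, hPp, -⟩ := e.mem_primes.mp hP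
  by_cases hdvd : deg F P ∣ j
  · simp only [hdvd, true_and, if_true]
    have hdeg : deg F (P ^ (j / deg F P)) = j := by
      rw [e.deg_pow hP0, Nat.div_mul_cancel hdvd]
    have h3 := e.ncard_multiples (pow_ne_zero (j / deg F P) hP0) (hdeg.trans_le hj.2)
    rw [hdeg] at h3
    rw [← h3, ← Finset.sum_filter, Finset.sum_const, smul_eq_mul, mul_comm,
      ← Set.ncard_coe_finset]
    congr 2
    ext I
    simp
  · simp [hdvd]

end PoleEmbedding

end PrimeIdealCount

section FrobeniusPoints

namespace PoleEmbedding

variable {F : Type*} [Field F] {R : Type*} [CommRing R] [Algebra F R] [IsDedekindDomain R]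

theorem deg_ker_dvd [Fintype F] (e : PoleEmbedding F R) {K : Type*} [Field K] [Algebra F K]
    {j : ℕ} (hj : 1 ≤ j) {φ : R →ₐ[F] K} (hφ : φ ∈ frobPoints F R K j) :
    RingHom.ker φ ≠ ⊥ ∧ (RingHom.ker φ).IsPrime ∧ deg F (RingHom.ker φ) ∣ j := by
  have hprime : (RingHom.ker φ).IsPrime := RingHom.ker_isPrime φ
  have h0 : RingHom.ker φ ≠ ⊥ := by
    obtain ⟨n, hn⟩ := Infinite.exists_notMem_finset (insert 0 e.gaps)
    rw [Finset.mem_insert, not_or, e.mem_gaps, not_not] at hn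
    obtain ⟨hn0, x, hx⟩ := hn
    intro hker
    have hmem : x ^ Fintype.card F ^ j - x ∈ RingHom.ker φ := by
      rw [RingHom.mem_ker, map_sub, map_pow, sub_eq_zero]
      exact hφ x
    rw [hker, Ideal.mem_bot, sub_eq_zero] at hmem
    have h1 := hx.pow (Fintype.card F ^ j)
    rw [← map_pow, hmem] at h1
    have h2 := h1.unique hx
    have hQ : 1 < Fintype.card F ^ j := Nat.one_lt_pow (by omega) Fintype.one_lt_card
    have h3 : Fintype.card F ^ j * n = n := by exact_mod_cast h2
    nlinarith [Nat.pos_of_ne_zero hn0]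
  refine ⟨h0, hprime, ?_⟩
  have hfin := e.finite_quotient h0
  have hmax : (RingHom.ker φ).IsMaximal := Ring.DimensionLEOne.maximalOfPrime h0 hprime
  let _ : Field (R ⧸ RingHom.ker φ) := Ideal.Quotient.field _
  have : Finite (R ⧸ RingHom.ker φ) := Module.finite_of_finite F
  rw [deg]
  rw [← FiniteField.orderOf_frobeniusAlgHom F (R ⧸ RingHom.ker φ)]
  refine orderOf_dvd_of_pow_eq_one (AlgHom.ext fun z => ?_)
  rw [frobeniusAlgHom_pow_apply, AlgHom.one_apply]
  obtain ⟨r, rfl⟩ := Ideal.Quotient.mk_surjective z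
  rw [← map_pow, Ideal.Quotient.eq, RingHom.mem_ker, map_sub, map_pow, sub_eq_zero]
  exact hφ r

theorem ncard_frobPoints_le_pointCount [Fintype F] (e : PoleEmbedding F R) (K : Type*) [Field K]
    [Algebra F K] {j : ℕ} (hj : 1 ≤ j) : (frobPoints F R K j).ncard ≤ e.pointCount j := by
  classical
  have hfib : ∀ P : Ideal R, P ≠ ⊥ →
      {φ : R →ₐ[F] K | RingHom.ker φ = P}.Finite ∧
      {φ : R →ₐ[F] K | RingHom.ker φ = P}.ncard ≤ deg F P := by
    intro P hP
    have hfin := e.finite_quotient hP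
    have : Finite ((R ⧸ P) →ₐ[F] K) := inferInstance
    have hsub : {φ : R →ₐ[F] K | RingHom.ker φ = P} ⊆
        Set.range fun ψ : (R ⧸ P) →ₐ[F] K => ψ.comp (Ideal.Quotient.mkₐ F P) := by
      intro φ hφ
      refine ⟨Ideal.Quotient.liftₐ P φ fun a ha => ?_, ?_⟩
      · rwa [← RingHom.mem_ker, hφ]
      · ext a
        rfl
    refine ⟨(Set.finite_range _).subset hsub, ?_⟩
    refine (Set.ncard_le_ncard hsub (Set.finite_range _)).trans ?_
    rw [← Set.image_univ]
    refine (Set.ncard_image_le Set.finite_univ).trans ?_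
    rw [Set.ncard_univ]
    exact card_algHom_le_finrank F (R ⧸ P) K
  have hsub : frobPoints F R K j ⊆ ⋃ P ∈ (e.primes j).filter (deg F · ∣ j),
      {φ : R →ₐ[F] K | RingHom.ker φ = P} := by
    intro φ hφ
    obtain ⟨h1, h2, h3⟩ := e.deg_ker_dvd hj hφ
    rw [Set.mem_iUnion₂]
    exact ⟨RingHom.ker φ, Finset.mem_filter.mpr ⟨e.mem_primes.mpr
      ⟨h1, h2, Nat.le_of_dvd hj h3⟩, h3⟩, rfl⟩
  have hP0 : ∀ P ∈ (e.primes j).filter (deg F · ∣ j), P ≠ ⊥ := fun P hP =>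
    (e.mem_primes.mp (Finset.mem_filter.mp hP).1).1
  refine (Set.ncard_le_ncard hsub ((Finset.finite_toSet _).biUnion fun P hP =>
    (hfib P (hP0 P hP)).1)).trans ?_
  refine (Finset.set_ncard_biUnion_le _ _).trans (Finset.sum_le_sum fun P hP => ?_)
  exact (hfib P (hP0 P hP)).2

omit [IsDedekindDomain R] in
theorem pointCount_one_le [Finite F] (e : PoleEmbedding F R) :
    e.pointCount 1 ≤ Nat.card (R →ₐ[F] F) := by
  classical
  have hfinA := e.finite_algHom
  have := Fintype.ofFinite (R →ₐ[F] F)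
  have h1 : e.pointCount 1 = ((e.primes 1).filter (deg F · ∣ 1)).card := by
    rw [pointCount, Finset.card_eq_sum_ones]
    exact Finset.sum_congr rfl fun P hP => Nat.dvd_one.mp (Finset.mem_filter.mp hP).2
  have hsub : (e.primes 1).filter (deg F · ∣ 1) ⊆
      Finset.univ.image fun φ : R →ₐ[F] F => RingHom.ker φ := by
    intro P hP
    obtain ⟨hP1, hP2⟩ := Finset.mem_filter.mp hP
    obtain ⟨hP0, hPp, -⟩ := e.mem_primes.mp hP1
    have hfin := e.finite_quotient hP0
    have hdom : IsDomain (R ⧸ P) := Ideal.Quotient.isDomain P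
    rw [Nat.dvd_one, deg] at hP2
    have hbij : Function.Bijective (algebraMap F (R ⧸ P)) := by
      refine ⟨(algebraMap F (R ⧸ P)).injective, fun z => ?_⟩
      obtain ⟨c, hc⟩ := (finrank_eq_one_iff_of_nonzero' (1 : R ⧸ P) one_ne_zero).mp hP2 z
      exact ⟨c, by rw [Algebra.algebraMap_eq_smul_one, hc]⟩
    let E := AlgEquiv.ofBijective (Algebra.ofId F (R ⧸ P)) hbij
    refine Finset.mem_image.mpr ⟨(E.symm : (R ⧸ P) →ₐ[F] F).comp (Ideal.Quotient.mkₐ F P),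
      Finset.mem_univ _, ?_⟩
    ext a
    rw [RingHom.mem_ker, ← Ideal.Quotient.eq_zero_iff_mem]
    exact E.symm.map_eq_zero_iff
  rw [h1, Nat.card_eq_fintype_card]
  exact (Finset.card_le_card hsub).trans Finset.card_image_le

end PoleEmbedding

end FrobeniusPoints

section PowerSums

open PowerSeries in
theorem exists_prod_one_sub_of_coeff_zero {K : Type*} [Field K] [IsAlgClosed K]
    (p : Polynomial K) (hp : p.coeff 0 = 1) :
    ∃ s : Multiset K, s.card ≤ p.natDegree ∧
      (p : K⟦X⟧) = (s.map fun a => 1 - C a * X).prod := by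
  have h0 : ∀ r ∈ p.roots, r ≠ 0 := by
    rintro r hr rfl
    have := Polynomial.isRoot_of_mem_roots hr
    rw [Polynomial.IsRoot, ← Polynomial.coeff_zero_eq_eval_zero, hp] at this
    exact one_ne_zero this
  refine ⟨p.roots.map (·⁻¹), by simpa using p.card_roots', ?_⟩
  have hsplit := (IsAlgClosed.splits p).eq_prod_roots
  have key : ∀ t : Multiset K, (∀ r ∈ t, r ≠ 0) →
      ∃ c : K, (t.map fun r => Polynomial.X - Polynomial.C r).prod =
        Polynomial.C c * (t.map fun r => 1 - Polynomial.C r⁻¹ * Polynomial.X).prod := by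
    intro t
    induction t using Multiset.induction_on with
    | empty => exact fun _ => ⟨1, by simp⟩
    | cons a t ih =>
      intro ht
      obtain ⟨c, hc⟩ := ih fun r hr => ht r (Multiset.mem_cons_of_mem hr)
      have ha := ht a (Multiset.mem_cons_self a t)
      refine ⟨-a * c, ?_⟩
      have h1 : Polynomial.C a * Polynomial.C a⁻¹ = (1 : Polynomial K) := by
        rw [← Polynomial.C_mul, mul_inv_cancel₀ ha, Polynomial.C_1]
      rw [Multiset.map_cons, Multiset.prod_cons, hc, Multiset.map_cons, Multiset.prod_cons,
        Polynomial.C_mul, Polynomial.C_neg]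
      linear_combination (-Polynomial.C c * Polynomial.X *
        (t.map fun r => 1 - Polynomial.C r⁻¹ * Polynomial.X).prod) * h1
  obtain ⟨c, hc⟩ := key p.roots h0
  rw [hc, ← mul_assoc, ← Polynomial.C_mul] at hsplit
  have h1 : p.leadingCoeff * c = 1 := by
    have h2 : (p.roots.map fun r => 1 - Polynomial.C r⁻¹ * Polynomial.X).prod.eval 0 = 1 := by
      rw [Polynomial.eval_multiset_prod, Multiset.map_map]
      simp
    have := congrArg (Polynomial.eval 0) hsplit
    rw [Polynomial.eval_mul, h2, ← Polynomial.coeff_zero_eq_eval_zero, hp, Polynomial.eval_C,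
      mul_one] at this
    exact this.symm
  rw [h1, Polynomial.C_1, one_mul] at hsplit
  nth_rw 1 [hsplit]
  rw [← Polynomial.coeToPowerSeries.ringHom_apply, map_multiset_prod, Multiset.map_map,
    Multiset.map_map]
  congr 1
  refine Multiset.map_congr rfl fun r _ => ?_
  simp

open PowerSeries in
/-- The series `∑ j ≥ 1, a ^ j X ^ j`. -/
noncomputable def geomTail {K : Type*} [Field K] (a : K) : K⟦X⟧ :=
  mk fun j => if j = 0 then 0 else a ^ j

open PowerSeries in
theorem one_sub_mul_geomTail {K : Type*} [Field K] (a : K) :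
    (1 - C a * X) * geomTail a = C a * X := by
  ext j
  rw [sub_mul, one_mul, mul_assoc, map_sub, coeff_C_mul, coeff_C_mul]
  rcases j with _ | _ | j
  · simp [geomTail]
  · simp [geomTail, coeff_succ_X_mul]
  · simp [geomTail, coeff_succ_X_mul, coeff_X, pow_succ']

open PowerSeries in
theorem X_mul_derivative_prod {K : Type*} [Field K] (s : Multiset K) :
    X * derivative K (s.map fun a => 1 - C a * X).prod =
      -((s.map fun a => 1 - C a * X).prod * (s.map geomTail).sum) := by
  induction s using Multiset.induction_on with
  | empty => simp
  | cons a s ih =>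
    have h := one_sub_mul_geomTail a
    have hd : derivative K (1 - C a * X) = - C a := by
      simp [Derivation.leibniz]
    rw [Multiset.map_cons, Multiset.prod_cons, Multiset.map_cons, Multiset.sum_cons,
      Derivation.leibniz, hd, smul_eq_mul, smul_eq_mul]
    linear_combination (1 - C a * X) * ih + (s.map fun a => 1 - C a * X).prod * h

open PowerSeries in
theorem exists_power_sums {b N : ℕ → ℕ} {q d : ℕ} (hb0 : b 0 = 1)
    (hb : ∀ m, d ≤ m → b (m + 1) = q * b m)
    (hN : ∀ m, m * b m = ∑ j ∈ Finset.Icc 1 m, N j * b (m - j)) :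
    ∃ s : Multiset ℂ, s.card ≤ d ∧ ∀ j, 1 ≤ j → (N j : ℂ) = q ^ j - (s.map (· ^ j)).sum := by
  let B : ℂ⟦X⟧ := mk fun m => (b m : ℂ)
  let L : ℂ⟦X⟧ := (1 - C (q : ℂ) * X) * B
  have hL : ∀ m, d < m → coeff m L = 0 := by
    intro m hm
    obtain ⟨m, rfl⟩ := Nat.exists_eq_succ_of_ne_zero (by omega : m ≠ 0)
    simp only [L, B]
    rw [sub_mul, one_mul, mul_assoc, map_sub, coeff_C_mul, coeff_succ_X_mul, coeff_mk, coeff_mk,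
      hb m (by omega)]
    push_cast
    ring
  let p : Polynomial ℂ := trunc (d + 1) L
  have hpL : (p : ℂ⟦X⟧) = L := by
    ext m
    rw [Polynomial.coeff_coe, coeff_trunc]
    split_ifs with h
    · rfl
    · rw [hL m (by omega)]
  have hp0 : p.coeff 0 = 1 := by
    rw [← Polynomial.coeff_coe, hpL]
    simp [L, B, hb0]
  obtain ⟨s, hs, hsp⟩ := exists_prod_one_sub_of_coeff_zero p hp0
  refine ⟨s, hs.trans (Nat.lt_succ_iff.mp (natDegree_trunc_lt L d)), ?_⟩
  rw [hpL] at hsp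
  have hL0 : L ≠ 0 := by
    intro h
    rw [← hpL] at h
    have := congrArg (coeff 0) h
    rw [Polynomial.coeff_coe, hp0] at this
    simp at this
  let Ns : ℂ⟦X⟧ := mk fun j => if j = 0 then 0 else (N j : ℂ)
  have hDB : X * derivative ℂ B = Ns * B := by
    ext m
    have h1 : coeff m (X * derivative ℂ B) = (m : ℂ) * b m := by
      rcases m with _ | m
      · simp
      · rw [coeff_succ_X_mul, coeff_derivative, coeff_mk]
        push_cast
        ring
    have h2 := congrArg (Nat.cast : ℕ → ℂ) (hN m)
    push_cast at h2
    rw [h1, h2, coeff_mul, Finset.Nat.sum_antidiagonal_eq_sum_range_succ_mk,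
      Finset.sum_range_succ', show Finset.Icc 1 m = Finset.Ico 1 (m + 1) from rfl,
      Finset.sum_Ico_eq_sum_range, Nat.add_sub_cancel]
    simp [Ns, B, add_comm]
  have hD := X_mul_derivative_prod s
  rw [← hsp] at hD
  have hd : derivative ℂ (1 - C (q : ℂ) * X) = - C (q : ℂ) := by
    simp [Derivation.leibniz]
  have hD2 : X * derivative ℂ L = -(C (q : ℂ) * X) * B + (1 - C (q : ℂ) * X) * (Ns * B) := by
    rw [← hDB]
    simp only [L]
    rw [Derivation.leibniz, hd, smul_eq_mul, smul_eq_mul]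
    ring
  have hq := one_sub_mul_geomTail (q : ℂ)
  have hfin : L * (Ns - geomTail (q : ℂ) + (s.map geomTail).sum) = 0 := by
    have hLdef : L = (1 - C (q : ℂ) * X) * B := rfl
    linear_combination hD - hD2 + (Ns - geomTail (q : ℂ)) * hLdef - B * hq
  intro j hj
  have h := congrArg (coeff j) ((mul_eq_zero.mp hfin).resolve_left hL0)
  have hj0 : j ≠ 0 := by omega
  have hsum : coeff j (s.map geomTail).sum = (s.map (· ^ j)).sum := by
    rw [map_multiset_sum, Multiset.map_map]
    congr 1
    refine Multiset.map_congr rfl fun a _ => ?_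
    simp [geomTail, hj0]
  rw [map_add, map_sub, hsum] at h
  simp only [Ns, geomTail, coeff_mk, hj0, if_false, map_zero] at h
  linear_combination h

end PowerSums

section PowerBounds

open Filter Topology

theorem exists_pow_re_ge (s : Finset ℂ) (t₀ : ℕ) :
    ∃ t, t₀ ≤ t ∧ ∀ α ∈ s, ‖α‖ ^ t / 2 ≤ (α ^ t).re := by
  have hc := mapClusterPt_one_atTop_pow (fun α : s => Circle.exp (α : ℂ).arg)
  have hU : {v : s → Circle | ∀ α, 1 / 2 < ((v α : Circle) : ℂ).re} ∈ 𝓝 (1 : s → Circle) := by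
    refine IsOpen.mem_nhds ?_ (by intro α; norm_num)
    rw [Set.ofPred_forall]
    refine isOpen_iInter_of_finite fun α => isOpen_lt continuous_const ?_
    exact Complex.continuous_re.comp ((continuous_subtype_val : Continuous ((↑) : Circle → ℂ)).comp (continuous_apply α))
  obtain ⟨t, ht, h⟩ := (frequently_atTop.mp (mapClusterPt_iff_frequently.mp hc _ hU)) t₀
  refine ⟨t, ht, fun α hα => ?_⟩
  have h1 : 1 / 2 < ((Circle.exp α.arg ^ t : Circle) : ℂ).re := h ⟨α, hα⟩
  have h2 : α ^ t = ((‖α‖ ^ t : ℝ) : ℂ) * ((Circle.exp α.arg ^ t : Circle) : ℂ) := by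
    nth_rw 1 [← Complex.norm_mul_exp_arg_mul_I α]
    rw [mul_pow, Circle.coe_pow, Circle.coe_exp, Complex.ofReal_pow]
  rw [h2, Complex.re_ofReal_mul, div_eq_mul_one_div]
  exact mul_le_mul_of_nonneg_left h1.le (by positivity)

theorem norm_le_sqrt_of_sum_pow_re_le {s : Multiset ℂ} {q C : ℝ} {t₀ : ℕ} (hq : 0 < q)
    (h : ∀ t, t₀ ≤ t → (s.map (· ^ (2 * t))).sum.re ≤ C * q ^ t) :
    ∀ α ∈ s, ‖α‖ ≤ √q := by
  intro α hα
  by_contra! hlt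
  have hsq : 1 < ‖α‖ ^ 2 / q := by
    rw [one_lt_div hq]
    calc q = √q ^ 2 := (Real.sq_sqrt hq.le).symm
      _ < ‖α‖ ^ 2 := by gcongr
  obtain ⟨t₁, ht₁⟩ := eventually_atTop.mp
    ((tendsto_pow_atTop_atTop_of_one_lt hsq).eventually_gt_atTop (2 * C))
  obtain ⟨t, ht, hs⟩ := exists_pow_re_ge (s.toFinset.image (· ^ 2)) (max t₀ t₁)
  have hpos : ∀ β ∈ s, ‖β‖ ^ (2 * t) / 2 ≤ (β ^ (2 * t)).re := by
    intro β hβ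
    have := hs (β ^ 2) (Finset.mem_image_of_mem _ (Multiset.mem_toFinset.mpr hβ))
    rwa [norm_pow, ← pow_mul, ← pow_mul] at this
  have hsum : (α ^ (2 * t)).re ≤ (s.map (· ^ (2 * t))).sum.re := by
    obtain ⟨u, rfl⟩ := Multiset.exists_cons_of_mem hα
    rw [Multiset.map_cons, Multiset.sum_cons, Complex.add_re]
    have : 0 ≤ (u.map (· ^ (2 * t))).sum.re := by
      rw [← Complex.coe_reAddGroupHom, map_multiset_sum, Multiset.map_map]
      refine Multiset.sum_nonneg fun r hr => ?_
      obtain ⟨β, hβ, rfl⟩ := Multiset.mem_map.mp hr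
      exact le_trans (by positivity) (hpos β (Multiset.mem_cons_of_mem hβ))
    linarith
  have h1 := ht₁ t (le_trans (le_max_right _ _) ht)
  have h2 := h t (le_trans (le_max_left _ _) ht)
  have h3 := hpos α hα
  rw [div_pow, lt_div_iff₀ (by positivity), ← pow_mul] at h1
  linarith

end PowerBounds

section WeilBound

namespace PlaneModel

/-- A Hasse–Weil bound for the number of rational points of a plane model. -/
theorem card_le_card_algHom_add {F : Type*} [Field F] [Fintype F] (M : PlaneModel F) :
    (Fintype.card F : ℝ) ≤
      Nat.card (M.Ring →ₐ[F] F) + 2 * M.gaps.card * √(Fintype.card F) := by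
  let e := M.poleEmbedding
  have := e.isDomain
  obtain ⟨R, _, _, ι, eR, hι, _, c, hc0, hc⟩ := e.exists_normalization
  have := eR.isDomain
  have hinj : Function.Injective ι := by
    intro a b hab
    apply e.injective
    rw [← hι, ← hι, hab]
  obtain ⟨n, hn⟩ := e.exists_hasPole hc0
  set q := Fintype.card F with hq
  have hq1 : 1 < q := Fintype.one_lt_card
  have hb0 : (PoleEmbedding.idealsOfDeg F R 0).ncard = 1 := by
    rw [Set.ncard_eq_one]
    refine ⟨⊤, Set.ext fun I => ⟨fun hI => (eR.deg_eq_zero_iff hI.1).mp hI.2, ?_⟩⟩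
    rintro rfl
    exact ⟨top_ne_bot, PoleEmbedding.deg_top⟩
  obtain ⟨s, hs, hN⟩ := exists_power_sums (q := q) (d := 2 * eR.genus) hb0
    (fun m hm => by rw [eR.ncard_idealsOfDeg_succ hm, hq, Nat.card_eq_fintype_card])
    eR.mul_ncard_idealsOfDeg
  obtain ⟨C, s₀, hC⟩ := M.exists_le_ncard_frobenius (AlgebraicClosure F)
  have hre : ∀ j, 1 ≤ j → (eR.pointCount j : ℝ) = (q : ℝ) ^ j - (s.map (· ^ j)).sum.re := by
    intro j hj
    have := congrArg Complex.re (hN j hj)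
    rw [Complex.sub_re, Complex.natCast_re, ← Nat.cast_pow, Complex.natCast_re] at this
    rw [this, Nat.cast_pow]
  have hnorm := norm_le_sqrt_of_sum_pow_re_le (s := s) (q := q) (C := C + n) (t₀ := max 1 s₀)
    (by positivity) (fun t ht => by
      have h1 := (hC t (le_trans (le_max_right _ _) ht)).2
      have ht1 : 1 ≤ 2 * t := by have := le_trans (le_max_left _ _) ht; omega
      have h2 := PoleEmbedding.ncard_frobPoints_le e eR hinj hn hc (AlgebraicClosure F) ht1
      have h3 := eR.ncard_frobPoints_le_pointCount (AlgebraicClosure F) ht1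
      have h4 : q ^ (2 * t) ≤ eR.pointCount (2 * t) + n + C * q ^ t := by
        refine h1.trans (Nat.add_le_add_right (h2.trans (Nat.add_le_add_right h3 _)) _)
      have h5 := hre _ ht1
      have h6 : ((q ^ (2 * t) : ℕ) : ℝ) ≤ _ := Nat.cast_le.mpr h4
      push_cast at h6
      have h7 : (1 : ℝ) ≤ (q : ℝ) ^ t := one_le_pow₀ (by exact_mod_cast hq1.le)
      have h8 : (n : ℝ) * 1 ≤ n * (q : ℝ) ^ t := by gcongr
      linarith)
  have h1 := hre 1 le_rfl
  have hsum : (s.map (· ^ 1)).sum.re ≤ 2 * eR.genus * √q := by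
    have h2 : ‖(s.map (· ^ 1)).sum‖ ≤ (s.map fun α => ‖α‖).sum := by
      have := norm_multiset_sum_le (s.map (· ^ 1))
      simpa using this
    have h3 : (s.map fun α => ‖α‖).sum ≤ s.card • √(q : ℝ) := by
      have := Multiset.sum_le_card_nsmul (s.map fun α => ‖α‖) (√(q : ℝ)) (by simpa using hnorm)
      simpa using this
    have h4 : (s.card : ℝ) ≤ 2 * eR.genus := by exact_mod_cast hs
    calc _ ≤ _ := Complex.re_le_norm _
      _ ≤ _ := h2.trans h3
      _ = s.card * √(q : ℝ) := nsmul_eq_mul _ _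
      _ ≤ _ := by gcongr
  have h2 := eR.pointCount_one_le
  have h3 : (Nat.card (R →ₐ[F] F) : ℝ) + eR.genus ≤ Nat.card (M.Ring →ₐ[F] F) + M.gaps.card := by
    exact_mod_cast PoleEmbedding.card_algHom_add_genus_le e eR hι
  have h4 : (eR.pointCount 1 : ℝ) ≤ Nat.card (R →ₐ[F] F) := by exact_mod_cast h2
  have h5 : (eR.genus : ℝ) ≤ M.gaps.card := by
    refine Nat.cast_le.mpr (Finset.card_le_card fun m hm => (e.mem_gaps m).mpr ?_)
    rintro ⟨z, hz⟩
    exact (eR.mem_gaps m).mp hm ⟨ι z, by rwa [hι]⟩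
  have h6 : 1 ≤ √(q : ℝ) := Real.one_le_sqrt.mpr (by exact_mod_cast hq1.le)
  rw [pow_one] at h1
  nlinarith

end PlaneModel

end WeilBound

section BranchAtInfinity

open Polynomial PowerSeries

theorem PowerSeries.exists_fixedPoint {R : Type*} [CommRing R] (Ψ : R⟦X⟧ → R⟦X⟧)
    (hΨ : ∀ n z z', (PowerSeries.X : R⟦X⟧) ^ n ∣ z - z' → PowerSeries.X ^ (n + 1) ∣ Ψ z - Ψ z') :
    ∃ z, Ψ z = z := by
  have h1 : ∀ n, (PowerSeries.X : R⟦X⟧) ^ n ∣ Ψ^[n + 1] 0 - Ψ^[n] 0 := by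
    intro n
    induction n with
    | zero => simp
    | succ n ih =>
      have := hΨ n _ _ ih
      rwa [← Function.iterate_succ_apply' Ψ, ← Function.iterate_succ_apply' Ψ] at this
  have h2 : ∀ m n, (PowerSeries.X : R⟦X⟧) ^ m ∣ Ψ^[m + n] 0 - Ψ^[m] 0 := by
    intro m n
    induction n with
    | zero => simp
    | succ n ih =>
      rw [← sub_add_sub_cancel _ (Ψ^[m + n] 0)]
      exact dvd_add ((pow_dvd_pow _ (Nat.le_add_right m n)).trans (h1 (m + n))) ih
  let z : R⟦X⟧ := PowerSeries.mk fun n => PowerSeries.coeff n (Ψ^[n + 1] 0)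
  have h3 : ∀ n, (PowerSeries.X : R⟦X⟧) ^ n ∣ z - Ψ^[n] 0 := by
    intro n
    rw [PowerSeries.X_pow_dvd_iff]
    intro m hm
    have := PowerSeries.X_pow_dvd_iff.mp (h2 (m + 1) (n - (m + 1))) m (Nat.lt_succ_self m)
    rw [Nat.add_sub_cancel' hm, map_sub] at this
    rw [map_sub, PowerSeries.coeff_mk, ← neg_sub, this, neg_zero]
  refine ⟨z, sub_eq_zero.mp (PowerSeries.ext fun n => ?_)⟩
  have h4 : (PowerSeries.X : R⟦X⟧) ^ (n + 1) ∣ Ψ z - z := by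
    have h5 := hΨ n _ _ (h3 n)
    rw [← Function.iterate_succ_apply' Ψ] at h5
    rw [← sub_sub_sub_cancel_right _ _ (Ψ^[n + 1] 0)]
    exact dvd_sub h5 (h3 (n + 1))
  rw [PowerSeries.X_pow_dvd_iff.mp h4 n (Nat.lt_succ_self n), map_zero]

variable {F : Type*} [Field F]

theorem HasPole.inv {f : Laurent F} {n : ℤ} (hf : HasPole f n) : HasPole f⁻¹ (-n) := by
  have h1 := hasPole_neg_order (inv_ne_zero hf.ne_zero)
  have h2 := hf.mul h1
  rw [mul_inv_cancel₀ hf.ne_zero] at h2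
  have h3 := h2.unique hasPole_one
  have h4 : -n = -(f⁻¹).order := by omega
  rwa [h4]

/-- The Laurent series attached to a power series. -/
noncomputable def Laurent.ofPowerSeries (F : Type*) [Field F] : F⟦X⟧ →+* Laurent F :=
  HahnSeries.ofPowerSeries ℤ F

theorem Laurent.ofPowerSeries_C (c : F) :
    Laurent.ofPowerSeries F (PowerSeries.C c) = algebraMap F (Laurent F) c :=
  HahnSeries.ofPowerSeries_C c

theorem Laurent.coeff_ofPowerSeries (z : F⟦X⟧) (n : ℤ) :
    (Laurent.ofPowerSeries F z).coeff n =
      if n < 0 then 0 else PowerSeries.coeff n.natAbs z :=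
  PowerSeries.coeff_coe z n

theorem hasPole_ofPowerSeries {z : F⟦X⟧} (hz : PowerSeries.constantCoeff z ≠ 0) :
    HasPole (Laurent.ofPowerSeries F z) 0 :=
  ⟨by rw [Laurent.coeff_ofPowerSeries]; simpa using hz, fun m hm => by
    rw [Laurent.coeff_ofPowerSeries, if_pos (by omega)]⟩

theorem hasPole_ofPowerSeries_X : HasPole (Laurent.ofPowerSeries F PowerSeries.X) (-1) :=
  ⟨by rw [Laurent.coeff_ofPowerSeries]; simp, fun m hm => by
    rw [Laurent.coeff_ofPowerSeries]
    split_ifs with h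
    · rfl
    · rw [PowerSeries.coeff_X, if_neg (by omega)]⟩

/-- The value at `(u, w)` of the equation of the curve
`B u ^ (k + 1) = ∑ d ≤ k, g_d u ^ (k - d) (w + ⋯ + w ^ d)`, where `k = deg g`. -/
noncomputable def curveEval (g : F[X]) (B : F) {A : Type*} [CommRing A] [Algebra F A]
    (u w : A) : A :=
  ∑ d ∈ Finset.range (g.natDegree + 1), ∑ i ∈ Finset.range d,
    algebraMap F A (g.coeff d) * u ^ (g.natDegree - d) * w ^ (d - i) -
      algebraMap F A B * u ^ (g.natDegree + 1)

/-- Exponents of the monomials in `curveEval`. -/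
def curveIndex (k : ℕ) : Finset (Σ _ : ℕ, ℕ) :=
  (Finset.range (k + 1)).sigma fun d => Finset.range d

theorem mem_curveIndex {k : ℕ} {t : Σ _ : ℕ, ℕ} : t ∈ curveIndex k ↔ t.1 ≤ k ∧ t.2 < t.1 := by
  simp [curveIndex]

theorem top_mem_curveIndex {k : ℕ} (hk : 1 ≤ k) : (⟨k, 0⟩ : Σ _ : ℕ, ℕ) ∈ curveIndex k :=
  mem_curveIndex.mpr ⟨le_rfl, hk⟩

theorem curveEval_eq_sum (g : F[X]) (B : F) {A : Type*} [CommRing A] [Algebra F A] (u w : A) :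
    curveEval g B u w = ∑ t ∈ curveIndex g.natDegree,
      algebraMap F A (g.coeff t.1) * u ^ (g.natDegree - t.1) * w ^ (t.1 - t.2) -
        algebraMap F A B * u ^ (g.natDegree + 1) := by
  rw [curveEval, curveIndex, Finset.sum_sigma]

theorem exists_curve_powerSeries (g : F[X]) {B : F} (hB : B ≠ 0) (hg : 1 ≤ g.natDegree) :
    ∃ z : F⟦X⟧, PowerSeries.constantCoeff z ≠ 0 ∧
      ∑ t ∈ curveIndex g.natDegree, PowerSeries.C (g.coeff t.1) *
        PowerSeries.X ^ (g.natDegree - t.1 + g.natDegree * t.2 + t.2) * z ^ (t.2 + 1) =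
      PowerSeries.C B := by
  classical
  set k := g.natDegree
  have hlc : g.coeff k ≠ 0 := by
    refine leadingCoeff_ne_zero.mpr ?_
    rintro rfl
    simp [k] at hg
  let S : F⟦X⟧ → F⟦X⟧ := fun z => ∑ t ∈ (curveIndex k).erase ⟨k, 0⟩, PowerSeries.C (g.coeff t.1) *
        PowerSeries.X ^ (k - t.1 + k * t.2 + t.2) * z ^ (t.2 + 1)
  have hexp : ∀ t ∈ (curveIndex k).erase ⟨k, 0⟩, 1 ≤ k - t.1 + k * t.2 + t.2 := by
    rintro ⟨d, i⟩ ht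
    obtain ⟨h1, h2⟩ := Finset.mem_erase.mp ht
    obtain ⟨h2, h3⟩ := mem_curveIndex.mp h2
    by_contra hlt
    refine h1 ?_
    dsimp only at *
    obtain rfl : i = 0 := by omega
    obtain rfl : d = k := by omega
    rfl
  obtain ⟨z, hz⟩ := PowerSeries.exists_fixedPoint
    (fun z : F⟦X⟧ => PowerSeries.C (g.coeff k)⁻¹ * (PowerSeries.C B - S z)) (by
      intro n z z' h
      rw [← mul_sub, sub_sub_sub_cancel_left]
      refine Dvd.dvd.mul_left ?_ _
      rw [← Finset.sum_sub_distrib]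
      refine Finset.dvd_sum fun t ht => ?_
      have h1 : (PowerSeries.X : F⟦X⟧) ∣ PowerSeries.X ^ (k - t.1 + k * t.2 + t.2) :=
        dvd_pow_self _ (by have := hexp t ht; omega)
      have h2 : (PowerSeries.X : F⟦X⟧) ^ n ∣ z' ^ (t.2 + 1) - z ^ (t.2 + 1) := by
        rw [← neg_sub, dvd_neg]
        exact h.trans (sub_dvd_pow_sub_pow _ _ _)
      rw [← mul_sub, pow_succ', mul_assoc]
      exact Dvd.dvd.mul_left (mul_dvd_mul h1 h2) _)
  refine ⟨z, ?_, ?_⟩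
  · rw [← hz]
    have : PowerSeries.constantCoeff (S z) = 0 := by
      rw [map_sum]
      refine Finset.sum_eq_zero fun t ht => ?_
      have := hexp t ht
      rw [map_mul, map_mul, map_pow, PowerSeries.constantCoeff_X, zero_pow (by omega), mul_zero,
        zero_mul]
    rw [map_mul, map_sub, this]
    simpa using ⟨hlc, hB⟩
  · rw [← Finset.add_sum_erase _ _ (top_mem_curveIndex hg)]
    change PowerSeries.C (g.coeff k) * _ * _ + S z = _
    have h1 : PowerSeries.C (g.coeff k) * z = PowerSeries.C B - S z := by
      nth_rw 1 [← hz]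
      rw [← mul_assoc, ← map_mul, mul_inv_cancel₀ hlc, map_one, one_mul]
    simp [h1]

theorem exists_curve_branch (g : F[X]) {B : F} (hB : B ≠ 0) (hg : 1 ≤ g.natDegree) :
    ∃ u w : Laurent F, HasPole u g.natDegree ∧ HasPole w (g.natDegree + 1 : ℕ) ∧
      curveEval g B u w = 0 := by
  obtain ⟨z, hz0, hz⟩ := exists_curve_powerSeries g hB hg
  set k := g.natDegree with hk
  set s := Laurent.ofPowerSeries F PowerSeries.X with hs
  set ζ := Laurent.ofPowerSeries F z with hζ
  have h1 : HasPole s (-1) := hasPole_ofPowerSeries_X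
  have h2 : HasPole ζ 0 := hasPole_ofPowerSeries hz0
  refine ⟨(s ^ k * ζ)⁻¹, (s ^ (k + 1) * ζ)⁻¹, ?_, ?_, ?_⟩
  · convert ((h1.pow k).mul h2).inv using 1
    ring
  · convert ((h1.pow (k + 1)).mul h2).inv using 1
    push_cast
    ring
  · have hs0 := h1.ne_zero
    have hζ0 := h2.ne_zero
    have h3 := congrArg (Laurent.ofPowerSeries F) hz
    simp only [map_sum, map_mul, map_pow, Laurent.ofPowerSeries_C] at h3
    rw [← hs, ← hζ] at h3
    rw [curveEval_eq_sum, ← hk, ← h3, Finset.sum_mul, sub_eq_zero]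
    refine Finset.sum_congr rfl ?_
    rintro ⟨d, i⟩ ht
    obtain ⟨hd, hi⟩ := mem_curveIndex.mp ht
    dsimp only at *
    obtain ⟨c, rfl⟩ := Nat.exists_eq_add_of_lt hi
    obtain ⟨e, he⟩ := Nat.exists_eq_add_of_le hd
    rw [show k - (i + c + 1) = e by omega, show i + c + 1 - i = c + 1 by omega, mul_assoc,
      mul_assoc, mul_assoc]
    congr 1
    have hk2 : k = i + c + 1 + e := he
    have h4 : s ^ (k + 1) * ζ = s ^ k * ζ * s := by ring
    have h5 : s ^ (e + k * i + i) * ζ ^ (i + 1) * s ^ (c + 1) = (s ^ k * ζ) ^ (i + 1) := by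
      have : e + k * i + i + (c + 1) = k * (i + 1) := by rw [mul_add]; omega
      rw [mul_pow, ← pow_mul, ← this]
      ring
    have hρ0 : s ^ k * ζ ≠ 0 := mul_ne_zero (pow_ne_zero _ hs0) hζ0
    have h6 : (s ^ k * ζ) ^ (k + 1) = s ^ (e + k * i + i) * ζ ^ (i + 1) *
        ((s ^ k * ζ) ^ e * (s ^ k * ζ * s) ^ (c + 1)) := by
      rw [mul_pow (s ^ k * ζ) s, show k + 1 = (i + 1) + (e + (c + 1)) by omega, pow_add, ← h5]
      ring
    rw [h4, inv_pow, inv_pow, inv_pow, h6, mul_inv, mul_inv (_ ^ e), ← mul_assoc _ (_ ^ _),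
      mul_inv_cancel_left₀ (mul_ne_zero (pow_ne_zero _ hs0) (pow_ne_zero _ hζ0))]

end BranchAtInfinity

section CurveBound

open Polynomial

theorem exists_gaps_succ {k : ℕ} (hk : 1 ≤ k) :
    ∃ G : Finset ℕ, 2 * G.card ≤ k * (k - 1) ∧
      ∀ n, n ∈ G ↔ ¬ ∃ i l, i * k + l * (k + 1) = n := by
  refine ⟨(Finset.range (k * k)).filter fun n => n / k < n % k, ?_, fun n => ?_⟩
  · have h : ((Finset.range (k * k)).filter fun n => n / k < n % k).card ≤
        ((Finset.range k).sigma fun r => Finset.range r).card := by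
      refine Finset.card_le_card_of_injOn (fun n => ⟨n % k, n / k⟩) ?_ ?_
      · intro n hn
        have := (Finset.mem_filter.mp hn).2
        simpa [this] using Nat.mod_lt n hk
      · intro m _ n _ h
        simp only [Sigma.mk.injEq, heq_eq_eq] at h
        rw [← Nat.div_add_mod m k, ← Nat.div_add_mod n k, h.1, h.2]
    rw [Finset.card_sigma] at h
    simp only [Finset.card_range] at h
    have := Finset.sum_range_id_mul_two k
    omega
  · have key : (∃ i l, i * k + l * (k + 1) = n) ↔ n % k ≤ n / k := by
      constructor
      · rintro ⟨i, l, rfl⟩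
        have h1 : i * k + l * (k + 1) = l + k * (i + l) := by ring
        rw [h1, Nat.add_mul_mod_self_left, Nat.add_mul_div_left _ _ hk]
        have := Nat.mod_le l k
        have := Nat.zero_le (l / k)
        lia
      · intro h
        refine ⟨n / k - n % k, n % k, ?_⟩
        conv_rhs => rw [← Nat.div_add_mod n k]
        obtain ⟨c, hc⟩ := Nat.exists_eq_add_of_le h
        rw [hc, Nat.add_sub_cancel_left]
        ring
    rw [Finset.mem_filter, Finset.mem_range, key, not_le]
    refine ⟨fun h => h.2, fun h => ⟨?_, h⟩⟩
    exact (Nat.div_lt_iff_lt_mul hk).mp (h.trans (Nat.mod_lt n hk))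

variable {F : Type*} [Field F]

theorem exists_planeModel_of_cast_ne_zero (g : F[X]) {B : F} (hB : B ≠ 0)
    (hg : 1 ≤ g.natDegree) (hk : (g.natDegree : F) ≠ 0) :
    ∃ M : PlaneModel F, 2 * M.gaps.card ≤ g.natDegree * (g.natDegree - 1) ∧
      ∀ u w : F, M.f.eval₂ (aeval u : F[X] →ₐ[F] F) w = 0 → curveEval g B u w = 0 := by
  classical
  obtain ⟨x, y, hx, hy, hxy⟩ := exists_curve_branch g hB hg
  obtain ⟨G, hG, hGmem⟩ := exists_gaps_succ hg
  set k := g.natDegree with hkdef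
  have hlc : g.coeff k ≠ 0 := by
    refine leadingCoeff_ne_zero.mpr ?_
    rintro rfl
    simp [k] at hg
  let r : F[X][X] := ∑ t ∈ (curveIndex k).erase ⟨k, 0⟩,
    C (C ((g.coeff k)⁻¹ * g.coeff t.1) * X ^ (k - t.1)) * X ^ (t.1 - t.2) -
      C (C ((g.coeff k)⁻¹ * B) * X ^ (k + 1))
  have hr : r.degree < (k : WithBot ℕ) := by
    refine (degree_sub_le _ _).trans_lt (max_lt ?_ ?_)
    · refine (degree_sum_le _ _).trans_lt ((Finset.sup_lt_iff ?_).mpr ?_)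
      · exact WithBot.bot_lt_coe k
      · rintro ⟨d, i⟩ ht
        obtain ⟨h1, h2⟩ := Finset.mem_erase.mp ht
        obtain ⟨h2, h3⟩ := mem_curveIndex.mp h2
        refine (degree_C_mul_X_pow_le _ _).trans_lt ?_
        dsimp only at *
        have : d - i < k := by
          by_contra hlt
          obtain rfl : i = 0 := by omega
          obtain rfl : d = k := by omega
          exact h1 rfl
        exact_mod_cast this
    · exact degree_C_le.trans_lt (by exact_mod_cast hg)
  have heval : ∀ {A : Type _} [CommRing A] [Algebra F A] (u w : A),
      algebraMap F A (g.coeff k) * (X ^ k + r).eval₂ (aeval u : F[X] →ₐ[F] A) w =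
        curveEval g B u w := by
    intro A _ _ u w
    have h1 : algebraMap F A (g.coeff k) * algebraMap F A (g.coeff k)⁻¹ = 1 := by
      rw [← map_mul, mul_inv_cancel₀ hlc, map_one]
    rw [curveEval_eq_sum, ← hkdef, ← Finset.add_sum_erase _ _ (top_mem_curveIndex hg)]
    simp only [r, eval₂_add, eval₂_sub, eval₂_finsetSum, eval₂_mul, eval₂_C, eval₂_X_pow]
    simp only [map_mul, map_pow, RingHom.coe_coe, aeval_C, aeval_X, Nat.sub_self, pow_zero,
      mul_one, Nat.sub_zero]
    rw [mul_add, mul_sub, Finset.mul_sum, add_sub_assoc]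
    congr 2
    · refine Finset.sum_congr rfl fun t _ => ?_
      linear_combination (algebraMap F A (g.coeff t.1) * u ^ (k - t.1) * w ^ (t.1 - t.2)) * h1
    · linear_combination (algebraMap F A B * u ^ (k + 1)) * h1
  refine ⟨{
    f := X ^ k + r
    monic := monic_X_pow_add hr
    a := k
    b := k + 1
    natDegree_eq := natDegree_eq_of_degree_eq_some (by
      rw [degree_add_eq_left_of_degree_lt (by rwa [degree_X_pow]), degree_X_pow])
    cast_ne := hk
    coprime := by simp
    x := x
    y := y
    hasPole_x := hx
    hasPole_y := hy
    root := ?_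
    gaps := G
    mem_gaps := hGmem }, hG, fun u w h => ?_⟩
  · have h1 := heval x y
    rw [hxy] at h1
    exact (mul_eq_zero.mp h1).resolve_left fun h => hlc (by simpa using h)
  · rw [← heval, h, mul_zero]

theorem exists_planeModel_of_cast_eq_zero (g : F[X]) {B : F} (hB : B ≠ 0)
    (hg : 1 ≤ g.natDegree) (hk : (g.natDegree : F) = 0) :
    ∃ M : PlaneModel F, 2 * M.gaps.card ≤ g.natDegree * (g.natDegree - 1) ∧
      ∀ u w : F, M.f.eval₂ (aeval u : F[X] →ₐ[F] F) w = 0 → curveEval g B w u = 0 := by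
  classical
  obtain ⟨x, y, hx, hy, hxy⟩ := exists_curve_branch g hB hg
  obtain ⟨G, hG, hGmem⟩ := exists_gaps_succ hg
  set k := g.natDegree with hkdef
  let r : F[X][X] := ∑ t ∈ curveIndex k,
    C (C (-B⁻¹ * g.coeff t.1) * X ^ (t.1 - t.2)) * X ^ (k - t.1)
  have hr : r.degree < ((k + 1 : ℕ) : WithBot ℕ) := by
    refine (degree_sum_le _ _).trans_lt ((Finset.sup_lt_iff ?_).mpr ?_)
    · exact WithBot.bot_lt_coe _
    · rintro ⟨d, i⟩ ht
      refine (degree_C_mul_X_pow_le _ _).trans_lt ?_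
      have : k - d < k + 1 := by omega
      exact_mod_cast this
  have heval : ∀ {A : Type _} [CommRing A] [Algebra F A] (u w : A),
      algebraMap F A (-B) * (X ^ (k + 1) + r).eval₂ (aeval u : F[X] →ₐ[F] A) w =
        curveEval g B w u := by
    intro A _ _ u w
    have h1 : algebraMap F A B * algebraMap F A B⁻¹ = 1 := by
      rw [← map_mul, mul_inv_cancel₀ hB, map_one]
    rw [curveEval_eq_sum, ← hkdef]
    simp only [r, eval₂_add, eval₂_finsetSum, eval₂_mul, eval₂_C, eval₂_X_pow]
    simp only [map_mul, map_pow, RingHom.coe_coe, aeval_C, aeval_X, map_neg]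
    rw [mul_add, Finset.mul_sum, add_comm, sub_eq_add_neg, neg_mul]
    congr 1
    refine Finset.sum_congr rfl fun t _ => ?_
    linear_combination (algebraMap F A (g.coeff t.1) * w ^ (k - t.1) * u ^ (t.1 - t.2)) * h1
  refine ⟨{
    f := X ^ (k + 1) + r
    monic := monic_X_pow_add hr
    a := k + 1
    b := k
    natDegree_eq := natDegree_eq_of_degree_eq_some (by
      rw [degree_add_eq_left_of_degree_lt (by rwa [degree_X_pow]), degree_X_pow])
    cast_ne := by simp [hk]
    coprime := by simp
    x := y
    y := x
    hasPole_x := hy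
    hasPole_y := hx
    root := ?_
    gaps := G
    mem_gaps := fun n => ?_ }, hG, fun u w h => ?_⟩
  · have h1 := heval y x
    rw [hxy] at h1
    exact (mul_eq_zero.mp h1).resolve_left fun h => hB (by simpa using h)
  · rw [hGmem, not_iff_not]
    constructor
    · rintro ⟨i, l, h⟩
      exact ⟨l, i, by rw [← h, add_comm]⟩
    · rintro ⟨i, l, h⟩
      exact ⟨l, i, by rw [← h, add_comm]⟩
  · rw [← heval, h, mul_zero]

theorem PlaneModel.algHom_mk (M : PlaneModel F) {K : Type*} [CommRing K] [Algebra F K]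
    (φ : M.Ring →ₐ[F] K) (p : F[X][X]) :
    φ (AdjoinRoot.mk M.f p) = p.eval₂ (aeval (φ M.cx) : F[X] →ₐ[F] K) (φ M.cy) := by
  have h1 : φ.comp (AdjoinRoot.ofAlgHom F M.f) = (aeval (φ M.cx) : F[X] →ₐ[F] K) :=
    Polynomial.algHom_ext (by simp [PlaneModel.cx])
  have h2 : (φ : M.Ring →+* K).comp (AdjoinRoot.mk M.f) =
      eval₂RingHom ((aeval (φ M.cx) : F[X] →ₐ[F] K) : F[X] →+* K) (φ M.cy) := by
    refine Polynomial.ringHom_ext (fun a => ?_) (by simp [PlaneModel.cy])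
    have := DFunLike.congr_fun h1 a
    simpa using this
  exact DFunLike.congr_fun h2 p

theorem PlaneModel.card_algHom_le_card_of_injective [Fintype F] (M : PlaneModel F) {S : Set (F × F)}
    (e : F × F → F × F) (he : Function.Injective e)
    (h : ∀ u w : F, M.f.eval₂ (aeval u : F[X] →ₐ[F] F) w = 0 → e (u, w) ∈ S) :
    Nat.card (M.Ring →ₐ[F] F) ≤ Nat.card S := by
  have hS : Finite S := Set.toFinite S
  refine Nat.card_le_card_of_injective
    (fun φ : M.Ring →ₐ[F] F => (⟨e (φ M.cx, φ M.cy), h _ _ ?_⟩ : S)) fun φ ψ hφψ => ?_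
  · rw [← M.algHom_mk, AdjoinRoot.mk_self, map_zero]
  · have := he (congrArg Subtype.val hφψ)
    exact M.algHom_ext (Prod.ext_iff.mp this).1 (Prod.ext_iff.mp this).2

theorem card_le_card_curveEval [Fintype F] (g : F[X]) {B : F} (hB : B ≠ 0)
    (hg : 1 ≤ g.natDegree) :
    (Fintype.card F : ℝ) ≤ Nat.card {p : F × F | curveEval g B p.1 p.2 = 0} +
      g.natDegree * (g.natDegree - 1 : ℝ) * √(Fintype.card F) := by
  obtain ⟨M, hM, hle⟩ : ∃ M : PlaneModel F, 2 * M.gaps.card ≤ g.natDegree * (g.natDegree - 1) ∧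
      Nat.card (M.Ring →ₐ[F] F) ≤ Nat.card {p : F × F | curveEval g B p.1 p.2 = 0} := by
    by_cases hk : (g.natDegree : F) = 0
    · obtain ⟨M, hM, h⟩ := exists_planeModel_of_cast_eq_zero g hB hg hk
      exact ⟨M, hM, M.card_algHom_le_card_of_injective Prod.swap Prod.swap_injective h⟩
    · obtain ⟨M, hM, h⟩ := exists_planeModel_of_cast_ne_zero g hB hg hk
      exact ⟨M, hM, M.card_algHom_le_card_of_injective id Function.injective_id h⟩
  refine M.card_le_card_algHom_add.trans (add_le_add (Nat.cast_le.mpr hle) ?_)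
  have h1 : ((2 * M.gaps.card : ℕ) : ℝ) ≤ _ := Nat.cast_le.mpr hM
  rw [Nat.cast_mul, Nat.cast_mul, Nat.cast_sub hg] at h1
  push_cast at h1
  gcongr

end CurveBound

section CurveCount

open Polynomial Finset

variable {F : Type*} [Field F]

/-- The value `x y (g(x) - g(y)) / (x - y)`, written as a polynomial in `x` and `y`. -/
def divDiffEval (g : F[X]) (x y : F) : F :=
  ∑ d ∈ range (g.natDegree + 1), ∑ i ∈ range d, g.coeff d * x ^ (i + 1) * y ^ (d - i)

theorem divDiffEval_mul_sub (g : F[X]) (x y : F) :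
    divDiffEval g x y * (x - y) = x * y * (g.eval x - g.eval y) := by
  rw [eval_eq_sum_range, eval_eq_sum_range, ← sum_sub_distrib, divDiffEval, sum_mul, mul_sum]
  refine sum_congr rfl fun d _ => ?_
  rw [← mul_sub, ← geom_sum₂_mul, sum_mul, sum_mul, mul_sum, mul_sum]
  refine sum_congr rfl fun i hi => ?_
  have h : d - i = d - 1 - i + 1 := by have := mem_range.mp hi; omega
  rw [h]
  ring

theorem divDiffEval_self (g : F[X]) (x : F) :
    divDiffEval g x x = ∑ d ∈ range (g.natDegree + 1), d * g.coeff d * x ^ (d + 1) := by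
  refine sum_congr rfl fun d _ => ?_
  rw [sum_congr rfl fun i hi => show g.coeff d * x ^ (i + 1) * x ^ (d - i) =
    g.coeff d * x ^ (d + 1) by
      have h : d + 1 = i + 1 + (d - i) := by have := mem_range.mp hi; omega
      rw [h, pow_add]; ring]
  rw [sum_const, card_range, nsmul_eq_mul, mul_assoc]

theorem curveEval_eq_mul (g : F[X]) (B : F) {u : F} (hu : u ≠ 0) (w : F) :
    curveEval g B u w = u ^ (g.natDegree + 1) * (divDiffEval g u⁻¹ (w / u) - B) := by
  rw [curveEval, divDiffEval, mul_sub, mul_sum, Algebra.algebraMap_self, RingHom.id_apply]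
  congr 1
  · refine sum_congr rfl fun d hd => ?_
    rw [mul_sum]
    refine sum_congr rfl fun i hi => ?_
    have h : g.natDegree + 1 = (g.natDegree - d) + (i + 1) + (d - i) := by
      have := mem_range.mp hi
      have := mem_range.mp hd
      omega
    rw [RingHom.id_apply, h, pow_add, pow_add, div_pow, inv_pow]
    field_simp
  · ring

theorem curveEval_zero_left (g : F[X]) (B : F) (w : F) :
    curveEval g B 0 w = g.leadingCoeff * ∑ i ∈ range g.natDegree, w ^ (i + 1) := by
  rw [curveEval, sum_range_succ, sum_eq_zero, zero_add, zero_pow (Nat.succ_ne_zero _), mul_zero,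
    sub_zero, mul_sum, ← sum_range_reflect]
  · refine sum_congr rfl fun i hi => ?_
    have h : g.natDegree - (g.natDegree - 1 - i) = i + 1 := by
      have := mem_range.mp hi
      omega
    rw [Nat.sub_self, pow_zero, mul_one, h]
    rfl
  · intro d hd
    have h : g.natDegree - d ≠ 0 := by have := mem_range.mp hd; omega
    simp [zero_pow h]

variable [Fintype F] [DecidableEq F]

theorem card_filter_pow_eq_one_le {k : ℕ} (hk : 1 ≤ k) :
    #{w : F | w ^ k = 1} ≤ k.gcd (Fintype.card F - 1) := by
  have h : ({w : F | w ^ k = 1} : Finset F) ⊆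
      (nthRoots (k.gcd (Fintype.card F - 1)) (1 : F)).toFinset := by
    intro w hw
    have hw1 := (mem_filter.mp hw).2
    have hw0 : w ≠ 0 := by
      rintro rfl
      rw [zero_pow (by omega)] at hw1
      exact zero_ne_one hw1
    rw [Multiset.mem_toFinset, mem_nthRoots (Nat.gcd_pos_of_pos_left _ hk)]
    have := pow_gcd_eq_one.mpr ⟨hw1, FiniteField.pow_card_sub_one_eq_one w hw0⟩
    exact this
  exact (card_le_card h).trans ((Multiset.toFinset_card_le _).trans (card_nthRoots _ _))

theorem card_filter_curveEval_zero_left_le (g : F[X]) (B : F) (hg : 1 ≤ g.natDegree) :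
    #{w : F | curveEval g B 0 w = 0} ≤
      g.natDegree.gcd (Fintype.card F - 1) + if (g.natDegree : F) = 0 then 1 else 0 := by
  set k := g.natDegree
  have hlc : g.leadingCoeff ≠ 0 := by
    refine leadingCoeff_ne_zero.mpr ?_
    rintro rfl
    simp [k] at hg
  have hsub : ({w : F | curveEval g B 0 w = 0} : Finset F) ⊆
      insert 0 (({w : F | w ^ k = 1} : Finset F).filter fun w => w = 1 → (k : F) = 0) := by
    intro w hw
    have h1 := (mem_filter.mp hw).2
    rw [curveEval_zero_left, mul_eq_zero, or_iff_right hlc] at h1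
    simp_rw [pow_succ] at h1
    rw [← sum_mul, mul_eq_zero, or_comm] at h1
    rw [mem_insert, mem_filter, mem_filter]
    refine h1.imp_right fun h2 => ⟨⟨mem_univ _, ?_⟩, ?_⟩
    · have := geom_sum_mul w k
      change (∑ i ∈ range k, w ^ i) = 0 at h2
      rw [h2, zero_mul] at this
      exact (sub_eq_zero.mp this.symm)
    · rintro rfl
      simpa using h2
  have h1 := card_filter_pow_eq_one_le (F := F) hg
  refine (card_le_card hsub).trans ((card_insert_le _ _).trans ?_)
  split_ifs with hk
  · exact Nat.add_le_add_right ((card_filter_le _ _).trans h1) 1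
  · rw [add_zero]
    refine le_trans (Nat.succ_le_of_lt (card_lt_card ?_)) h1
    refine filter_ssubset.mpr ⟨1, by simp, ?_⟩
    simp [hk]

theorem card_filter_divDiffEval_le (g : F[X]) {B : F} (hB : B ≠ 0) (x : F) :
    #{y : F | divDiffEval g x y = B} ≤ g.natDegree := by
  let P : F[X] := ∑ d ∈ range (g.natDegree + 1), ∑ i ∈ range d,
    C (g.coeff d * x ^ (i + 1)) * X ^ (d - i) - C B
  have hP : ∀ y, P.eval y = divDiffEval g x y - B := by
    intro y
    simp [P, eval_finsetSum, divDiffEval]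
  have h0 : P ≠ 0 := by
    intro h
    have := hP 0
    rw [h, eval_zero, divDiffEval, sum_eq_zero, zero_sub, zero_eq_neg] at this
    · exact hB this
    · refine fun d _ => sum_eq_zero fun i hi => ?_
      have : d - i ≠ 0 := by have := mem_range.mp hi; omega
      rw [zero_pow this, mul_zero]
  have hdeg : P.natDegree ≤ g.natDegree := by
    rw [natDegree_sub_C]
    refine natDegree_sum_le_of_forall_le _ _ fun d hd =>
      natDegree_sum_le_of_forall_le _ _ fun i _ => (natDegree_C_mul_X_pow_le _ _).trans ?_
    have := mem_range.mp hd
    omega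
  refine le_trans (card_le_card (t := P.roots.toFinset) fun y hy => ?_)
    ((Multiset.toFinset_card_le _).trans ((card_roots' P).trans hdeg))
  rw [Multiset.mem_toFinset, mem_roots h0, IsRoot, hP, (mem_filter.mp hy).2, sub_self]

theorem card_filter_divDiffEval_self_le (g : F[X]) {B : F} (hB : B ≠ 0) :
    #{x : F | divDiffEval g x x = B} + (if (g.natDegree : F) = 0 then 1 else 0) ≤
      g.natDegree + 1 := by
  let P : F[X] := ∑ d ∈ range (g.natDegree + 1), C (d * g.coeff d) * X ^ (d + 1) - C B
  have hP : ∀ x, P.eval x = divDiffEval g x x - B := by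
    intro y
    simp [P, eval_finsetSum, divDiffEval_self]
  have h0 : P ≠ 0 := by
    intro h
    have := hP 0
    rw [h, eval_zero, divDiffEval_self, sum_eq_zero, zero_sub, zero_eq_neg] at this
    · exact hB this
    · exact fun d _ => by rw [zero_pow (Nat.succ_ne_zero d), mul_zero]
  have hdeg : P.natDegree + (if (g.natDegree : F) = 0 then 1 else 0) ≤ g.natDegree + 1 := by
    rw [natDegree_sub_C]
    split_ifs with hk
    · refine Nat.add_le_add_right (natDegree_sum_le_of_forall_le _ _ fun d hd => ?_) 1
      rcases (Nat.lt_succ_iff.mp (mem_range.mp hd)).lt_or_eq with h | rfl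
      · exact (natDegree_C_mul_X_pow_le _ _).trans h
      · simp [hk]
    · refine natDegree_sum_le_of_forall_le _ _ fun d hd =>
        (natDegree_C_mul_X_pow_le _ _).trans ?_
      have := mem_range.mp hd
      omega
  refine le_trans (Nat.add_le_add_right ?_ _) hdeg
  refine le_trans (card_le_card (t := P.roots.toFinset) fun y hy => ?_)
    ((Multiset.toFinset_card_le _).trans (card_roots' P))
  rw [Multiset.mem_toFinset, mem_roots h0, IsRoot, hP, (mem_filter.mp hy).2, sub_self]

theorem card_filter_divDiffEval_add_le (g : F[X]) {B : F} (hB : B ≠ 0)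
    {π : F → F} (hπ : Function.Injective π) {O : Finset F} (h0 : 0 ∈ O)
    (hO : ∀ c, c ∉ O → π c = B / c + g.eval c) :
    #{p : F × F | p.1 ≠ 0 ∧ p.2 ≠ 0 ∧ divDiffEval g p.1 p.2 = B} +
      (if (g.natDegree : F) = 0 then 1 else 0) ≤ (g.natDegree + 1) * #O := by
  set k := g.natDegree with hk
  set D : Finset (F × F) := {p : F × F | p.1 ≠ 0 ∧ p.2 ≠ 0 ∧ divDiffEval g p.1 p.2 = B}
  have hD : ∀ {p : F × F}, p ∈ D ↔ p.1 ≠ 0 ∧ p.2 ≠ 0 ∧ divDiffEval g p.1 p.2 = B := by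
    simp [D]
  let D₁ := D.filter fun p => p.1 ∈ O.erase 0
  let D₂ := D.filter fun p => p.1 ∉ O ∧ p.2 ∈ O.erase 0
  let D₃ := D.filter fun p => p.1 = p.2
  have heq : ∀ p ∈ D, p.1 ≠ p.2 → B / p.1 + g.eval p.1 = B / p.2 + g.eval p.2 := by
    rintro ⟨x, y⟩ hp hne
    obtain ⟨hx, hy, h⟩ := hD.mp hp
    have h1 := divDiffEval_mul_sub g x y
    dsimp only at *
    rw [h] at h1
    field_simp
    linear_combination -h1
  have hsub : D ⊆ D₁ ∪ D₂ ∪ D₃ := by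
    rintro ⟨x, y⟩ hp
    obtain ⟨hx, hy, h⟩ := hD.mp hp
    simp only [D₁, D₂, D₃, mem_union, mem_filter, hp, true_and, mem_erase]
    dsimp only at *
    by_cases hxO : x ∈ O
    · exact Or.inl (Or.inl ⟨hx, hxO⟩)
    by_cases hyO : y ∈ O
    · exact Or.inl (Or.inr ⟨hxO, hy, hyO⟩)
    · right
      by_contra hne
      refine hne (hπ ?_)
      rw [hO x hxO, hO y hyO]
      exact heq _ hp hne
  have hc : #(O.erase 0) + 1 = #O := card_erase_add_one h0
  have h1 : #D₁ ≤ k * #(O.erase 0) := by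
    refine card_le_mul_card_image_of_maps_to (f := Prod.fst) (fun p hp => (mem_filter.mp hp).2) k
      fun x _ => ?_
    refine le_trans (card_le_card_of_injOn Prod.snd (fun p hp => ?_) fun p hp p' hp' h => ?_)
      (card_filter_divDiffEval_le g hB x)
    · obtain ⟨h2, rfl⟩ := mem_filter.mp hp
      simpa using (hD.mp (mem_filter.mp h2).1).2.2
    · exact Prod.ext ((mem_filter.mp hp).2.trans (mem_filter.mp hp').2.symm) h
  have h2 : #D₂ ≤ 1 * #(O.erase 0) := by
    refine card_le_mul_card_image_of_maps_to (f := Prod.snd)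
      (fun p hp => (mem_filter.mp hp).2.2) 1 fun y hy => card_le_one.mpr ?_
    rintro p hp p' hp'
    obtain ⟨hpD, rfl⟩ := mem_filter.mp hp
    obtain ⟨hpD', hpp⟩ := mem_filter.mp hp'
    obtain ⟨hp1, hp2, hp3⟩ := mem_filter.mp hpD
    obtain ⟨hp1', hp2', hp3'⟩ := mem_filter.mp hpD'
    refine Prod.ext (hπ ?_) hpp.symm
    rw [hO _ hp2, hO _ hp2', heq _ hp1, heq _ hp1', hpp]
    · rintro h
      exact hp2' (h ▸ mem_of_mem_erase hp3')
    · rintro h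
      exact hp2 (h ▸ mem_of_mem_erase hp3)
  have h3 : #D₃ ≤ #{x : F | divDiffEval g x x = B} := by
    refine card_le_card_of_injOn Prod.fst (fun p hp => ?_) fun p hp p' hp' h => ?_
    · obtain ⟨h4, h5⟩ := mem_filter.mp hp
      have := (hD.mp h4).2.2
      rw [← h5] at this
      simpa using this
    · exact Prod.ext h ((mem_filter.mp hp).2.symm.trans (h.trans (mem_filter.mp hp').2))
  have h4 := card_filter_divDiffEval_self_le g hB
  rw [← hk] at h4
  have h5 : #D ≤ #D₁ + #D₂ + #D₃ :=
    (card_le_card hsub).trans ((card_union_le _ _).trans (Nat.add_le_add_right (card_union_le _ _) _))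
  have h6 : (k + 1) * #O = k * #(O.erase 0) + 1 * #(O.erase 0) + (k + 1) := by
    rw [← hc]; ring
  omega

theorem card_curveEval_le (g : F[X]) {B : F} (hB : B ≠ 0) (hg : 1 ≤ g.natDegree)
    {π : F → F} (hπ : Function.Injective π) {O : Finset F} (h0 : 0 ∈ O)
    (hO : ∀ c, c ∉ O → π c = B / c + g.eval c) :
    Nat.card {p : F × F | curveEval g B p.1 p.2 = 0} ≤
      (g.natDegree + 1) * #O + g.natDegree.gcd (Fintype.card F - 1) := by
  have h1 := card_filter_curveEval_zero_left_le g B hg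
  have h2 := card_filter_divDiffEval_add_le g hB hπ h0 hO
  have h3 : Nat.card {p : F × F | curveEval g B p.1 p.2 = 0} =
      #{p : F × F | curveEval g B p.1 p.2 = 0} := by
    rw [Nat.card_coe_set_eq, ← Set.ncard_coe_finset]
    simp
  have h4 := card_filter_add_card_filter_not (s := {p : F × F | curveEval g B p.1 p.2 = 0})
    (fun p => p.1 = 0)
  have h5 : #(({p : F × F | curveEval g B p.1 p.2 = 0} : Finset (F × F)).filter
      fun p => p.1 = 0) ≤ #{w : F | curveEval g B 0 w = 0} := by
    refine card_le_card_of_injOn Prod.snd (fun p hp => ?_) fun p hp p' hp' h => ?_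
    · obtain ⟨h6, h7⟩ := mem_filter.mp hp
      rw [mem_filter, h7] at h6
      simpa using h6
    · exact Prod.ext ((mem_filter.mp hp).2.trans (mem_filter.mp hp').2.symm) h
  have h6 : #(({p : F × F | curveEval g B p.1 p.2 = 0} : Finset (F × F)).filter
      fun p => ¬ p.1 = 0) ≤
      #{p : F × F | p.1 ≠ 0 ∧ p.2 ≠ 0 ∧ divDiffEval g p.1 p.2 = B} := by
    refine card_le_card_of_injOn (fun p => (p.1⁻¹, p.2 / p.1)) (fun p hp => ?_)
      fun p hp p' hp' h => ?_
    · obtain ⟨h6, h7⟩ := mem_filter.mp hp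
      have h8 := (mem_filter.mp h6).2
      rw [curveEval_eq_mul g B h7, mul_eq_zero, or_iff_right (pow_ne_zero _ h7), sub_eq_zero] at h8
      have h9 : p.2 / p.1 ≠ 0 := by
        intro h
        rw [h, divDiffEval, sum_eq_zero] at h8
        · exact hB h8.symm
        · refine fun d _ => sum_eq_zero fun i hi => ?_
          have : d - i ≠ 0 := by have := mem_range.mp hi; omega
          rw [zero_pow this, mul_zero]
      simp only [coe_filter, mem_univ, true_and, Set.mem_ofPred_eq]
      exact ⟨inv_ne_zero h7, h9, h8⟩
    · have h7 := (mem_filter.mp hp).2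
      obtain ⟨h8, h9⟩ := Prod.ext_iff.mp h
      dsimp only at h8 h9
      have h8 := inv_injective h8
      rw [← h8] at h9
      exact Prod.ext h8 (by simpa [h7] using h9)
  omega

end CurveCount

section CarlitzReduction

variable {F : Type*} [Field F]

theorem carlitz_det (a : ℕ → F) (m : ℕ) :
    carlitzAlpha a (m + 1) * carlitzBeta a m - carlitzAlpha a m * carlitzBeta a (m + 1) =
      (-1) ^ m * a 0 := by
  induction m with
  | zero => simp [carlitzAlpha, carlitzBeta]
  | succ m ih =>
    rw [pow_succ, carlitzAlpha, carlitzBeta]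
    linear_combination -ih

theorem carlitzMap_eq_div [Fintype F] (hq : 3 ≤ Fintype.card F) (a : ℕ → F) {c : F} :
    ∀ m : ℕ, (∀ j, 1 ≤ j → j ≤ m → carlitzAlpha a j * c + carlitzBeta a j ≠ 0) →
      carlitzMap (Fintype.card F) a m c =
        (carlitzAlpha a (m + 1) * c + carlitzBeta a (m + 1)) /
          (carlitzAlpha a m * c + carlitzBeta a m)
  | 0, _ => by simp [carlitzMap, carlitzAlpha, carlitzBeta]
  | m + 1, h => by
    have ih := carlitzMap_eq_div hq a m fun j h1 h2 => h j h1 (h2.trans m.le_succ)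
    have hm := h (m + 1) (by omega) le_rfl
    have hm0 : carlitzAlpha a m * c + carlitzBeta a m ≠ 0 := by
      rcases Nat.eq_zero_or_pos m with rfl | hpos
      · simp [carlitzAlpha, carlitzBeta]
      · exact h m hpos m.le_succ
    have hz : (carlitzMap (Fintype.card F) a m c) ^ (Fintype.card F - 2) =
        (carlitzMap (Fintype.card F) a m c)⁻¹ := by
      have hne : carlitzMap (Fintype.card F) a m c ≠ 0 := by
        rw [ih]
        exact div_ne_zero hm hm0
      apply eq_inv_of_mul_eq_one_left
      rw [← pow_succ, show Fintype.card F - 2 + 1 = Fintype.card F - 1 by omega]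
      exact FiniteField.pow_card_sub_one_eq_one _ hne
    simp only [carlitzMap]
    rw [hz, ih, carlitzAlpha, carlitzBeta]
    field_simp
    ring

/-- Off a set of at most `n` points containing the last pole, a Carlitz representation of length
`n` agrees with a fractional transformation written as a constant plus a simple pole. -/
theorem exists_pole_set_of_carlitzRep [Fintype F] [DecidableEq F] (hq : 3 ≤ Fintype.card F)
    {f : F → F} {n : ℕ} (hn : 1 ≤ n) {a : ℕ → F} (ha : IsCarlitzRep (Fintype.card F) f n a)
    (hα : carlitzAlpha a n ≠ 0) :
    ∃ (A B P : F) (O : Finset F), B ≠ 0 ∧ 0 ∈ O ∧ O.card ≤ n ∧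
      ∀ c, c ∉ O → f (c + P) = B / c + A := by
  set P : F := -(carlitzBeta a n / carlitzAlpha a n) with hP
  refine ⟨carlitzAlpha a (n + 1) / carlitzAlpha a n,
    -((-1) ^ n * a 0) / carlitzAlpha a n ^ 2, P,
    (Finset.Icc 1 n).image fun m => -(carlitzBeta a m / carlitzAlpha a m) - P, ?_, ?_, ?_, ?_⟩
  · have := ha.1
    simp [hα, this]
  · rw [Finset.mem_image]
    exact ⟨n, by simpa using hn, by rw [hP, sub_self]⟩
  · exact Finset.card_image_le.trans (by simp)
  · intro c hc
    have hne : ∀ j, 1 ≤ j → j ≤ n → carlitzAlpha a j * (c + P) + carlitzBeta a j ≠ 0 := by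
      intro j h1 h2 h0
      by_cases hj : carlitzAlpha a j = 0
      · have hd := carlitz_det a (j - 1)
        rw [Nat.sub_add_cancel h1, hj] at hd
        rw [hj, zero_mul, zero_add] at h0
        rw [h0] at hd
        have := ha.1
        simp_all
      · apply hc
        rw [Finset.mem_image]
        refine ⟨j, by simp [h1, h2], ?_⟩
        field_simp
        linear_combination -h0
    have hc0 : c ≠ 0 := by
      rintro rfl
      apply hne n hn le_rfl
      rw [hP]
      field_simp
      ring
    rw [ha.2.2, carlitzMap_eq_div hq a n hne]
    have hd := carlitz_det a n
    have hden : carlitzAlpha a n * (c + P) + carlitzBeta a n = carlitzAlpha a n * c := by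
      rw [hP]
      field_simp
      ring
    rw [hden, ← hd, hP]
    field_simp
    ring

end CarlitzReduction

theorem difference_of_permutation_polynomials
    {F : Type*} [Field F] [Fintype F] (q n k : ℕ)
    (hq : Fintype.card F = q) (hq3 : 3 ≤ q)
    (f : F → F) (g : Polynomial F)
    (hf : Function.Bijective f)
    (hfg : Function.Bijective fun x => f x + g.eval x)
    (hn1 : 1 ≤ n) (hL1 : MemL1 q f n)
    (hk1 : 1 ≤ k) (hk2 : k < q - 1) (hdeg : g.natDegree = k) :
    (n : ℝ) * k + (k : ℝ) * ((k : ℝ) - 1) * Real.sqrt q ≥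
      (q : ℝ) - (Nat.gcd k (q - 1) : ℝ) - (n : ℝ) := by
  classical
  subst hq
  obtain ⟨-, -, a, ha, hα⟩ := hL1
  obtain ⟨A, B, P, O, hB, h0, hcard, hO⟩ := exists_pole_set_of_carlitzRep hq3 hn1 ha hα
  set h : Polynomial F := g.comp (Polynomial.X + Polynomial.C P) + Polynomial.C A with hh
  have hdegh : h.natDegree = k := by
    rw [hh, Polynomial.natDegree_add_C, Polynomial.natDegree_comp, Polynomial.natDegree_X_add_C,
      mul_one, hdeg]
  have hπ : Function.Injective fun x => f (x + P) + g.eval (x + P) :=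
    hfg.injective.comp (add_left_injective P)
  have hle := card_curveEval_le h hB (hk1.trans_eq hdegh.symm) hπ h0 fun c hc => by
    simp only [hO c hc, hh, Polynomial.eval_add, Polynomial.eval_comp, Polynomial.eval_X,
      Polynomial.eval_C]
    ring
  have hge := card_le_card_curveEval h hB (hk1.trans_eq hdegh.symm)
  rw [hdegh] at hle hge
  have hle' : (Nat.card {p : F × F | curveEval h B p.1 p.2 = 0} : ℝ) ≤
      (k + 1) * n + k.gcd (Fintype.card F - 1) := by
    exact_mod_cast hle.trans (by gcongr)
  linarith
end

section
/- Let q = p^r ≥ 3 be a prime power. Let f be a permutation polynomial of F_q with Carlitz rank Crk(f) = n ≥ 1 and f ∈ L₁. If n < (q − 1)/2, then f is not a complete mapping of F_q, i.e., f(x) + x is not a permutation polynomial of F_q. -/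
theorem carlitzAlpha_mul_carlitzBeta_sub {F : Type*} [Field F] (a : ℕ → F) (k : ℕ) :
    carlitzAlpha a (k + 1) * carlitzBeta a k - carlitzAlpha a k * carlitzBeta a (k + 1)
      = (-1) ^ k * a 0 := by
  induction k with
  | zero => simp [carlitzAlpha, carlitzBeta]
  | succ k ih =>
    rw [pow_succ, carlitzAlpha, carlitzBeta]
    linear_combination (-1) * ih

/-- Away from the poles, the Carlitz map agrees with its convergent. -/
theorem carlitzMap_mul_eq {F : Type*} [Field F] [Fintype F] (hq3 : 3 ≤ Fintype.card F)
    (a : ℕ → F) (x : F) (n : ℕ)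
    (h : ∀ i, 1 ≤ i → i ≤ n → carlitzAlpha a i * x + carlitzBeta a i ≠ 0) :
    carlitzMap (Fintype.card F) a n x * (carlitzAlpha a n * x + carlitzBeta a n)
      = carlitzAlpha a (n + 1) * x + carlitzBeta a (n + 1) := by
  induction n with
  | zero => simp [carlitzMap, carlitzAlpha, carlitzBeta]
  | succ n ih =>
    have ih := ih fun i h1 h2 => h i h1 (by omega)
    have hne := h (n + 1) (by omega) le_rfl
    rw [carlitzAlpha, carlitzBeta]
    change (carlitzMap (Fintype.card F) a n x ^ (Fintype.card F - 2) + a (n + 2)) * _ = _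
    generalize carlitzMap (Fintype.card F) a n x = y at ih ⊢
    have hy : y ≠ 0 := by
      rintro rfl
      exact hne (by rw [← ih, zero_mul])
    have hpow : y ^ (Fintype.card F - 2) * y = 1 := by
      rw [← pow_succ, ← FiniteField.pow_card_sub_one_eq_one y hy]
      congr 1
      omega
    linear_combination (-y ^ (Fintype.card F - 2)) * ih +
      (carlitzAlpha a n * x + carlitzBeta a n) * hpow

/-- A map agreeing with `x ↦ A + B / (x - c)` off a small set `E ∋ c` stays far from
injective after adding the identity, because `u ↦ B / u` preserves `u + B / u`. -/
theorem not_injective_add_id_of_eq_off {F : Type*} [Field F] [Fintype F]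
    (f : F → F) (E : Finset F) (A B c : F) (hB : B ≠ 0) (hc : c ∈ E)
    (hE : 2 * E.card + 2 ≤ Fintype.card F)
    (hf : ∀ x ∉ E, (f x - A) * (x - c) = B) :
    ¬ Function.Injective fun x => f x + x := by
  classical
  intro hinj
  let σ : F → F := fun x => c + B / (x - c)
  have hσ : Set.InjOn σ (Eᶜ : Finset F) := by
    intro x hx y hy hxy
    have hx0 : x - c ≠ 0 := sub_ne_zero.2 fun h => by simp_all
    have hy0 : y - c ≠ 0 := sub_ne_zero.2 fun h => by simp_all
    simp only [σ, add_right_inj] at hxy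
    rw [div_eq_div_iff hx0 hy0] at hxy
    linear_combination -(mul_left_cancel₀ hB hxy)
  have hunion : Eᶜ ∪ Eᶜ.image σ ⊆ {c}ᶜ := by
    intro x hx
    simp only [Finset.mem_compl, Finset.mem_singleton]
    rintro rfl
    rcases Finset.mem_union.1 hx with h | h
    · simp_all
    · obtain ⟨y, hy, hyx⟩ := Finset.mem_image.1 h
      have hy0 : y - x ≠ 0 := sub_ne_zero.2 fun h => by simp_all
      exact div_ne_zero hB hy0 (by simpa [σ] using hyx)
  have hfix : ∀ x ∈ Eᶜ ∩ Eᶜ.image σ, (x - c) ^ 2 = B := by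
    intro x hx
    obtain ⟨hxE, hxσ⟩ := Finset.mem_inter.1 hx
    obtain ⟨y, hy, rfl⟩ := Finset.mem_image.1 hxσ
    have hy0 : y - c ≠ 0 := sub_ne_zero.2 fun h => by simp_all
    have h1 := hf _ (Finset.mem_compl.1 hxE)
    have h2 := hf y (Finset.mem_compl.1 hy)
    have h3 : (σ y - c) * (y - c) = B := by simp [σ, hy0]
    have h3' : σ y - c ≠ 0 := fun h => hB (by rw [← h3, h, zero_mul])
    have h4 : f (σ y) - A = y - c := mul_right_cancel₀ h3' (by rw [h1, ← h3, mul_comm])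
    have h5 : f y - A = σ y - c := mul_right_cancel₀ hy0 (by rw [h2, h3])
    have h6 : σ y = y := hinj (by dsimp only; linear_combination h4 - h5)
    rw [← h3, h6, sq]
  have hinter : (Eᶜ ∩ Eᶜ.image σ).card ≤ 2 := by
    by_contra! h
    obtain ⟨x, y, z, hx, hy, hz, hxy, hxz, hyz⟩ := Finset.two_lt_card_iff.1 h
    have ex := hfix x hx
    have ey := hfix y hy
    have ez := hfix z hz
    have e1 : x + y - 2 * c = 0 :=
      (mul_eq_zero.1 (by linear_combination ex - ey :
        (x - y) * (x + y - 2 * c) = 0)).resolve_left (sub_ne_zero.2 hxy)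
    have e2 : x + z - 2 * c = 0 :=
      (mul_eq_zero.1 (by linear_combination ex - ez :
        (x - z) * (x + z - 2 * c) = 0)).resolve_left (sub_ne_zero.2 hxz)
    exact hyz (by linear_combination e1 - e2)
  have h1 := Finset.card_union_add_card_inter Eᶜ (Eᶜ.image σ)
  rw [Finset.card_image_of_injOn hσ] at h1
  have h2 := Finset.card_le_card hunion
  rw [Finset.card_compl, Finset.card_singleton] at h2
  rw [Finset.card_compl] at h1
  omega

theorem not_complete_mapping_of_small_carlitz_rank
    {F : Type*} [Field F] [Fintype F] (q n : ℕ)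
    (hq : Fintype.card F = q) (hq3 : 3 ≤ q)
    (f : F → F) (hf : Function.Bijective f)
    (hn1 : 1 ≤ n) (hL1 : MemL1 q f n)
    (hsmall : (n : ℝ) < ((q : ℝ) - 1) / 2) :
    ¬ Function.Bijective fun x => f x + x := by
  classical
  subst hq
  obtain ⟨-, -, a, ⟨ha0, -, hfa⟩, hα⟩ := hL1
  have hdet (k : ℕ) : carlitzAlpha a (k + 1) * carlitzBeta a k
      - carlitzAlpha a k * carlitzBeta a (k + 1) ≠ 0 := by
    rw [carlitzAlpha_mul_carlitzBeta_sub]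
    exact mul_ne_zero (pow_ne_zero _ (by simp)) ha0
  let E : Finset F := (Finset.Icc 1 n).image fun i => -carlitzBeta a i / carlitzAlpha a i
  have hEcard : E.card ≤ n := Finset.card_image_le.trans (by simp)
  have hn : 2 * n + 2 ≤ Fintype.card F := by
    have : 2 * n + 1 < Fintype.card F := by
      have : (2 * n + 1 : ℝ) < Fintype.card F := by linarith
      exact_mod_cast this
    omega
  refine fun hbij => not_injective_add_id_of_eq_off f E
    (carlitzAlpha a (n + 1) / carlitzAlpha a n)
    (-(carlitzAlpha a (n + 1) * carlitzBeta a n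
      - carlitzAlpha a n * carlitzBeta a (n + 1)) / carlitzAlpha a n ^ 2)
    (-carlitzBeta a n / carlitzAlpha a n)
    (div_ne_zero (neg_ne_zero.2 (hdet n)) (pow_ne_zero 2 hα))
    (Finset.mem_image_of_mem _ (Finset.mem_Icc.2 ⟨hn1, le_rfl⟩)) (by omega)
    (fun x hx => ?_) hbij.injective
  have key := carlitzMap_mul_eq hq3 a x n fun i hi1 hin h0 => by
    by_cases hi : carlitzAlpha a i = 0
    · refine hdet i ?_
      have hβ : carlitzBeta a i = 0 := by simpa [hi] using h0
      rw [hi, hβ]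
      ring
    · refine hx (Finset.mem_image.2 ⟨i, Finset.mem_Icc.2 ⟨hi1, hin⟩, ?_⟩)
      rw [div_eq_iff hi]
      linear_combination -h0
  rw [← hfa] at key
  field_simp
  linear_combination carlitzAlpha a n * key
end
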